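/- Let $S$, $K$, and the data $\alpha_k,l_k$ be as in the standing assumptions, with $g=\min(a_0, l_1-\alpha_1,\dots,l_m-\alpha_m)$, and let $\nu_z$ be the measure such that $T_z f=f*\nu_z$. Suppose $s_1>\max(0,\,1/\max(o(S),2)-g)$ and set $\beta=1/\max(o(S),2)$. Then, provided $K$ is supported in a sufficiently small neighborhood of the origin, there is a constant $C_{s_1}$ such that for all $z$ with $\mathrm{Re}(z)=s_1$ and all $\lambda\in\mathbf{R}^{n+1}$, $|\hat{\nu}_z(\lambda)|\le C_{s_1}(1+|\lambda|)^{-\beta}$; equivalently, $\|T_z f\|_{L^2_\beta(\mathbf{R}^{n+1})}\le C_{s_1}\|f\|_{L^2(\mathbf{R}^{n+1})}$. -/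

import Mathlib

open MeasureTheory Real Filter Topology Set
open scoped ENNReal

noncomputable section

namespace Paper

variable {n m : ℕ}

/-- The monomial `t ^ α`. -/
def monomial (α : Fin n → ℕ) (t : Fin n → ℝ) : ℝ := ∏ i, t i ^ α i

/-- `S` is real-analytic near the origin with Taylor coefficient family `c`:
its Taylor series at the origin converges to it near `0`. -/
def HasTaylorSeriesAtOrigin (S : (Fin n → ℝ) → ℝ) (c : (Fin n → ℕ) → ℝ) : Prop :=
  ∀ᶠ t in 𝓝 (0 : Fin n → ℝ), HasSum (fun α => c α * monomial α t) (S t)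

/-- The Newton polyhedron of the Taylor coefficient family `c`: the convex hull of
the octants above the exponents of the nonzero coefficients. -/
def newtonPolyhedron (c : (Fin n → ℕ) → ℝ) : Set (Fin n → ℝ) :=
  convexHull ℝ {x : Fin n → ℝ | ∃ α : Fin n → ℕ, c α ≠ 0 ∧ ∀ i, (α i : ℝ) ≤ x i}

/-- The vertices (extreme points) of the Newton polyhedron. -/
def newtonVertices (c : (Fin n → ℕ) → ℝ) : Set (Fin n → ℝ) :=
  Set.extremePoints ℝ (newtonPolyhedron c)

/-- `f^*`, the sum of the absolute values of the vertex monomials. -/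
def starFn (c : (Fin n → ℕ) → ℝ) (t : Fin n → ℝ) : ℝ :=
  ∑' v : newtonVertices c, ∏ i, |t i| ^ ((v : Fin n → ℝ) i)

/-- Compact (exposed) faces of the Newton polyhedron; a vertex is a face of dimension zero. -/
def IsCompactFace (c : (Fin n → ℕ) → ℝ) (F : Set (Fin n → ℝ)) : Prop :=
  IsExposed ℝ (newtonPolyhedron c) F ∧ F.Nonempty ∧ IsCompact F

/-- The face polynomial `f_F(t) = ∑_{α ∈ F} f_α t^α`. -/
def facePoly (c : (Fin n → ℕ) → ℝ) (F : Set (Fin n → ℝ)) (t : Fin n → ℝ) : ℝ :=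
  ∑' α : {α : Fin n → ℕ // (fun i => (α i : ℝ)) ∈ F}, c α.1 * monomial α.1 t

/-- The order of vanishing of `g` at `x`. -/
def vanishingOrder (g : (Fin n → ℝ) → ℝ) (x : Fin n → ℝ) : ℕ∞ :=
  sSup {k : ℕ∞ | ∀ j : ℕ, (j : ℕ∞) < k → iteratedFDeriv ℝ j g x = 0}

/-- `o(f)`: the maximum order of a zero of a compact face polynomial on `(ℝ ∖ {0})^n`
(`0` if there are no such zeroes). -/
def newtonOrder (c : (Fin n → ℕ) → ℝ) : ℕ∞ :=
  sSup {k : ℕ∞ | ∃ F : Set (Fin n → ℝ), IsCompactFace c F ∧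
    ∃ x : Fin n → ℝ, (∀ i, x i ≠ 0) ∧ facePoly c F x = 0 ∧
      k ≤ vanishingOrder (facePoly c F) x}

/-- The Euclidean norm `|t_k|` of the `k`-th group of variables. -/
def grpNorm (grp : Fin n → Fin m) (k : Fin m) (t : Fin n → ℝ) : ℝ :=
  Real.sqrt (∑ i ∈ Finset.univ.filter (fun i => grp i = k), t i ^ 2)

/-- The weight `∏_k |t_k|^{-α_k}`. -/
def kernelWeight (grp : Fin n → Fin m) (a : Fin m → ℝ) (t : Fin n → ℝ) : ℝ :=
  ∏ k, grpNorm grp k t ^ (-(a k))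

/-- The measure `dμ = ∏_k |t_k|^{-α_k} dm`, `m` being Lebesgue measure. -/
def fracMeasure (grp : Fin n → Fin m) (a : Fin m → ℝ) : Measure (Fin n → ℝ) :=
  volume.withDensity fun t => ENNReal.ofReal (kernelWeight grp a t)

/-- The characterization (1.5) of the sublevel growth exponents `a₀`, `d₀`. -/
def IsSublevelExponent (grp : Fin n → Fin m) (a : Fin m → ℝ) (c : (Fin n → ℕ) → ℝ)
    (a₀ : ℝ) (d₀ : ℕ) : Prop :=
  0 < a₀ ∧ d₀ ≤ n - 1 ∧ ∃ r₀ > (0 : ℝ), ∀ r : ℝ, 0 < r → r < r₀ →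
    ∃ b B : ℝ, 0 < b ∧ 0 < B ∧ ∀ ε : ℝ, 0 < ε → ε < 1/2 →
      ENNReal.ofReal (b * ε ^ a₀ * |Real.log ε| ^ d₀) <
          fracMeasure grp a {t | (∀ i, t i ∈ Set.Ioo 0 r) ∧ starFn c t < ε} ∧
        fracMeasure grp a {t | (∀ i, t i ∈ Set.Ioo 0 r) ∧ starFn c t < ε} <
          ENNReal.ofReal (B * ε ^ a₀ * |Real.log ε| ^ d₀)

/-- The kernel bounds (1.2a)-(1.2b): `K` is `C¹` off the coordinate hyperplanes,
`|K(t)| ≤ C ∏_k |t_k|^{-α_k}` and `|∂_{t_i} K(t)| ≤ C |t_i|⁻¹ ∏_k |t_k|^{-α_k}`. -/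
def KernelBounds (grp : Fin n → Fin m) (a : Fin m → ℝ) (K : (Fin n → ℝ) → ℝ) : Prop :=
  ContDiffOn ℝ 1 K {t | ∀ i, t i ≠ 0} ∧
  ∃ C : ℝ, ∀ t : Fin n → ℝ, (∀ i, t i ≠ 0) →
    |K t| ≤ C * kernelWeight grp a t ∧
    ∀ i : Fin n, |fderiv ℝ K t (Pi.single i 1)| ≤ C / |t i| * kernelWeight grp a t

/-- The averaging operator (1.1),
`Tf(x, x_{n+1}) = ∫ f(x - t, x_{n+1} - S(t)) K(t) dt`. -/
def radonOp (S K : (Fin n → ℝ) → ℝ) (f : (Fin (n+1) → ℝ) → ℂ) :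
    (Fin (n+1) → ℝ) → ℂ :=
  fun x => ∫ t : Fin n → ℝ, (K t : ℂ) * f (fun j => x j - Fin.snoc (α := fun _ => ℝ) t (S t) j)

/-- The Fourier transform on `ℝ^N`. -/
def fourierTransform {N : ℕ} (g : (Fin N → ℝ) → ℂ) (ξ : Fin N → ℝ) : ℂ :=
  ∫ x : Fin N → ℝ,
    Complex.exp (-2 * (Real.pi : ℂ) * Complex.I * ((∑ i, x i * ξ i : ℝ) : ℂ)) * g x

/-- The inverse Fourier transform on `ℝ^N`. -/
def fourierInv {N : ℕ} (g : (Fin N → ℝ) → ℂ) (x : Fin N → ℝ) : ℂ :=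
  ∫ ξ : Fin N → ℝ,
    Complex.exp (2 * (Real.pi : ℂ) * Complex.I * ((∑ i, x i * ξ i : ℝ) : ℂ)) * g ξ

/-- The Bessel potential `(I - Δ)^{β/2} g`, defined via the Fourier transform. -/
def besselPotential {N : ℕ} (β : ℝ) (g : (Fin N → ℝ) → ℂ) : (Fin N → ℝ) → ℂ :=
  fun x => fourierInv
    (fun ξ => (((1 + ∑ i, ξ i ^ 2) ^ (β / 2) : ℝ) : ℂ) * fourierTransform g ξ) x

/-- `T` is bounded from `L^p(ℝ^N)` to the `L^p` Sobolev space `L^p_β(ℝ^N)`,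
whose norm is `‖(I - Δ)^{β/2} f‖_{L^p}`. -/
def BddLpSobolev {N : ℕ} (p β : ℝ)
    (T : ((Fin N → ℝ) → ℂ) → ((Fin N → ℝ) → ℂ)) : Prop :=
  ∃ C : ℝ, 0 ≤ C ∧ ∀ f : SchwartzMap (Fin N → ℝ) ℂ,
    eLpNorm (besselPotential β (T ⇑f)) (ENNReal.ofReal p) volume ≤
      ENNReal.ofReal C * eLpNorm (⇑f) (ENNReal.ofReal p) volume

/-- `min(|t₁|,...,|tₙ|, S^*(t))`. -/
def minFactor (c : (Fin n → ℕ) → ℝ) (t : Fin n → ℝ) : ℝ :=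
  min (⨅ i, |t i|) (starFn c t)

/-- The analytic family (3.1):
`T_z f(x) = e^{z²} ∫ (min(|t₁|,...,|tₙ|,S^*(t)))^z f(x - t, x_{n+1} - S(t)) K(t) dt`. -/
def radonOpZ (S K : (Fin n → ℝ) → ℝ) (c : (Fin n → ℕ) → ℝ) (z : ℂ)
    (f : (Fin (n+1) → ℝ) → ℂ) : (Fin (n+1) → ℝ) → ℂ :=
  fun x => Complex.exp (z ^ 2) *
    ∫ t : Fin n → ℝ,
      ((minFactor c t : ℂ) ^ z) * (K t : ℂ) * f (fun j => x j - Fin.snoc (α := fun _ => ℝ) t (S t) j)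

/-- The Fourier transform (3.8) of the convolution kernel `ν_z` of `T_z`. -/
def nuHatZ (S K : (Fin n → ℝ) → ℝ) (c : (Fin n → ℕ) → ℝ) (z : ℂ)
    (lam : Fin (n+1) → ℝ) : ℂ :=
  Complex.exp (z ^ 2) *
    ∫ t : Fin n → ℝ,
      Complex.exp (Complex.I *
          (((∑ i, lam i.castSucc * t i) + lam (Fin.last n) * S t : ℝ) : ℂ)) *
        ((minFactor c t : ℂ) ^ z) * (K t : ℂ)


section

/-- oscillating exponential -/
def osc (x : ℝ) : ℂ := Complex.exp (Complex.I * (x : ℂ))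

lemma norm_osc (x : ℝ) : ‖osc x‖ = 1 := by
  unfold osc; rw [mul_comm]; exact Complex.norm_exp_ofReal_mul_I x

lemma continuous_osc : Continuous osc := by unfold osc; fun_prop

lemma osc_neg (x : ℝ) : osc (-x) = (starRingEnd ℂ) (osc x) := by
  unfold osc; rw [← Complex.exp_conj]; simp

lemma hasDerivAt_osc {φ : ℝ → ℝ} {φ' s : ℝ} (h : HasDerivAt φ φ' s) :
    HasDerivAt (fun s => osc (φ s)) (osc (φ s) * (Complex.I * (φ' : ℂ))) s := by
  unfold osc
  exact (h.ofReal_comp.const_mul Complex.I).cexp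

lemma vdc_one {φ φ1 φ2 : ℝ → ℝ} {a b Λ : ℝ} (hab : a ≤ b) (hΛ : 0 < Λ)
    (h1 : ∀ s ∈ Icc a b, HasDerivAt φ (φ1 s) s)
    (h2 : ∀ s ∈ Icc a b, HasDerivAt φ1 (φ2 s) s)
    (hc : ContinuousOn φ2 (Icc a b))
    (hl : ∀ s ∈ Icc a b, Λ ≤ |φ1 s|) :
    ‖∫ s in a..b, osc (φ s)‖ ≤ 2 / Λ + ∫ s in a..b, |φ2 s| / (φ1 s) ^ 2 := by
  have hI : uIcc a b = Icc a b := uIcc_of_le hab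
  have hne : ∀ s ∈ Icc a b, φ1 s ≠ 0 := fun s hs h0 => by
    have := hl s hs; rw [h0] at this; simp at this; linarith
  have hφc : ContinuousOn φ (Icc a b) := fun s hs => (h1 s hs).continuousAt.continuousWithinAt
  have hφ1c : ContinuousOn φ1 (Icc a b) := fun s hs => (h2 s hs).continuousAt.continuousWithinAt
  have hcc : ContinuousOn (fun s => osc (φ s)) (Icc a b) := continuous_osc.comp_continuousOn hφc
  set u : ℝ → ℂ := fun s => (((φ1 s)⁻¹ : ℝ) : ℂ) * (-Complex.I) with hu
  set u' : ℝ → ℂ := fun s => ((-(φ2 s) / (φ1 s)^2 : ℝ) : ℂ) * (-Complex.I) with hu'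
  have hud : ∀ s ∈ Icc a b, HasDerivAt u (u' s) s := fun s hs =>
    (((h2 s hs).inv (hne s hs)).ofReal_comp).mul_const _
  have hquot : ContinuousOn (fun s => -(φ2 s) / (φ1 s)^2) (Icc a b) :=
    (hc.neg).div (hφ1c.pow 2) (fun s hs => pow_ne_zero _ (hne s hs))
  have hu'c : ContinuousOn u' (Icc a b) :=
    (Complex.continuous_ofReal.comp_continuousOn hquot).mul continuousOn_const
  have hv'c : ContinuousOn (fun s => osc (φ s) * (Complex.I * (φ1 s : ℂ))) (Icc a b) :=
    hcc.mul (continuousOn_const.mul (Complex.continuous_ofReal.comp_continuousOn hφ1c))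
  have hparts := intervalIntegral.integral_mul_deriv_eq_deriv_mul (a := a) (b := b)
    (u := u) (v := fun s => osc (φ s)) (u' := u')
    (v' := fun s => osc (φ s) * (Complex.I * (φ1 s : ℂ)))
    (fun s hs => hud s (hI ▸ hs)) (fun s hs => hasDerivAt_osc (h1 s (hI ▸ hs)))
    ((hI.symm ▸ hu'c : ContinuousOn u' (uIcc a b)).intervalIntegrable)
    ((hI.symm ▸ hv'c : ContinuousOn _ (uIcc a b)).intervalIntegrable)
  have heq : ∫ s in a..b, osc (φ s) =
      ∫ s in a..b, u s * (osc (φ s) * (Complex.I * (φ1 s : ℂ))) := by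
    apply intervalIntegral.integral_congr
    intro s hs
    rw [hI] at hs
    have : (φ1 s : ℂ) ≠ 0 := by exact_mod_cast hne s hs
    simp only [hu]
    push_cast
    field_simp
    simp
  rw [heq, hparts]
  have hub : ∀ s ∈ Icc a b, ‖u s‖ ≤ 1 / Λ := by
    intro s hs
    simp only [hu, norm_mul, norm_neg, Complex.norm_I, mul_one, Complex.norm_real, norm_inv,
      Real.norm_eq_abs]
    rw [← one_div]
    exact one_div_le_one_div_of_le hΛ (hl s hs)
  have e1 : ‖u b * osc (φ b)‖ ≤ 1 / Λ := by
    rw [norm_mul, norm_osc, mul_one]; exact hub b (right_mem_Icc.2 hab)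
  have e2 : ‖u a * osc (φ a)‖ ≤ 1 / Λ := by
    rw [norm_mul, norm_osc, mul_one]; exact hub a (left_mem_Icc.2 hab)
  have e3 : ‖∫ s in a..b, u' s * osc (φ s)‖ ≤ ∫ s in a..b, |φ2 s| / (φ1 s) ^ 2 := by
    apply (intervalIntegral.norm_integral_le_integral_norm hab).trans_eq
    apply intervalIntegral.integral_congr
    intro s _
    simp [hu', norm_osc]
  calc _ ≤ ‖u b * osc (φ b) - u a * osc (φ a)‖ + ‖∫ s in a..b, u' s * osc (φ s)‖ := norm_sub_le _ _
    _ ≤ (‖u b * osc (φ b)‖ + ‖u a * osc (φ a)‖) + ‖∫ s in a..b, u' s * osc (φ s)‖ := by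
        gcongr; exact norm_sub_le _ _
    _ ≤ (1 / Λ + 1 / Λ) + ∫ s in a..b, |φ2 s| / (φ1 s) ^ 2 := by gcongr
    _ = _ := by ring

lemma vdc_one_mono {φ φ1 φ2 : ℝ → ℝ} {a b Λ : ℝ} (hab : a ≤ b) (hΛ : 0 < Λ)
    (h1 : ∀ s ∈ Icc a b, HasDerivAt φ (φ1 s) s)
    (h2 : ∀ s ∈ Icc a b, HasDerivAt φ1 (φ2 s) s)
    (hc : ContinuousOn φ2 (Icc a b))
    (hl : ∀ s ∈ Icc a b, Λ ≤ φ1 s)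
    (hm : (∀ s ∈ Icc a b, 0 ≤ φ2 s) ∨ (∀ s ∈ Icc a b, φ2 s ≤ 0)) :
    ‖∫ s in a..b, osc (φ s)‖ ≤ 3 / Λ := by
  have hl' : ∀ s ∈ Icc a b, Λ ≤ |φ1 s| := fun s hs => (hl s hs).trans (le_abs_self _)
  have hI : uIcc a b = Icc a b := uIcc_of_le hab
  have hne : ∀ s ∈ Icc a b, φ1 s ≠ 0 := fun s hs h0 => by
    have := hl s hs; rw [h0] at this; linarith
  have hφ1c : ContinuousOn φ1 (Icc a b) := fun s hs => (h2 s hs).continuousAt.continuousWithinAt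
  have hquot : ContinuousOn (fun s => -(φ2 s) / (φ1 s)^2) (Icc a b) :=
    (hc.neg).div (hφ1c.pow 2) (fun s hs => pow_ne_zero _ (hne s hs))
  have key : ∫ s in a..b, -(φ2 s) / (φ1 s)^2 = (φ1 b)⁻¹ - (φ1 a)⁻¹ := by
    apply intervalIntegral.integral_eq_sub_of_hasDerivAt (f := fun s => (φ1 s)⁻¹)
    · intro s hs; exact (h2 s (hI ▸ hs)).inv (hne s (hI ▸ hs))
    · exact (hI.symm ▸ hquot : ContinuousOn _ (uIcc a b)).intervalIntegrable
  have pa : 0 < (φ1 a)⁻¹ ∧ (φ1 a)⁻¹ ≤ 1/Λ := by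
    have := hl a (left_mem_Icc.2 hab)
    rw [← one_div]
    exact ⟨one_div_pos.2 (hΛ.trans_le this), one_div_le_one_div_of_le hΛ this⟩
  have pb : 0 < (φ1 b)⁻¹ ∧ (φ1 b)⁻¹ ≤ 1/Λ := by
    have := hl b (right_mem_Icc.2 hab)
    rw [← one_div]
    exact ⟨one_div_pos.2 (hΛ.trans_le this), one_div_le_one_div_of_le hΛ this⟩
  have hb : ∫ s in a..b, |φ2 s| / (φ1 s) ^ 2 ≤ 1 / Λ := by
    rcases hm with hm | hm
    · have : ∫ s in a..b, |φ2 s| / (φ1 s) ^ 2 = - ∫ s in a..b, -(φ2 s) / (φ1 s)^2 := by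
        rw [← intervalIntegral.integral_neg]
        apply intervalIntegral.integral_congr
        intro s hs
        simp only [abs_of_nonneg (hm s (hI ▸ hs))]
        ring
      rw [this, key]; linarith [pa.1, pa.2, pb.1, pb.2]
    · have : ∫ s in a..b, |φ2 s| / (φ1 s) ^ 2 = ∫ s in a..b, -(φ2 s) / (φ1 s)^2 := by
        apply intervalIntegral.integral_congr
        intro s hs
        simp only [abs_of_nonpos (hm s (hI ▸ hs))]
      rw [this, key]; linarith [pa.1, pa.2, pb.1, pb.2]
  calc _ ≤ _ := vdc_one hab hΛ h1 h2 hc hl'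
    _ ≤ 2 / Λ + 1 / Λ := by gcongr
    _ = _ := by ring

lemma norm_integral_osc_neg (φ : ℝ → ℝ) (a b : ℝ) :
    ‖∫ s in a..b, osc (- φ s)‖ = ‖∫ s in a..b, osc (φ s)‖ := by
  have : ∫ s in a..b, osc (- φ s) = (starRingEnd ℂ) (∫ s in a..b, osc (φ s)) := by
    simp_rw [osc_neg]
    simp only [intervalIntegral]
    rw [integral_conj, integral_conj, map_sub]
  rw [this, RCLike.norm_conj]

lemma norm_integral_osc_le (φ : ℝ → ℝ) {a b : ℝ} (hab : a ≤ b) :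
    ‖∫ s in a..b, osc (φ s)‖ ≤ b - a := by
  have := intervalIntegral.norm_integral_le_of_norm_le_const (a := a) (b := b) (C := 1)
    (f := fun s => osc (φ s)) (fun s _ => (norm_osc _).le)
  rwa [one_mul, abs_of_nonneg (by linarith)] at this

def vdcC : ℕ → ℝ
  | 0 => 0
  | 1 => 3
  | (k+2) => 2 * vdcC (k+1) + 2

lemma vdcC_nonneg : ∀ k, 0 ≤ vdcC k
  | 0 => le_rfl
  | 1 => by norm_num [vdcC]
  | (k+2) => by have := vdcC_nonneg (k+1); simp only [vdcC]; linarith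

lemma vdc_pos (k : ℕ) : ∀ (Φ : ℕ → ℝ → ℝ) (a b Λ : ℝ), a ≤ b → 0 < Λ →
    (∀ j, ∀ s ∈ Icc a b, HasDerivAt (Φ j) (Φ (j+1) s) s) →
    (∀ s ∈ Icc a b, Λ ≤ Φ (k+1) s) →
    (k = 0 → (∀ s ∈ Icc a b, 0 ≤ Φ 2 s) ∨ (∀ s ∈ Icc a b, Φ 2 s ≤ 0)) →
    ‖∫ s in a..b, osc (Φ 0 s)‖ ≤ vdcC (k+1) * Λ ^ (-(1 / ((k:ℝ)+1))) := by
  induction k with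
  | zero =>
    intro Φ a b Λ hab hΛ hd hl hm
    have := vdc_one_mono hab hΛ (hd 0) (hd 1)
      (fun s hs => (hd 2 s hs).continuousAt.continuousWithinAt) hl (hm rfl)
    refine this.trans_eq ?_
    simp [vdcC, Real.rpow_neg hΛ.le]; ring
  | succ k ih =>
    intro Φ a b Λ hab hΛ hd hl _
    set η : ℝ := Λ ^ (-(1 / ((k:ℝ)+2))) with hη
    have hηpos : 0 < η := Real.rpow_pos_of_pos hΛ _
    have hcont : ∀ j, ContinuousOn (Φ j) (Icc a b) :=
      fun j s hs => (hd j s hs).continuousAt.continuousWithinAt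
    -- growth
    have hgrow : ∀ x ∈ Icc a b, ∀ y ∈ Icc a b, x ≤ y → Λ * (y - x) ≤ Φ (k+1) y - Φ (k+1) x := by
      intro x hx y hy hxy
      apply (convex_Icc a b).mul_sub_le_image_sub_of_le_deriv (hcont _) _ _ x hx y hy hxy
      · intro s hs
        exact (hd _ s (interior_subset hs)).differentiableAt.differentiableWithinAt
      · intro s hs
        rw [(hd _ s (interior_subset hs)).deriv]; exact hl s (interior_subset hs)
    obtain ⟨x0, hx0, hx0a, hx0b⟩ : ∃ x0 ∈ Icc a b,
        (∀ s ∈ Icc a b, s < x0 → Λ * (x0 - s) ≤ - Φ (k+1) s) ∧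
        (∀ s ∈ Icc a b, x0 < s → Λ * (s - x0) ≤ Φ (k+1) s) := by
      have ha := left_mem_Icc.2 hab
      have hb := right_mem_Icc.2 hab
      by_cases h1 : 0 ≤ Φ (k+1) a
      · refine ⟨a, ha, fun s hs hsa => ?_, fun s hs has => ?_⟩
        · exact absurd hs.1 (not_le.2 hsa)
        · have := hgrow a ha s hs has.le; linarith
      · by_cases h2 : Φ (k+1) b ≤ 0
        · refine ⟨b, hb, fun s hs hsa => ?_, fun s hs has => ?_⟩
          · have := hgrow s hs b hb hsa.le; linarith
          · exact absurd hs.2 (not_le.2 has)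
        · push Not at h1 h2
          obtain ⟨x0, hx0, h0⟩ := intermediate_value_Icc hab (hcont (k+1)) ⟨h1.le, h2.le⟩
          refine ⟨x0, hx0, fun s hs hsa => ?_, fun s hs has => ?_⟩
          · have := hgrow s hs x0 hx0 hsa.le; linarith
          · have := hgrow x0 hx0 s hs has.le; linarith
    set p := max a (x0 - η) with hp
    set q := min b (x0 + η) with hq
    have hap : a ≤ p := le_max_left _ _
    have hqb : q ≤ b := min_le_left _ _
    have hpx : p ≤ x0 := max_le hx0.1 (by linarith)
    have hxq : x0 ≤ q := le_min hx0.2 (by linarith)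
    have hpb : p ≤ b := hpx.trans hx0.2
    have haq : a ≤ q := hx0.1.trans hxq
    have hlen : q - p ≤ 2 * η := by
      have h1 : x0 - η ≤ p := le_max_right _ _
      have h2 : q ≤ x0 + η := min_le_right _ _
      linarith
    have hΛη : (Λ * η) ^ (-(1 / ((k:ℝ)+1))) = η := by
      have : Λ * η = Λ ^ (((k:ℝ)+1)/((k:ℝ)+2)) := by
        rw [hη]; nth_rewrite 1 [← Real.rpow_one Λ]
        rw [← Real.rpow_add hΛ]; congr 1; field_simp; ring
      rw [this, ← Real.rpow_mul hΛ.le, hη]; congr 1; field_simp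
    have hmono2 : k = 0 → ∀ s ∈ Icc a b, 0 ≤ Φ 2 s := by
      rintro rfl s hs; exact hΛ.le.trans (hl s hs)
    have hcosc : ContinuousOn (fun s => osc (Φ 0 s)) (Icc a b) :=
      continuous_osc.comp_continuousOn (hcont 0)
    have hintg : ∀ x y, x ∈ Icc a b → y ∈ Icc a b →
        IntervalIntegrable (fun s => osc (Φ 0 s)) volume x y := by
      intro x y hx hy
      exact (hcosc.mono (uIcc_subset_Icc hx hy)).intervalIntegrable
    have hpm : p ∈ Icc a b := ⟨hap, hpb⟩
    have hqm : q ∈ Icc a b := ⟨haq, hqb⟩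
    have hsplit : ∫ s in a..b, osc (Φ 0 s) = (∫ s in a..p, osc (Φ 0 s)) +
        (∫ s in p..q, osc (Φ 0 s)) + ∫ s in q..b, osc (Φ 0 s) := by
      rw [intervalIntegral.integral_add_adjacent_intervals (hintg _ _ (left_mem_Icc.2 hab) hpm)
        (hintg _ _ hpm hqm), intervalIntegral.integral_add_adjacent_intervals
        (hintg _ _ (left_mem_Icc.2 hab) hqm) (hintg _ _ hqm (right_mem_Icc.2 hab))]
    have hCk := vdcC_nonneg (k+1)
    have b3 : ‖∫ s in q..b, osc (Φ 0 s)‖ ≤ vdcC (k+1) * η := by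
      rcases hqb.eq_or_lt with h | h
      · rw [h]; simp; positivity
      · have hq' : q = x0 + η := by
          rw [hq]; apply min_eq_right; by_contra hh; push Not at hh
          rw [hq, min_eq_left hh.le] at h; exact lt_irrefl _ h
        have hsub : Icc q b ⊆ Icc a b := Icc_subset_Icc_left haq
        have := ih Φ q b (Λ * η) hqb (by positivity) (fun j s hs => hd j s (hsub hs))
          (fun s hs => ?_) (fun hk => Or.inl fun s hs => hmono2 hk s (hsub hs))
        · rwa [hΛη] at this
        · have h1 : x0 + η ≤ s := hq' ▸ hs.1
          refine le_trans ?_ (hx0b s (hsub hs) (by linarith))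
          gcongr; linarith
    have b1 : ‖∫ s in a..p, osc (Φ 0 s)‖ ≤ vdcC (k+1) * η := by
      rcases hap.eq_or_lt with h | h
      · rw [← h]; simp; positivity
      · have hq' : p = x0 - η := by
          rw [hp]; apply max_eq_right; by_contra hh; push Not at hh
          rw [hp, max_eq_left hh.le] at h; exact lt_irrefl _ h
        have hsub : Icc a p ⊆ Icc a b := Icc_subset_Icc_right hpb
        have := ih (fun j s => - Φ j s) a p (Λ * η) hap (by positivity)
          (fun j s hs => (hd j s (hsub hs)).neg)
          (fun s hs => ?_) (fun hk => Or.inr fun s hs => by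
            have := hmono2 hk s (hsub hs); simpa using this)
        · rw [norm_integral_osc_neg] at this
          rwa [hΛη] at this
        · have h1 : s ≤ x0 - η := hq' ▸ hs.2
          refine le_trans ?_ (hx0a s (hsub hs) (by linarith))
          gcongr; linarith
    have b2 : ‖∫ s in p..q, osc (Φ 0 s)‖ ≤ 2 * η :=
      (norm_integral_osc_le _ (hpx.trans hxq)).trans hlen
    have e : Λ ^ (-(1 / (((k+1:ℕ):ℝ)+1))) = η := by
      rw [hη]; congr 3; push_cast; ring
    rw [e, hsplit]
    calc _ ≤ ‖∫ s in a..p, osc (Φ 0 s)‖ + ‖∫ s in p..q, osc (Φ 0 s)‖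
        + ‖∫ s in q..b, osc (Φ 0 s)‖ := norm_add₃_le
      _ ≤ vdcC (k+1) * η + 2 * η + vdcC (k+1) * η := by gcongr
      _ = vdcC (k+1+1) * η := by simp only [vdcC]; ring

/-- van der Corput, order at least two, two-sided. -/
lemma vdc {k : ℕ} (hk : 2 ≤ k) {Φ : ℕ → ℝ → ℝ} {a b Λ : ℝ} (hab : a ≤ b) (hΛ : 0 < Λ)
    (hd : ∀ j, ∀ s ∈ Icc a b, HasDerivAt (Φ j) (Φ (j+1) s) s)
    (hl : (∀ s ∈ Icc a b, Λ ≤ Φ k s) ∨ (∀ s ∈ Icc a b, Φ k s ≤ -Λ)) :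
    ‖∫ s in a..b, osc (Φ 0 s)‖ ≤ vdcC k * Λ ^ (-(1 / (k:ℝ))) := by
  obtain ⟨k, rfl⟩ : ∃ k', k = k' + 1 := ⟨k - 1, by omega⟩
  rcases hl with hl | hl
  · have := vdc_pos k Φ a b Λ hab hΛ hd hl (by omega)
    simpa using this
  · have := vdc_pos k (fun j s => - Φ j s) a b Λ hab hΛ (fun j s hs => (hd j s hs).neg)
      (fun s hs => by have := hl s hs; linarith) (by omega)
    rw [norm_integral_osc_neg] at this
    simpa using this

/-- real amplitude lemma -/
lemma real_amp {e ψ : ℝ → ℝ} {h A L B : ℝ} (hh : 0 ≤ h) (hL : 0 ≤ L)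
    (he : ContinuousOn e (Icc 0 h)) (hB : ∀ x ∈ Icc 0 h, |∫ s in (0:ℝ)..x, e s| ≤ B)
    (hA : ∀ s ∈ Icc 0 h, |ψ s| ≤ A)
    (hψ : ∀ s ∈ Icc 0 h, ∀ s' ∈ Icc 0 h, |ψ s - ψ s'| ≤ L * |s - s'|) :
    |∫ s in (0:ℝ)..h, e s * ψ s| ≤ B * (A + L * h) := by
  have hI : uIcc 0 h = Icc 0 h := uIcc_of_le hh
  have hB0 : 0 ≤ B := (abs_nonneg _).trans (hB 0 (left_mem_Icc.2 hh))
  have hei : IntervalIntegrable e volume 0 h := (hI.symm ▸ he : ContinuousOn e (uIcc 0 h)).intervalIntegrable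
  set I : ℝ → ℝ := fun x => ∫ s in (0:ℝ)..x, e s with hIdef
  have hIac : AbsolutelyContinuousOnInterval I 0 h :=
    hei.absolutelyContinuousOnInterval_intervalIntegral (by simp)
  have hψL : LipschitzOnWith L.toNNReal ψ (uIcc 0 h) := by
    rw [hI]
    apply LipschitzOnWith.of_dist_le_mul
    intro x hx y hy
    rw [Real.dist_eq, Real.dist_eq, Real.coe_toNNReal _ hL]; exact hψ x hx y hy
  have hψac := hψL.absolutelyContinuousOnInterval
  have hparts := hIac.integral_mul_deriv_eq_deriv_mul hψac
  have hder : ∫ x in (0:ℝ)..h, deriv I x * ψ x = ∫ s in (0:ℝ)..h, e s * ψ s := by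
    apply intervalIntegral.integral_congr_ae
    have : ∀ᵐ x : ℝ, x ≠ h := by
      simp [ae_iff, measure_singleton]
    filter_upwards [this] with x hxh hx
    rw [uIoc_of_le hh] at hx
    have hx' : x ∈ Ioo 0 h := ⟨hx.1, lt_of_le_of_ne hx.2 hxh⟩
    have : HasDerivAt I (e x) x := by
      apply intervalIntegral.integral_hasDerivAt_right
      · exact hei.mono_set (by rw [hI, uIcc_of_le hx.1.le]; exact Icc_subset_Icc_right hx.2)
      · exact ContinuousOn.stronglyMeasurableAtFilter (s := Ioo 0 h) isOpen_Ioo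
          (he.mono Ioo_subset_Icc_self) x hx'
      · exact he.continuousAt (Icc_mem_nhds hx'.1 hx'.2)
    rw [this.deriv]
  rw [hder] at hparts
  have hI0 : I 0 = 0 := by simp [hIdef]
  have e1 : ∫ s in (0:ℝ)..h, e s * ψ s = I h * ψ h - ∫ x in (0:ℝ)..h, I x * deriv ψ x := by
    rw [hparts, hI0]; ring
  have e2 : |∫ x in (0:ℝ)..h, I x * deriv ψ x| ≤ (B * L) * h := by
    have := intervalIntegral.norm_integral_le_of_norm_le_const_ae (a := 0) (b := h) (C := B * L)
      (f := fun x => I x * deriv ψ x) ?_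
    · simpa [abs_of_nonneg hh] using this
    · have : ∀ᵐ x : ℝ, x ≠ h := by
        simp [ae_iff, measure_singleton]
      filter_upwards [this] with x hxh hx
      rw [uIoc_of_le hh] at hx
      have hx' : x ∈ Ioo 0 h := ⟨hx.1, lt_of_le_of_ne hx.2 hxh⟩
      rw [norm_mul]
      gcongr
      · exact hB x ⟨hx.1.le, hx.2⟩
      · have := norm_deriv_le_of_lipschitzOn (f := ψ) (x₀ := x) (C := L.toNNReal) (s := Icc 0 h)
          (Icc_mem_nhds hx'.1 hx'.2) (hI ▸ hψL)
        rwa [Real.coe_toNNReal _ hL] at this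
  rw [e1]
  calc _ ≤ |I h * ψ h| + |∫ x in (0:ℝ)..h, I x * deriv ψ x| := abs_sub _ _
    _ ≤ B * A + (B * L) * h := by
      gcongr
      rw [abs_mul]
      have := hB h (right_mem_Icc.2 hh)
      have h2 := hA h (right_mem_Icc.2 hh)
      gcongr
    _ = _ := by ring

/-- complex amplitude lemma -/
lemma cplx_amp {e ψ : ℝ → ℂ} {h A B : ℝ} (hh : 0 ≤ h) (hA0 : 0 ≤ A)
    (he : ContinuousOn e (Icc 0 h)) (hB : ∀ x ∈ Icc 0 h, ‖∫ s in (0:ℝ)..x, e s‖ ≤ B)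
    (hA : ∀ s ∈ Icc 0 h, ‖ψ s‖ ≤ A)
    (hψ : ∀ s ∈ Icc 0 h, ∀ s' ∈ Icc 0 h, ‖ψ s - ψ s'‖ ≤ A * |s - s'|) :
    ‖∫ s in (0:ℝ)..h, e s * ψ s‖ ≤ 4 * B * A * (1 + h) := by
  have hI : uIcc 0 h = Icc 0 h := uIcc_of_le hh
  have hψc : ContinuousOn ψ (Icc 0 h) := by
    have : LipschitzOnWith A.toNNReal ψ (Icc 0 h) := by
      apply LipschitzOnWith.of_dist_le_mul
      intro x hx y hy
      rw [dist_eq_norm, Real.dist_eq, Real.coe_toNNReal _ hA0]; exact hψ x hx y hy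
    exact this.continuousOn
  have ii : ∀ {x}, x ∈ Icc 0 h → ∀ {f : ℝ → ℂ}, ContinuousOn f (Icc 0 h) →
      IntervalIntegrable f volume 0 x := by
    intro x hx f hf
    exact (hf.mono (by rw [uIcc_of_le hx.1]; exact Icc_subset_Icc_right hx.2)).intervalIntegrable
  have reI : ∀ x ∈ Icc 0 h, ∀ {f : ℝ → ℂ}, ContinuousOn f (Icc 0 h) →
      ∫ s in (0:ℝ)..x, (f s).re = (∫ s in (0:ℝ)..x, f s).re := by
    intro x hx f hf
    have := Complex.reCLM.intervalIntegral_comp_comm (ii hx hf)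
    simpa using this
  have imI : ∀ x ∈ Icc 0 h, ∀ {f : ℝ → ℂ}, ContinuousOn f (Icc 0 h) →
      ∫ s in (0:ℝ)..x, (f s).im = (∫ s in (0:ℝ)..x, f s).im := by
    intro x hx f hf
    have := Complex.imCLM.intervalIntegral_comp_comm (ii hx hf)
    simpa using this
  have ere : ContinuousOn (fun s => (e s).re) (Icc 0 h) := Complex.continuous_re.comp_continuousOn he
  have eim : ContinuousOn (fun s => (e s).im) (Icc 0 h) := Complex.continuous_im.comp_continuousOn he
  have pre : ContinuousOn (fun s => (ψ s).re) (Icc 0 h) := Complex.continuous_re.comp_continuousOn hψc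
  have pim : ContinuousOn (fun s => (ψ s).im) (Icc 0 h) := Complex.continuous_im.comp_continuousOn hψc
  have B1 : ∀ x ∈ Icc 0 h, |∫ s in (0:ℝ)..x, (e s).re| ≤ B := fun x hx => by
    rw [reI x hx he]; exact (Complex.abs_re_le_norm _).trans (hB x hx)
  have B2 : ∀ x ∈ Icc 0 h, |∫ s in (0:ℝ)..x, (e s).im| ≤ B := fun x hx => by
    rw [imI x hx he]; exact (Complex.abs_im_le_norm _).trans (hB x hx)
  have A1 : ∀ s ∈ Icc 0 h, |(ψ s).re| ≤ A := fun s hs => (Complex.abs_re_le_norm _).trans (hA s hs)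
  have A2 : ∀ s ∈ Icc 0 h, |(ψ s).im| ≤ A := fun s hs => (Complex.abs_im_le_norm _).trans (hA s hs)
  have L1 : ∀ s ∈ Icc 0 h, ∀ s' ∈ Icc 0 h, |(ψ s).re - (ψ s').re| ≤ A * |s - s'| :=
    fun s hs s' hs' => by
      rw [← Complex.sub_re]; exact (Complex.abs_re_le_norm _).trans (hψ s hs s' hs')
  have L2 : ∀ s ∈ Icc 0 h, ∀ s' ∈ Icc 0 h, |(ψ s).im - (ψ s').im| ≤ A * |s - s'| :=
    fun s hs s' hs' => by
      rw [← Complex.sub_im]; exact (Complex.abs_im_le_norm _).trans (hψ s hs s' hs')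
  have r1 := real_amp hh hA0 ere B1 A1 L1
  have r2 := real_amp hh hA0 eim B2 A2 L2
  have r3 := real_amp hh hA0 ere B1 A2 L2
  have r4 := real_amp hh hA0 eim B2 A1 L1
  have hr := right_mem_Icc.2 hh
  have iir : ∀ {f : ℝ → ℝ}, ContinuousOn f (Icc 0 h) → IntervalIntegrable f volume 0 h :=
    fun hf => (hI.symm ▸ hf : ContinuousOn _ (uIcc 0 h)).intervalIntegrable
  have hre : (∫ s in (0:ℝ)..h, e s * ψ s).re =
      (∫ s in (0:ℝ)..h, (e s).re * (ψ s).re) - ∫ s in (0:ℝ)..h, (e s).im * (ψ s).im := by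
    rw [← reI h hr (f := fun s => e s * ψ s) (he.mul hψc), ← intervalIntegral.integral_sub (iir (ere.fun_mul pre)) (iir (eim.fun_mul pim))]
    simp
  have him : (∫ s in (0:ℝ)..h, e s * ψ s).im =
      (∫ s in (0:ℝ)..h, (e s).re * (ψ s).im) + ∫ s in (0:ℝ)..h, (e s).im * (ψ s).re := by
    rw [← imI h hr (f := fun s => e s * ψ s) (he.mul hψc), ← intervalIntegral.integral_add (iir (ere.fun_mul pim)) (iir (eim.fun_mul pre))]
    simp
  calc _ ≤ |(∫ s in (0:ℝ)..h, e s * ψ s).re| + |(∫ s in (0:ℝ)..h, e s * ψ s).im| :=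
        Complex.norm_le_abs_re_add_abs_im _
    _ ≤ (B * (A + A * h) + B * (A + A * h)) + (B * (A + A * h) + B * (A + A * h)) := by
        rw [hre, him]
        gcongr
        · exact (abs_sub _ _).trans (add_le_add r1 r2)
        · exact (abs_add_le _ _).trans (add_le_add r3 r4)
    _ = _ := by ring

end

section

/-- cast of an exponent -/
def rc (α : Fin n → ℕ) : Fin n → ℝ := fun i => (α i : ℝ)

/-- dot product -/
def dt (w x : Fin n → ℝ) : ℝ := ∑ i, w i * x i

lemma rc_inj {α β : Fin n → ℕ} (h : rc α = rc β) : α = β := by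
  funext i; have := congrFun h i; simpa [rc] using this

lemma dt_add (w x y : Fin n → ℝ) : dt w (x + y) = dt w x + dt w y := by
  simp [dt, mul_add, Finset.sum_add_distrib]

lemma dt_smul (w : Fin n → ℝ) (a : ℝ) (x : Fin n → ℝ) : dt w (a • x) = a * dt w x := by
  simp only [dt, Finset.mul_sum, Pi.smul_apply, smul_eq_mul]
  exact Finset.sum_congr rfl fun i _ => by ring

lemma dt_mono {w x y : Fin n → ℝ} (hw : ∀ i, 0 < w i) (h : ∀ i, x i ≤ y i) : dt w x ≤ dt w y :=
  Finset.sum_le_sum fun i _ => mul_le_mul_of_nonneg_left (h i) (hw i).le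

lemma dt_eq_of_le {w x y : Fin n → ℝ} (hw : ∀ i, 0 < w i) (h : ∀ i, x i ≤ y i)
    (he : dt w y ≤ dt w x) : x = y := by
  have h1 := (Finset.sum_eq_sum_iff_of_le (s := Finset.univ) (f := fun i => w i * x i)
    (g := fun i => w i * y i) (fun i _ => mul_le_mul_of_nonneg_left (h i) (hw i).le)).1
    (le_antisymm (dt_mono hw h) he)
  funext i
  exact mul_left_cancel₀ (hw i).ne' (h1 i (Finset.mem_univ i))

/-- the generating set of the Newton polyhedron -/
def genSet (c : (Fin n → ℕ) → ℝ) : Set (Fin n → ℝ) :=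
  {x : Fin n → ℝ | ∃ α : Fin n → ℕ, c α ≠ 0 ∧ ∀ i, (α i : ℝ) ≤ x i}

lemma rc_mem_genSet {c : (Fin n → ℕ) → ℝ} {α : Fin n → ℕ} (h : c α ≠ 0) : rc α ∈ genSet c :=
  ⟨α, h, fun _ => le_rfl⟩

lemma rc_mem_poly {c : (Fin n → ℕ) → ℝ} {α : Fin n → ℕ} (h : c α ≠ 0) :
    rc α ∈ newtonPolyhedron c := subset_convexHull ℝ _ (rc_mem_genSet h)

lemma exists_min_weight {c : (Fin n → ℕ) → ℝ} (hc : c ≠ 0) {w : Fin n → ℝ} (hw : ∀ i, 0 < w i) :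
    ∃ α0, c α0 ≠ 0 ∧ ∀ α, c α ≠ 0 → dt w (rc α0) ≤ dt w (rc α) := by
  obtain ⟨β, hβ⟩ : ∃ β, c β ≠ 0 := Function.ne_iff.1 hc
  set s : Set (Fin n → ℕ) := {α | c α ≠ 0 ∧ dt w (rc α) ≤ dt w (rc β)} with hs
  have hfin : s.Finite := by
    apply (Set.finite_Iic (fun i => ⌈dt w (rc β) / w i⌉₊)).subset
    rintro α ⟨_, h⟩ i
    have h1 : w i * (α i : ℝ) ≤ dt w (rc α) :=
      Finset.single_le_sum (f := fun i => w i * rc α i)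
        (fun j _ => mul_nonneg (hw j).le (Nat.cast_nonneg _)) (Finset.mem_univ i)
    have : (α i : ℝ) ≤ dt w (rc β) / w i := by
      rw [le_div_iff₀ (hw i)]; linarith
    exact_mod_cast this.trans (Nat.le_ceil _)
  obtain ⟨α0, h0, hm⟩ := hfin.exists_minimalFor (fun α => dt w (rc α)) s ⟨β, hβ, le_rfl⟩
  refine ⟨α0, h0.1, fun α hα => ?_⟩
  by_cases h : dt w (rc α) ≤ dt w (rc β)
  · rcases le_total (dt w (rc α0)) (dt w (rc α)) with h' | h'
    · exact h'
    · exact hm ⟨hα, h⟩ h'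
  · exact h0.2.trans (not_le.1 h).le

/-- face cut out by a weight -/
def wFace (c : (Fin n → ℕ) → ℝ) (w : Fin n → ℝ) (d : ℝ) : Set (Fin n → ℝ) :=
  {x | x ∈ newtonPolyhedron c ∧ dt w x = d}

lemma poly_ge {c : (Fin n → ℕ) → ℝ} {w : Fin n → ℝ} (hw : ∀ i, 0 < w i) {d : ℝ}
    (hd : ∀ α, c α ≠ 0 → d ≤ dt w (rc α)) (x : Fin n → ℝ) (hx : x ∈ newtonPolyhedron c) :
    d < dt w x ∨ x ∈ convexHull ℝ {y | ∃ α, c α ≠ 0 ∧ dt w (rc α) = d ∧ y = rc α} := by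
  set E : Set (Fin n → ℝ) := {y | ∃ α, c α ≠ 0 ∧ dt w (rc α) = d ∧ y = rc α} with hE
  have hconvlin : Convex ℝ {x | dt w x = d} := by
    intro x hx y hy a b ha hb hab
    simp only [mem_setOf_eq] at *
    rw [dt_add, dt_smul, dt_smul, hx, hy, ← add_mul, hab, one_mul]
  have hEd : ∀ x ∈ convexHull ℝ E, dt w x = d := by
    intro x hx
    exact convexHull_min (s := E) (t := {x | dt w x = d}) (by rintro _ ⟨α, _, h, rfl⟩; exact h)
      hconvlin hx
  have hY : Convex ℝ {x | d < dt w x ∨ x ∈ convexHull ℝ E} := by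
    intro x hx y hy a b ha hb hab
    simp only [mem_setOf_eq] at *
    have key : dt w (a • x + b • y) = a * dt w x + b * dt w y := by rw [dt_add, dt_smul, dt_smul]
    have hxd : d ≤ dt w x := hx.elim le_of_lt fun h => (hEd x h).ge
    have hyd : d ≤ dt w y := hy.elim le_of_lt fun h => (hEd y h).ge
    rcases ha.eq_or_lt with rfl | ha'
    · have : b = 1 := by linarith
      subst this; simpa using hy
    rcases hb.eq_or_lt with rfl | hb'
    · have : a = 1 := by linarith
      subst this; simpa using hx
    rw [key]
    have hd1 : d = a * d + b * d := by rw [← add_mul, hab, one_mul]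
    rcases hx with hx | hx
    · left; nlinarith [mul_lt_mul_of_pos_left hx ha', mul_le_mul_of_nonneg_left hyd hb]
    rcases hy with hy | hy
    · left; nlinarith [mul_lt_mul_of_pos_left hy hb', mul_le_mul_of_nonneg_left hxd ha]
    · right; exact convex_convexHull ℝ E hx hy ha hb hab
  refine convexHull_min (s := genSet c) ?_ hY hx
  rintro x ⟨α, hα, hle⟩
  have h1 : dt w (rc α) ≤ dt w x := dt_mono hw hle
  rcases (hd α hα).eq_or_lt with h | h
  · rcases h1.eq_or_lt with h' | h'
    · right
      have : rc α = x := dt_eq_of_le hw hle h'.ge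
      exact subset_convexHull ℝ _ ⟨α, hα, h.symm, this.symm⟩
    · left; linarith
  · left; linarith

lemma wFace_isCompactFace {c : (Fin n → ℕ) → ℝ} {w : Fin n → ℝ} (hw : ∀ i, 0 < w i) {d : ℝ}
    (hd : ∀ α, c α ≠ 0 → d ≤ dt w (rc α)) (he : ∃ α, c α ≠ 0 ∧ dt w (rc α) = d) :
    IsCompactFace c (wFace c w d) := by
  set E : Set (Fin n → ℝ) := {y | ∃ α, c α ≠ 0 ∧ dt w (rc α) = d ∧ y = rc α} with hE
  have hge : ∀ x ∈ newtonPolyhedron c, d ≤ dt w x := by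
    intro x hx
    rcases poly_ge hw hd x hx with h | h
    · exact h.le
    · have hconvlin : Convex ℝ {x | d ≤ dt w x} := by
        intro x hx y hy a b ha hb hab
        simp only [mem_setOf_eq] at *
        rw [dt_add, dt_smul, dt_smul]
        have hd1 : d = a * d + b * d := by rw [← add_mul, hab, one_mul]
        nlinarith [mul_le_mul_of_nonneg_left hx ha, mul_le_mul_of_nonneg_left hy hb]
      exact convexHull_min (t := {x | d ≤ dt w x})
        (by rintro _ ⟨α, _, h, rfl⟩; exact h.ge) hconvlin h
  obtain ⟨α0, h0, h0d⟩ := he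
  have hmem0 : rc α0 ∈ wFace c w d := ⟨rc_mem_poly h0, h0d⟩
  have hFE : wFace c w d = convexHull ℝ E := by
    apply Subset.antisymm
    · rintro x ⟨hx, hxd⟩
      rcases poly_ge hw hd x hx with h | h
      · exact absurd hxd h.ne'
      · exact h
    · apply convexHull_min
      · rintro _ ⟨α, h, h', rfl⟩; exact ⟨rc_mem_poly h, h'⟩
      · intro x hx y hy a b ha hb hab
        refine ⟨convex_convexHull ℝ _ hx.1 hy.1 ha hb hab, ?_⟩
        rw [dt_add, dt_smul, dt_smul, hx.2, hy.2, ← add_mul, hab, one_mul]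
  refine ⟨?_, ⟨_, hmem0⟩, ?_⟩
  · intro _
    refine ⟨-∑ i, w i • (ContinuousLinearMap.proj (R := ℝ) (φ := fun _ : Fin n => ℝ) i), ?_⟩
    have hl : ∀ x, (-∑ i, w i • (ContinuousLinearMap.proj (R := ℝ) (φ := fun _ : Fin n => ℝ) i)) x
        = - dt w x := by intro x; simp [dt, ContinuousLinearMap.sum_apply]
    ext x
    simp only [hl, neg_le_neg_iff]
    constructor
    · rintro ⟨hx, hxd⟩; exact ⟨hx, fun y hy => hxd.symm ▸ hge y hy⟩
    · rintro ⟨hx, hxd⟩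
      exact ⟨hx, le_antisymm (h0d ▸ hxd _ (rc_mem_poly h0)) (hge x hx)⟩
  · rw [hFE]
    have hEfin : E.Finite := by
      have : ({α : Fin n → ℕ | dt w (rc α) ≤ d}).Finite := by
        apply (Set.finite_Iic (fun i => ⌈d / w i⌉₊)).subset
        intro α h i
        have h1 : w i * (α i : ℝ) ≤ dt w (rc α) :=
          Finset.single_le_sum (f := fun i => w i * rc α i)
            (fun j _ => mul_nonneg (hw j).le (Nat.cast_nonneg _)) (Finset.mem_univ i)
        have : (α i : ℝ) ≤ d / w i := by
          rw [le_div_iff₀ (hw i)]; simp only [mem_setOf_eq] at h; linarith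
        exact_mod_cast this.trans (Nat.le_ceil _)
      apply (this.image rc).subset
      rintro _ ⟨α, _, h, rfl⟩
      exact ⟨α, h.le, rfl⟩
    exact hEfin.isCompact_convexHull (𝕜 := ℝ)

lemma exists_min_vertex {c : (Fin n → ℕ) → ℝ} (hc : c ≠ 0) {w : Fin n → ℝ} (hw : ∀ i, 0 < w i) :
    ∃ v ∈ newtonVertices c, ∀ α, c α ≠ 0 → dt w v ≤ dt w (rc α) := by
  obtain ⟨α0, h0, hm⟩ := exists_min_weight hc hw
  obtain ⟨h1, h2, h3⟩ := wFace_isCompactFace hw hm ⟨α0, h0, rfl⟩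
  obtain ⟨v, hv⟩ := h3.extremePoints_nonempty h2
  refine ⟨v, h1.isExtreme.extremePoints_subset_extremePoints hv, fun α hα => ?_⟩
  rw [(hv.1).2]; exact hm α hα

lemma not_vertex_of_lt {c : (Fin n → ℕ) → ℝ} {α : Fin n → ℕ} (hα : c α ≠ 0) {x : Fin n → ℝ}
    (hx : x ∈ newtonVertices c) (hle : ∀ i, (α i : ℝ) ≤ x i) : rc α = x := by
  have h1 : (2:ℝ) • x - rc α ∈ newtonPolyhedron c := by
    apply subset_convexHull ℝ _
    refine ⟨α, hα, fun i => ?_⟩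
    have := hle i
    simp [rc]; linarith
  refine hx.2 (rc_mem_poly hα) h1 ⟨1/2, 1/2, by norm_num, by norm_num, by norm_num, ?_⟩
  funext i; simp; ring

lemma vertex_eq_rc {c : (Fin n → ℕ) → ℝ} {x : Fin n → ℝ} (hx : x ∈ newtonVertices c) :
    ∃ α, c α ≠ 0 ∧ x = rc α := by
  obtain ⟨α, hα, hle⟩ := extremePoints_convexHull_subset hx
  exact ⟨α, hα, (not_vertex_of_lt hα hx hle).symm⟩

lemma supp_of_vertex {c : (Fin n → ℕ) → ℝ} {α : Fin n → ℕ} (h : rc α ∈ newtonVertices c) :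
    c α ≠ 0 := by
  obtain ⟨β, hβ, h'⟩ := vertex_eq_rc h
  rwa [rc_inj h']

lemma finite_of_antichain (s : Set (Fin n → ℕ)) (h : ∀ a ∈ s, ∀ b ∈ s, a ≤ b → a = b) :
    s.Finite := by
  apply WellQuasiOrderedLE.finite_of_isAntichain
  intro a ha b hb hne hle
  exact hne (h a ha b hb hle)

lemma vertexExp_finite (c : (Fin n → ℕ) → ℝ) : {α : Fin n → ℕ | rc α ∈ newtonVertices c}.Finite := by
  apply finite_of_antichain
  intro a ha b hb hle
  exact rc_inj (not_vertex_of_lt (supp_of_vertex ha) hb (fun i => by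
    have := hle i; simpa [rc] using this))

/-- vertex exponents -/
def VE (c : (Fin n → ℕ) → ℝ) : Finset (Fin n → ℕ) := (vertexExp_finite c).toFinset

lemma mem_VE {c : (Fin n → ℕ) → ℝ} {α : Fin n → ℕ} : α ∈ VE c ↔ rc α ∈ newtonVertices c := by
  simp [VE]

/-- absolute monomial -/
def amon (α : Fin n → ℕ) (t : Fin n → ℝ) : ℝ := ∏ i, |t i| ^ α i

lemma abs_monomial (α : Fin n → ℕ) (t : Fin n → ℝ) : |monomial α t| = amon α t := by
  simp [monomial, amon, Finset.abs_prod]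

lemma starFn_eq (c : (Fin n → ℕ) → ℝ) (t : Fin n → ℝ) : starFn c t = ∑ v ∈ VE c, amon v t := by
  unfold starFn
  have hf : newtonVertices c = ((VE c).image rc : Finset (Fin n → ℝ)) := by
    ext x
    simp only [Finset.coe_image, mem_image, Finset.mem_coe]
    constructor
    · intro hx
      obtain ⟨α, _, rfl⟩ := vertex_eq_rc hx
      exact ⟨α, mem_VE.2 hx, rfl⟩
    · rintro ⟨α, h, rfl⟩
      exact mem_VE.1 h
  rw [hf]
  have := Finset.tsum_subtype' ((VE c).image rc) (fun v : Fin n → ℝ => ∏ i, |t i| ^ (v i))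
  rw [this, Finset.sum_image (fun a _ b _ h => rc_inj h)]
  simp only [rc, Real.rpow_natCast, amon]

lemma amon_eq_exp (α : Fin n → ℕ) {t : Fin n → ℝ} (ht : ∀ i, t i ≠ 0) :
    amon α t = Real.exp (- dt (fun i => - Real.log |t i|) (rc α)) := by
  unfold amon dt
  rw [← Finset.sum_neg_distrib, Real.exp_sum]
  refine Finset.prod_congr rfl fun i _ => ?_
  have : 0 < |t i| := abs_pos.2 (ht i)
  rw [neg_mul, neg_neg, mul_comm]
  simp only [rc]
  rw [Real.exp_nat_mul, Real.exp_log this]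

lemma amon_pos (α : Fin n → ℕ) {t : Fin n → ℝ} (ht : ∀ i, t i ≠ 0) : 0 < amon α t :=
  Finset.prod_pos fun i _ => pow_pos (abs_pos.2 (ht i)) _

lemma amon_nonneg (α : Fin n → ℕ) (t : Fin n → ℝ) : 0 ≤ amon α t :=
  Finset.prod_nonneg fun i _ => pow_nonneg (abs_nonneg _) _

lemma exists_VE_min {c : (Fin n → ℕ) → ℝ} (hc : c ≠ 0) {t : Fin n → ℝ} (ht : ∀ i, t i ≠ 0)
    (ht1 : ∀ i, |t i| < 1) : ∃ v ∈ VE c, ∀ α, c α ≠ 0 → amon α t ≤ amon v t := by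
  obtain ⟨x, hx, hm⟩ := exists_min_vertex hc (w := fun i => - Real.log |t i|)
    (fun i => by have := Real.log_neg (abs_pos.2 (ht i)) (ht1 i); linarith)
  obtain ⟨v, _, rfl⟩ := vertex_eq_rc hx
  refine ⟨v, mem_VE.2 hx, fun α hα => ?_⟩
  rw [amon_eq_exp _ ht, amon_eq_exp _ ht]
  exact Real.exp_le_exp.2 (neg_le_neg (hm α hα))

lemma amon_le_star {c : (Fin n → ℕ) → ℝ} (hc : c ≠ 0) {t : Fin n → ℝ} (ht : ∀ i, t i ≠ 0)
    (ht1 : ∀ i, |t i| < 1) {α : Fin n → ℕ} (hα : c α ≠ 0) : amon α t ≤ starFn c t := by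
  obtain ⟨v, hv, hm⟩ := exists_VE_min hc ht ht1
  rw [starFn_eq]
  exact (hm α hα).trans (Finset.single_le_sum (f := fun v => amon v t)
    (fun v _ => amon_nonneg v t) hv)

lemma VE_nonempty {c : (Fin n → ℕ) → ℝ} (hc : c ≠ 0) : (VE c).Nonempty := by
  obtain ⟨v, hv, _⟩ := exists_VE_min hc (t := fun _ => 1/2) (by intro i; norm_num)
    (by intro i; rw [abs_of_pos] <;> norm_num)
  exact ⟨v, hv⟩

lemma star_pos {c : (Fin n → ℕ) → ℝ} (hc : c ≠ 0) {t : Fin n → ℝ} (ht : ∀ i, t i ≠ 0) :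
    0 < starFn c t := by
  rw [starFn_eq]
  exact Finset.sum_pos (fun v _ => amon_pos v ht) (VE_nonempty hc)

end

section

/-- total degree -/
def dg (α : Fin n → ℕ) : ℕ := ∑ i, α i

lemma monomial_const (α : Fin n → ℕ) (R : ℝ) : monomial α (fun _ => R) = R ^ dg α := by
  simp [monomial, dg, Finset.prod_pow_eq_pow_sum]

lemma amon_smul (α : Fin n → ℕ) (t : Fin n → ℝ) {x : ℝ} (hx : 0 ≤ x) :
    amon α (fun i => x * t i) = x ^ dg α * amon α t := by
  simp [amon, dg, abs_mul, mul_pow, Finset.prod_mul_distrib, Finset.prod_pow_eq_pow_sum,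
    abs_of_nonneg hx]

lemma amon_le_pow (α : Fin n → ℕ) {t : Fin n → ℝ} {R : ℝ} (h : ∀ i, |t i| ≤ R) :
    amon α t ≤ R ^ dg α := by
  rw [← monomial_const]
  exact Finset.prod_le_prod (fun i _ => pow_nonneg (abs_nonneg _) _)
    (fun i _ => pow_le_pow_left₀ (abs_nonneg _) (h i) _)

lemma exists_radius {S : (Fin n → ℝ) → ℝ} {c : (Fin n → ℕ) → ℝ}
    (h : HasTaylorSeriesAtOrigin S c) : ∃ R : ℝ, 0 < R ∧ R < 1 ∧
      Summable (fun α => |c α| * R ^ dg α) ∧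
      ∀ t : Fin n → ℝ, (∀ i, |t i| ≤ R) → HasSum (fun α => c α * monomial α t) (S t) := by
  obtain ⟨ε, hε, hb⟩ := Metric.eventually_nhds_iff_ball.1 h
  refine ⟨min (ε/2) (1/2), by positivity, (min_le_right _ _).trans_lt (by norm_num), ?_, ?_⟩
  · have h1 : (fun _ => min (ε/2) (1/2) : Fin n → ℝ) ∈ Metric.ball (0 : Fin n → ℝ) ε := by
      rw [mem_ball_zero_iff, pi_norm_lt_iff hε]
      intro i
      rw [Real.norm_of_nonneg (by positivity)]
      exact (min_le_left _ _).trans_lt (by linarith)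
    have := (hb _ h1).summable.abs
    refine this.congr fun α => ?_
    rw [abs_mul, monomial_const, abs_of_nonneg (a := _ ^ dg α) (by positivity)]
  · intro t ht
    apply hb
    rw [mem_ball_zero_iff, pi_norm_lt_iff hε]
    intro i
    exact ((ht i).trans (min_le_left _ _)).trans_lt (by linarith)

lemma coeff_zero {S : (Fin n → ℝ) → ℝ} {c : (Fin n → ℕ) → ℝ}
    (h : HasTaylorSeriesAtOrigin S c) (hS0 : S 0 = 0) : c 0 = 0 := by
  obtain ⟨R, hR, _, _, hs⟩ := exists_radius h
  have h1 := hs 0 (by simp [hR.le])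
  have h2 : HasSum (fun α => c α * monomial α (0 : Fin n → ℝ)) (c 0 * monomial 0 (0 : Fin n → ℝ)) := by
    apply hasSum_single
    intro α hα
    obtain ⟨i, hi⟩ := Function.ne_iff.1 hα
    have : monomial α (0 : Fin n → ℝ) = 0 := by
      apply Finset.prod_eq_zero (Finset.mem_univ i)
      simpa using hi
    rw [this, mul_zero]
  have h3 := h1.unique h2
  rw [hS0] at h3
  simpa [monomial] using h3.symm

lemma dg_single (i : Fin n) : dg (Pi.single i 1 : Fin n → ℕ) = 1 := by
  simp [dg]

lemma monomial_single (i : Fin n) (t : Fin n → ℝ) :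
    monomial (Pi.single i 1 : Fin n → ℕ) t = t i := by
  unfold monomial
  rw [Finset.prod_eq_single i]
  · simp
  · intro j _ hj; simp [Pi.single_eq_of_ne hj]
  · simp

lemma eq_single_of_dg {α : Fin n → ℕ} (h : dg α = 1) : ∃ i, α = Pi.single i 1 := by
  have : ∃ i, α i ≠ 0 := by
    by_contra hh; push Not at hh; simp [dg, hh] at h
  obtain ⟨i, hi⟩ := this
  have h1 : α i + ∑ j ∈ Finset.univ.erase i, α j = 1 := by
    rw [Finset.add_sum_erase _ _ (Finset.mem_univ i)]; exact h
  have h2 : ∑ j ∈ Finset.univ.erase i, α j = 0 := by omega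
  refine ⟨i, funext fun j => ?_⟩
  by_cases hj : j = i
  · subst hj; simp; omega
  · rw [Pi.single_eq_of_ne hj]
    exact Finset.sum_eq_zero_iff.1 h2 j (by simp [hj])

lemma coeff_single {S : (Fin n → ℝ) → ℝ} {c : (Fin n → ℕ) → ℝ}
    (h : HasTaylorSeriesAtOrigin S c) (hS0 : S 0 = 0) (hS1 : fderiv ℝ S 0 = 0) (i : Fin n) :
    c (Pi.single i 1) = 0 := by
  have hc0 := coeff_zero h hS0
  obtain ⟨R, hR, hR1, hsum, hs⟩ := exists_radius h
  set L : (Fin n → ℝ) →L[ℝ] ℝ :=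
    ∑ i, c (Pi.single i 1) • (ContinuousLinearMap.proj (R := ℝ) (φ := fun _ : Fin n => ℝ) i) with hL
  have hLa : ∀ t, L t = ∑ i, c (Pi.single i 1) * t i := by
    intro t; simp [hL]
  have hbd : ∀ t : Fin n → ℝ, ‖t‖ ≤ R → |S t - L t| ≤ (∑' α, |c α| * R ^ dg α) / R^2 * ‖t‖^2 := by
    intro t ht
    have ht' : ∀ i, |t i| ≤ ‖t‖ := fun i => norm_le_pi_norm t i
    have h1 := hs t (fun i => (ht' i).trans ht)
    set T : Finset (Fin n → ℕ) := Finset.univ.image (fun i => (Pi.single i 1 : Fin n → ℕ)) with hT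
    have hinj : Function.Injective (fun i : Fin n => (Pi.single i 1 : Fin n → ℕ)) := by
      intro i j hij
      by_contra hne
      have := congrFun hij i
      simp [Pi.single_eq_of_ne hne] at this
    have h2 : HasSum (fun α => if α ∈ T then c α * monomial α t else 0) (L t) := by
      have := hasSum_sum_of_ne_finset_zero (L := .unconditional _) (s := T)
        (f := fun α => if α ∈ T then c α * monomial α t else 0) (fun b hb => by simp [hb])
      convert this using 1
      rw [hLa, Finset.sum_congr rfl (g := fun α => c α * monomial α t) (fun x hx => by simp [hx]),
        hT, Finset.sum_image (fun a _ b _ h => hinj h)]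
      simp [monomial_single]
    have h3 := h1.sub h2
    have h4 : Summable (fun α => |c α| * R ^ dg α / R^2 * ‖t‖^2) := (hsum.div_const _).mul_right _
    have h5 := h3.norm_le_of_bounded (h4.hasSum) (fun α => ?_)
    · rw [tsum_mul_right, tsum_div_const] at h5; exact h5
    · have hnn : 0 ≤ |c α| * R ^ dg α / R^2 * ‖t‖^2 := by positivity
      by_cases hα : α ∈ T
      · simpa [hα] using hnn
      · by_cases h0 : α = 0
        · subst h0; simpa [hα, hc0] using hnn
        have hd : 2 ≤ dg α := by
          by_contra hlt
          have : dg α = 0 ∨ dg α = 1 := by omega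
          rcases this with h' | h'
          · apply h0; funext j
            exact Finset.sum_eq_zero_iff.1 h' j (Finset.mem_univ j)
          · obtain ⟨j, hj⟩ := eq_single_of_dg h'
            apply hα; rw [hj, hT]; exact Finset.mem_image_of_mem _ (Finset.mem_univ j)
        simp only [hα, if_false, sub_zero, Real.norm_eq_abs, abs_mul, abs_monomial]
        have e1 : amon α t ≤ ‖t‖ ^ dg α := amon_le_pow α ht'
        obtain ⟨k, hk⟩ := Nat.exists_eq_add_of_le hd
        have e2 : ‖t‖ ^ dg α ≤ R ^ dg α / R^2 * ‖t‖^2 := by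
          rw [hk, pow_add, pow_add, mul_div_assoc, mul_comm (R^2), div_mul_cancel₀ _ (by positivity),
            mul_comm]
          exact mul_le_mul_of_nonneg_right (pow_le_pow_left₀ (norm_nonneg _) ht _) (by positivity)
        calc |c α| * amon α t ≤ |c α| * (R ^ dg α / R^2 * ‖t‖^2) :=
              mul_le_mul_of_nonneg_left (e1.trans e2) (abs_nonneg _)
          _ = _ := by ring
  have hF : HasFDerivAt S L 0 := by
    rw [hasFDerivAt_iff_isLittleO_nhds_zero]
    simp only [zero_add, hS0, sub_zero]
    have hO : (fun t : Fin n → ℝ => S t - L t) =O[𝓝 0] fun t => ‖t‖^2 := by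
      refine Asymptotics.IsBigO.of_bound ((∑' α, |c α| * R ^ dg α) / R^2) ?_
      filter_upwards [Metric.closedBall_mem_nhds (0 : Fin n → ℝ) hR] with t ht
      rw [mem_closedBall_zero_iff] at ht
      simpa using hbd t ht
    refine hO.trans_isLittleO ?_
    simp only [pow_two]
    have : (fun t : Fin n → ℝ => ‖t‖ * ‖t‖) =o[𝓝 0] fun t : Fin n → ℝ => (1:ℝ) * ‖t‖ := by
      refine Asymptotics.IsLittleO.mul_isBigO ?_ (Asymptotics.isBigO_refl _ _)
      rw [Asymptotics.isLittleO_one_iff]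
      exact tendsto_norm_zero
    simp only [one_mul] at this
    exact this.trans_isBigO (Asymptotics.isBigO_refl _ _).norm_left
  have := hF.fderiv
  rw [hS1] at this
  have h2 := congrArg (fun f : (Fin n → ℝ) →L[ℝ] ℝ => f (Pi.single i 1)) this
  simp only [hLa] at h2
  rw [Finset.sum_eq_single i] at h2
  · simpa using h2.symm
  · intro j _ hj; simp [Pi.single_eq_of_ne hj]
  · simp

open Polynomial in
/-- the polynomial of a monomial along a line -/
def LP (v : Fin n → ℝ) (α : Fin n → ℕ) : Polynomial ℝ :=
  ∏ i, (1 + Polynomial.C (v i) * Polynomial.X) ^ (α i)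

/-- the line -/
def ln (v t : Fin n → ℝ) (s : ℝ) : Fin n → ℝ := fun i => t i * (1 + s * v i)

lemma LP_eval (v : Fin n → ℝ) (α : Fin n → ℕ) (s : ℝ) :
    (LP v α).eval s = ∏ i, (1 + s * v i) ^ α i := by
  simp [LP, Polynomial.eval_prod, mul_comm s]

lemma monomial_ln (v t : Fin n → ℝ) (α : Fin n → ℕ) (s : ℝ) :
    monomial α (ln v t s) = monomial α t * (LP v α).eval s := by
  simp [LP_eval, monomial, ln, mul_pow, Finset.prod_mul_distrib]

/-- nonnegative coefficients -/
def NN (p : Polynomial ℝ) : Prop := ∀ k, 0 ≤ p.coeff k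

lemma NN.mul {p q : Polynomial ℝ} (hp : NN p) (hq : NN q) : NN (p * q) := by
  intro k
  rw [Polynomial.coeff_mul]
  exact Finset.sum_nonneg fun x _ => mul_nonneg (hp _) (hq _)

lemma NN.one : NN (1 : Polynomial ℝ) := by
  intro k; rw [Polynomial.coeff_one]; split_ifs <;> norm_num

lemma NN.pow {p : Polynomial ℝ} (hp : NN p) (k : ℕ) : NN (p ^ k) := by
  induction k with
  | zero => simpa using NN.one
  | succ k ih => rw [pow_succ]; exact ih.mul hp

lemma LP_NN {v : Fin n → ℝ} (hv : ∀ i, 0 ≤ v i) (α : Fin n → ℕ) : NN (LP v α) := by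
  unfold LP
  refine Finset.prod_induction _ NN (fun _ _ => NN.mul) NN.one fun i _ => NN.pow ?_ _
  intro k
  rw [Polynomial.coeff_add, Polynomial.coeff_C_mul, Polynomial.coeff_X, Polynomial.coeff_one]
  have := hv i
  split_ifs <;> simp [this]; linarith

lemma NN.eval_nonneg {p : Polynomial ℝ} (hp : NN p) {x : ℝ} (hx : 0 ≤ x) : 0 ≤ p.eval x := by
  rw [Polynomial.eval_eq_sum_range]
  exact Finset.sum_nonneg fun i _ => mul_nonneg (hp i) (pow_nonneg hx i)

lemma NN.derivative {p : Polynomial ℝ} (hp : NN p) (j : ℕ) : NN (Polynomial.derivative^[j] p) := by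
  intro k
  rw [Polynomial.coeff_iterate_derivative, nsmul_eq_mul]
  exact mul_nonneg (Nat.cast_nonneg _) (hp _)

lemma NN.abs_eval_le {p : Polynomial ℝ} (hp : NN p) (x : ℝ) : |p.eval x| ≤ p.eval |x| := by
  rw [Polynomial.eval_eq_sum_range, Polynomial.eval_eq_sum_range]
  refine (Finset.abs_sum_le_sum_abs _ _).trans (Finset.sum_le_sum fun i _ => ?_)
  rw [abs_mul, abs_of_nonneg (hp i), abs_pow]

lemma NN.eval_mono {p : Polynomial ℝ} (hp : NN p) {x y : ℝ} (hx : 0 ≤ x) (h : x ≤ y) :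
    p.eval x ≤ p.eval y := by
  rw [Polynomial.eval_eq_sum_range, Polynomial.eval_eq_sum_range]
  exact Finset.sum_le_sum fun i _ => mul_le_mul_of_nonneg_left (pow_le_pow_left₀ hx h i) (hp i)

lemma NN.deriv_bound {p : Polynomial ℝ} (hp : NN p) {s ρ : ℝ} (hs : 0 ≤ s) (hρ : 0 < ρ) (j : ℕ) :
    (Polynomial.derivative^[j] p).eval s ≤ j.factorial / ρ ^ j * p.eval (s + ρ) := by
  have h1 : p.eval (s + ρ) = ∑ i ∈ Finset.range ((Polynomial.taylor s p).natDegree + 1),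
      (Polynomial.hasseDeriv i p).eval s * ρ ^ i := by
    rw [add_comm, ← Polynomial.taylor_eval, Polynomial.eval_eq_sum_range]
    simp [Polynomial.taylor_coeff]
  have hh : ∀ i, NN (Polynomial.hasseDeriv i p) := by
    intro i k
    rw [Polynomial.hasseDeriv_coeff]
    exact mul_nonneg (Nat.cast_nonneg _) (hp _)
  have h2 : (Polynomial.hasseDeriv j p).eval s * ρ ^ j ≤ p.eval (s + ρ) := by
    by_cases hj : j ∈ Finset.range ((Polynomial.taylor s p).natDegree + 1)
    · rw [h1]
      exact Finset.single_le_sum (f := fun i => (Polynomial.hasseDeriv i p).eval s * ρ ^ i)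
        (fun i _ => mul_nonneg ((hh i).eval_nonneg hs) (by positivity)) hj
    · have : (Polynomial.hasseDeriv j p).eval s = 0 := by
        rw [← Polynomial.taylor_coeff]
        apply Polynomial.coeff_eq_zero_of_natDegree_lt
        rw [Finset.mem_range, not_lt] at hj; exact hj
      rw [this, zero_mul]; exact hp.eval_nonneg (by positivity)
  have h3 : (Polynomial.derivative^[j] p).eval s = j.factorial * (Polynomial.hasseDeriv j p).eval s := by
    have := congrArg (fun f => (f p).eval s) (Polynomial.factorial_smul_hasseDeriv (R := ℝ) j)
    simp only [Pi.smul_apply, LinearMap.smul_apply] at this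
    rw [← this]; simp
  rw [h3, div_mul_eq_mul_div, le_div_iff₀ (by positivity), mul_assoc]
  exact mul_le_mul_of_nonneg_left h2 (by positivity)

lemma LP_le_two {v : Fin n → ℝ} (hv : ∀ i, 0 ≤ v i) (α : Fin n → ℕ) {s : ℝ} (hs : 0 ≤ s)
    (h : ∀ i, s * v i ≤ 1) : (LP v α).eval s ≤ 2 ^ dg α := by
  rw [LP_eval, ← monomial_const]
  unfold monomial
  refine Finset.prod_le_prod (fun i _ => ?_) (fun i _ => ?_)
  · have := mul_nonneg hs (hv i); positivity
  · have := mul_nonneg hs (hv i); exact pow_le_pow_left₀ (by positivity) (by linarith [h i]) _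

lemma LP_deriv_bound {v : Fin n → ℝ} (hv : ∀ i, 0 ≤ v i) (α : Fin n → ℕ) {s ρ : ℝ} (hρ : 0 < ρ)
    (h : ∀ i, 2 * ρ * v i ≤ 1) (hs : |s| ≤ ρ) (j : ℕ) :
    |(Polynomial.derivative^[j] (LP v α)).eval s| ≤ j.factorial / ρ ^ j * 2 ^ dg α := by
  have hN := LP_NN hv α
  refine ((hN.derivative j).abs_eval_le s).trans ?_
  refine (hN.deriv_bound (abs_nonneg s) hρ j).trans ?_
  refine mul_le_mul_of_nonneg_left ?_ (by positivity)
  refine (hN.eval_mono (by positivity) (show |s| + ρ ≤ 2 * ρ by linarith)).trans ?_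
  exact LP_le_two hv α (by positivity) h

end

section

/-- the bundle of convergence facts for the Taylor series -/
structure SD (S : (Fin n → ℝ) → ℝ) (c : (Fin n → ℕ) → ℝ) (r0 : ℝ) (u : (Fin n → ℕ) → ℝ) : Prop where
  hc : c ≠ 0
  pos : 0 < r0
  lt : r0 < 1
  summ : Summable u
  unn : ∀ α, 0 ≤ u α
  bd : ∀ α (t : Fin n → ℝ), (∀ i, t i ≠ 0) → (∀ i, |t i| < r0) →
    |c α| * 4 ^ dg α * amon α t ≤ u α * starFn c t
  summ' : Summable (fun α => |c α| * 4 ^ dg α * r0 ^ dg α)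
  hs : ∀ t : Fin n → ℝ, (∀ i, |t i| ≤ 4 * r0) → HasSum (fun α => c α * monomial α t) (S t)

lemma exists_SD {S : (Fin n → ℝ) → ℝ} {c : (Fin n → ℕ) → ℝ} (hc : c ≠ 0)
    (h : HasTaylorSeriesAtOrigin S c) : ∃ r0 u, SD S c r0 u := by
  obtain ⟨R, hR, hR1, hsum, hs⟩ := exists_radius h
  set D := ∑ v ∈ VE c, dg v with hD
  set r := R / 4 with hr
  have hr0 : 0 < r := by positivity
  have hr1 : r < 1 := by rw [hr]; linarith
  have e4 : ∀ α : Fin n → ℕ, |c α| * 4 ^ dg α * r ^ dg α = |c α| * R ^ dg α := by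
    intro α; rw [mul_assoc, ← mul_pow, hr]; congr 2; ring
  refine ⟨r, fun α => |c α| * R ^ dg α * (1/r) ^ D, hc, hr0, hr1, hsum.mul_right _,
    fun α => by positivity, ?_, ?_, ?_⟩
  · intro α t ht htr
    by_cases hα : c α = 0
    · have : 0 ≤ starFn c t := by
        rw [starFn_eq]; exact Finset.sum_nonneg fun v _ => amon_nonneg v t
      simp [hα]
    have h1 : amon α (fun i => (1/r) * t i) ≤ starFn c (fun i => (1/r) * t i) := by
      refine amon_le_star hc (fun i => mul_ne_zero (by positivity) (ht i)) (fun i => ?_) hα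
      rw [abs_mul, abs_of_pos (by positivity), one_div, inv_mul_lt_iff₀ hr0]
      simpa using htr i
    have h2 : starFn c (fun i => (1/r) * t i) ≤ (1/r) ^ D * starFn c t := by
      rw [starFn_eq, starFn_eq, Finset.mul_sum]
      refine Finset.sum_le_sum fun v hv => ?_
      rw [amon_smul _ _ (by positivity)]
      refine mul_le_mul_of_nonneg_right (pow_le_pow_right₀ ?_ ?_) (amon_nonneg _ _)
      · rw [le_div_iff₀ hr0]; linarith
      · exact Finset.single_le_sum (f := fun v => dg v) (fun _ _ => Nat.zero_le _) hv
    have h3 : amon α t = r ^ dg α * amon α (fun i => (1/r) * t i) := by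
      rw [amon_smul _ _ (by positivity), ← mul_assoc, ← mul_pow, mul_one_div_cancel hr0.ne']; simp
    calc |c α| * 4 ^ dg α * amon α t
        = |c α| * R ^ dg α * amon α (fun i => (1/r) * t i) := by rw [h3, ← e4]; ring
      _ ≤ |c α| * R ^ dg α * ((1/r) ^ D * starFn c t) :=
          mul_le_mul_of_nonneg_left (h1.trans h2) (by positivity)
      _ = _ := by ring
  · exact hsum.congr fun α => (e4 α).symm
  · intro t ht
    apply hs
    intro i; have := ht i; rw [hr] at this; linarith

/-- generic series along a line -/
def ser (e : (Fin n → ℕ) → ℝ) (v t : Fin n → ℝ) (j : ℕ) (s : ℝ) : ℝ :=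
  ∑' α, e α * monomial α t * (Polynomial.derivative^[j] (LP v α)).eval s

/-- admissible coefficients -/
def Adm (c e : (Fin n → ℕ) → ℝ) (A : ℝ) : Prop := ∀ α, |e α| ≤ A * 2 ^ dg α * |c α|

variable {S : (Fin n → ℝ) → ℝ} {c e : (Fin n → ℕ) → ℝ} {r0 A ρ : ℝ} {u : (Fin n → ℕ) → ℝ}
  {v t : Fin n → ℝ}

lemma ser_term (hS : SD S c r0 u) (hA : 0 ≤ A) (he : Adm c e A) (hv : ∀ i, 0 ≤ v i) (hρ : 0 < ρ)
    (hvρ : ∀ i, 2 * ρ * v i ≤ 1) (ht : ∀ i, t i ≠ 0) (htr : ∀ i, |t i| < r0) (j : ℕ)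
    {s : ℝ} (hs : |s| ≤ ρ) (α : Fin n → ℕ) :
    ‖e α * monomial α t * (Polynomial.derivative^[j] (LP v α)).eval s‖ ≤
      A * (j.factorial / ρ ^ j) * starFn c t * u α := by
  rw [Real.norm_eq_abs, abs_mul, abs_mul, abs_monomial]
  have h1 := LP_deriv_bound hv α hρ hvρ hs j
  have h2 := hS.bd α t ht htr
  have h4 : (4:ℝ) ^ dg α = 2 ^ dg α * 2 ^ dg α := by rw [← mul_pow]; norm_num
  have hJ : 0 ≤ (j.factorial / ρ ^ j : ℝ) := by positivity
  have hm := amon_nonneg α t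
  calc |e α| * amon α t * |(Polynomial.derivative^[j] (LP v α)).eval s|
      ≤ (A * 2 ^ dg α * |c α|) * amon α t * (j.factorial / ρ ^ j * 2 ^ dg α) := by
        gcongr; exact he α
    _ = A * (j.factorial / ρ ^ j) * (|c α| * 4 ^ dg α * amon α t) := by rw [h4]; ring
    _ ≤ A * (j.factorial / ρ ^ j) * (u α * starFn c t) := by gcongr
    _ = _ := by ring

lemma ser_summable (hS : SD S c r0 u) (hA : 0 ≤ A) (he : Adm c e A) (hv : ∀ i, 0 ≤ v i) (hρ : 0 < ρ)
    (hvρ : ∀ i, 2 * ρ * v i ≤ 1) (ht : ∀ i, t i ≠ 0) (htr : ∀ i, |t i| < r0) (j : ℕ)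
    {s : ℝ} (hs : |s| ≤ ρ) :
    Summable fun α => e α * monomial α t * (Polynomial.derivative^[j] (LP v α)).eval s :=
  Summable.of_norm_bounded (hS.summ.mul_left _) (ser_term hS hA he hv hρ hvρ ht htr j hs)

lemma ser_bound (hS : SD S c r0 u) (hA : 0 ≤ A) (he : Adm c e A) (hv : ∀ i, 0 ≤ v i) (hρ : 0 < ρ)
    (hvρ : ∀ i, 2 * ρ * v i ≤ 1) (ht : ∀ i, t i ≠ 0) (htr : ∀ i, |t i| < r0) (j : ℕ)
    {s : ℝ} (hs : |s| ≤ ρ) :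
    |ser e v t j s| ≤ A * (j.factorial / ρ ^ j) * (∑' α, u α) * starFn c t := by
  have := tsum_of_norm_bounded ((hS.summ.mul_left (A * (j.factorial / ρ ^ j) * starFn c t)).hasSum)
    (ser_term hS hA he hv hρ hvρ ht htr j hs)
  rw [tsum_mul_left] at this
  calc _ ≤ _ := this
    _ = _ := by ring

lemma ser_hasDerivAt (hS : SD S c r0 u) (hA : 0 ≤ A) (he : Adm c e A) (hv : ∀ i, 0 ≤ v i)
    (hρ : 0 < ρ) (hvρ : ∀ i, 2 * ρ * v i ≤ 1) (ht : ∀ i, t i ≠ 0) (htr : ∀ i, |t i| < r0) (j : ℕ)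
    {s : ℝ} (hs : |s| < ρ) : HasDerivAt (ser e v t j) (ser e v t (j+1) s) s := by
  have h := hasDerivAt_tsum_of_isPreconnected (𝕜 := ℝ)
    (g := fun α s => e α * monomial α t * (Polynomial.derivative^[j] (LP v α)).eval s)
    (g' := fun α s => e α * monomial α t * (Polynomial.derivative^[j+1] (LP v α)).eval s)
    (t := Set.Ioo (-ρ) ρ) (y₀ := 0) (y := s)
    (hS.summ.mul_left (A * ((j+1).factorial / ρ ^ (j+1)) * starFn c t)) isOpen_Ioo isPreconnected_Ioo
    (fun α y _ => ?_) (fun α y hy => ?_) (by constructor <;> linarith) ?_ (abs_lt.1 hs)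
  · exact h
  · rw [Function.iterate_succ_apply']
    exact ((Polynomial.derivative^[j] (LP v α)).hasDerivAt y).const_mul _
  · exact ser_term hS hA he hv hρ hvρ ht htr (j+1) (abs_lt.2 hy).le α
  · exact ser_summable hS hA he hv hρ hvρ ht htr j (by simpa using hρ.le)

lemma ln_abs_lt (hv : ∀ i, 0 ≤ v i) (hvρ : ∀ i, 2 * ρ * v i ≤ 1) (htr : ∀ i, |t i| < r0)
    {s : ℝ} (hs : |s| ≤ ρ) (i : Fin n) : |ln v t s i| < 2 * r0 := by
  unfold ln
  rw [abs_mul]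
  have h1 : |1 + s * v i| ≤ 2 := by
    refine (abs_add_le _ _).trans ?_
    rw [abs_mul, abs_of_nonneg (hv i), abs_one]
    have := mul_le_mul_of_nonneg_right hs (hv i)
    have h3 : ρ * v i = (2 * ρ * v i)/2 := by ring
    linarith [hvρ i]
  have h2 := htr i
  have := abs_nonneg (t i)
  nlinarith [abs_nonneg (1 + s * v i)]

lemma ser_zero (hS : SD S c r0 u) (hv : ∀ i, 0 ≤ v i) (hvρ : ∀ i, 2 * ρ * v i ≤ 1)
    (htr : ∀ i, |t i| < r0) {s : ℝ} (hs : |s| ≤ ρ) : ser c v t 0 s = S (ln v t s) := by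
  have h := hS.hs (ln v t s) (fun i => by
    have := ln_abs_lt hv hvρ htr hs i; have := hS.pos; linarith)
  rw [← h.tsum_eq]
  unfold ser
  refine tsum_congr fun α => ?_
  simp only [Function.iterate_zero, id, monomial_ln]; ring

lemma monomial_continuous (α : Fin n → ℕ) : Continuous (monomial α : (Fin n → ℝ) → ℝ) := by
  unfold monomial; fun_prop

lemma ser_continuousOn (hS : SD S c r0 u) (hA : 0 ≤ A) (he : Adm c e A) (hv : ∀ i, 0 ≤ v i)
    (hρ : 0 < ρ) (hvρ : ∀ i, 2 * ρ * v i ≤ 1) (j : ℕ) {s : ℝ} (hs : |s| ≤ ρ) :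
    ContinuousOn (fun t => ser e v t j s) {t | ∀ i, |t i| < r0} := by
  refine continuousOn_tsum (u := fun α => A * (j.factorial / ρ ^ j) *
    (|c α| * 4 ^ dg α * r0 ^ dg α)) (fun α => ?_) (hS.summ'.mul_left _) (fun α t ht => ?_)
  · exact ((continuous_const.mul (monomial_continuous α)).mul continuous_const).continuousOn
  · rw [Real.norm_eq_abs, abs_mul, abs_mul, abs_monomial]
    have h1 := LP_deriv_bound hv α hρ hvρ hs j
    have h4 : (4:ℝ) ^ dg α = 2 ^ dg α * 2 ^ dg α := by rw [← mul_pow]; norm_num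
    have hJ : 0 ≤ (j.factorial / ρ ^ j : ℝ) := by positivity
    have hm := amon_nonneg α t
    have hm2 : amon α t ≤ r0 ^ dg α := amon_le_pow α (fun i => (ht i).le)
    have := hS.pos
    calc |e α| * amon α t * |(Polynomial.derivative^[j] (LP v α)).eval s|
        ≤ (A * 2 ^ dg α * |c α|) * r0 ^ dg α * (j.factorial / ρ ^ j * 2 ^ dg α) := by
          gcongr; exact he α
      _ = _ := by rw [h4]; ring

lemma Adm_self (c : (Fin n → ℕ) → ℝ) : Adm c c 1 := by
  intro α
  rw [one_mul]
  exact le_mul_of_one_le_left (abs_nonneg _) (one_le_pow₀ (by norm_num))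

lemma S_continuousOn (hS : SD S c r0 u) : ContinuousOn S {t | ∀ i, |t i| < r0} := by
  refine (ser_continuousOn (v := fun _ => 0) (ρ := 1) (s := 0) hS zero_le_one (Adm_self c) (by simp)
    (by norm_num) (by simp) 0 (by simp)).congr ?_
  intro t ht
  dsimp only
  rw [ser_zero (ρ := 1) hS (by simp) (by simp) ht (by simp)]
  congr 1; funext i; simp [ln]

/-- coefficients of the derivative function `G` -/
def eG (c : (Fin n → ℕ) → ℝ) (v : Fin n → ℝ) (k : ℕ) : (Fin n → ℕ) → ℝ :=
  fun α => c α * (Polynomial.derivative^[k] (LP v α)).eval 0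

/-- `k`-th derivative at the start of the line -/
def GG (c : (Fin n → ℕ) → ℝ) (v : Fin n → ℝ) (k : ℕ) (t : Fin n → ℝ) : ℝ := ser c v t k 0

lemma eG_adm (hv : ∀ i, 0 ≤ v i) (hρ : 0 < ρ) (hvρ : ∀ i, 2 * ρ * v i ≤ 1) (k : ℕ) :
    Adm c (eG c v k) (k.factorial / ρ ^ k) := by
  intro α
  unfold eG
  rw [abs_mul, mul_comm]
  exact mul_le_mul_of_nonneg_right (LP_deriv_bound hv α hρ hvρ (by simpa using hρ.le) k)
    (abs_nonneg _)

lemma GG_ln (v w t : Fin n → ℝ) (k : ℕ) (s : ℝ) : GG c v k (ln w t s) = ser (eG c v k) w t 0 s := by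
  unfold GG ser
  refine tsum_congr fun α => ?_
  simp only [Function.iterate_zero, id, monomial_ln, eG]; ring

end

section

/-- smooth and vanishing to order `k` at `x` -/
def Vord (g : (Fin n → ℝ) → ℝ) (x : Fin n → ℝ) (k : ℕ) : Prop :=
  ContDiff ℝ (⊤ : ℕ∞) g ∧ ∀ j < k, iteratedFDeriv ℝ j g x = 0

lemma Vord.mul {f g : (Fin n → ℝ) → ℝ} {x : Fin n → ℝ} {a b : ℕ} (hf : Vord f x a)
    (hg : Vord g x b) : Vord (fun y => f y * g y) x (a + b) := by
  refine ⟨hf.1.mul hg.1, fun j hj => ?_⟩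
  have h := norm_iteratedFDeriv_mul_le hf.1 hg.1 x (n := j)
    (by exact_mod_cast le_top)
  rw [← norm_le_zero_iff]
  refine h.trans (le_of_eq (Finset.sum_eq_zero fun i hi => ?_))
  by_cases hia : i < a
  · rw [hf.2 i hia]; simp
  · have hij := Finset.mem_range.1 hi
    have : j - i < b := by omega
    rw [hg.2 _ this]; simp

lemma Vord.const (a : ℝ) (x : Fin n → ℝ) : Vord (fun _ => a) x 0 :=
  ⟨contDiff_const, fun j hj => by omega⟩

lemma Vord.pow {f : (Fin n → ℝ) → ℝ} {x : Fin n → ℝ} {a : ℕ} (hf : Vord f x a) (k : ℕ) :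
    Vord (fun y => f y ^ k) x (k * a) := by
  induction k with
  | zero => simpa using Vord.const 1 x
  | succ k ih =>
    have := ih.mul hf
    simpa only [pow_succ, add_mul, one_mul] using this

lemma Vord.prod {ι : Type*} [DecidableEq ι] {f : ι → (Fin n → ℝ) → ℝ} {x : Fin n → ℝ} {a : ι → ℕ} (s : Finset ι)
    (hf : ∀ i ∈ s, Vord (f i) x (a i)) : Vord (fun y => ∏ i ∈ s, f i y) x (∑ i ∈ s, a i) := by
  induction s using Finset.induction_on with
  | empty => simpa using Vord.const 1 x
  | insert i s his ih =>
    simp only [Finset.prod_insert his, Finset.sum_insert his]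
    exact (hf i (Finset.mem_insert_self _ _)).mul
      (ih fun j hj => hf j (Finset.mem_insert_of_mem hj))

lemma Vord.mono {f : (Fin n → ℝ) → ℝ} {x : Fin n → ℝ} {a b : ℕ} (hf : Vord f x a) (h : b ≤ a) :
    Vord f x b := ⟨hf.1, fun j hj => hf.2 j (hj.trans_le h)⟩

lemma Vord.sum {ι : Type*} {f : ι → (Fin n → ℝ) → ℝ} {x : Fin n → ℝ} {a : ℕ} (s : Finset ι)
    (hf : ∀ i ∈ s, Vord (f i) x a) : Vord (fun y => ∑ i ∈ s, f i y) x a := by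
  refine ⟨ContDiff.sum fun i hi => (hf i hi).1, fun j hj => ?_⟩
  rw [iteratedFDeriv_fun_sum_apply (fun i hi => ((hf i hi).1.contDiffAt.of_le
    (by exact_mod_cast le_top)))]
  exact Finset.sum_eq_zero fun i hi => (hf i hi).2 j hj

lemma Vord.coord {u : Fin n → ℝ} (hu : ∀ i, u i ≠ 0) (i : Fin n) :
    Vord (fun t => t i / u i - 1) u 1 := by
  refine ⟨by fun_prop, fun j hj => ?_⟩
  have : j = 0 := by omega
  subst this
  ext y
  simp [iteratedFDeriv_zero_apply, div_self (hu i)]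

open MvPolynomial in
/-- the recentered face polynomial -/
def HH (F : Finset (Fin n → ℕ)) (b : (Fin n → ℕ) → ℝ) : MvPolynomial (Fin n) ℝ :=
  ∑ α ∈ F, C (b α) * ∏ i, (1 + X i) ^ (α i)

open MvPolynomial in
lemma coeff_line (P : MvPolynomial (Fin n) ℝ) (v : Fin n → ℝ) (j : ℕ) :
    (aeval (fun i => Polynomial.C (v i) * Polynomial.X) P : Polynomial ℝ).coeff j
      = eval v (homogeneousComponent j P) := by
  induction P using MvPolynomial.induction_on' with
  | monomial d a =>
    rw [aeval_monomial]
    have h1 : (d.prod fun i k => (Polynomial.C (v i) * Polynomial.X : Polynomial ℝ) ^ k)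
        = Polynomial.C (d.prod fun i k => v i ^ k) * Polynomial.X ^ d.degree := by
      simp only [Finsupp.prod, mul_pow, Finset.prod_mul_distrib, Finset.prod_pow_eq_pow_sum,
        ← Polynomial.C_pow, map_prod]
      rfl
    rw [h1]
    by_cases hd : d.degree = j
    · have : homogeneousComponent j (MvPolynomial.monomial d a) = MvPolynomial.monomial d a := by
        ext e
        rw [coeff_homogeneousComponent, coeff_monomial]
        by_cases hde : d = e
        · subst hde; simp [hd]
        · simp [hde]
      rw [this, eval_monomial, ← hd]
      rw [show (algebraMap ℝ (Polynomial ℝ)) a = Polynomial.C a from rfl, Polynomial.coeff_C_mul,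
        Polynomial.coeff_C_mul, Polynomial.coeff_X_pow]
      simp
    · have : homogeneousComponent j (MvPolynomial.monomial d a) = 0 := by
        ext e
        rw [coeff_homogeneousComponent, coeff_monomial]
        by_cases hde : d = e
        · subst hde; simp [hd]
        · simp [hde]
      rw [this]
      rw [show (algebraMap ℝ (Polynomial ℝ)) a = Polynomial.C a from rfl, Polynomial.coeff_C_mul,
        Polynomial.coeff_C_mul, Polynomial.coeff_X_pow]
      simp [Ne.symm hd]
  | add p q hp hq => simp [hp, hq]

open MvPolynomial in
lemma HH_line (F : Finset (Fin n → ℕ)) (b : (Fin n → ℕ) → ℝ) (v : Fin n → ℝ) (j : ℕ) :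
    eval v (homogeneousComponent j (HH F b)) = ∑ α ∈ F, b α * (LP v α).coeff j := by
  rw [← coeff_line]
  unfold HH
  simp only [map_sum, map_mul, map_prod, map_pow, map_add, map_one, aeval_X, aeval_C,
    Polynomial.finset_sum_coeff]
  refine Finset.sum_congr rfl fun α _ => ?_
  rw [show (algebraMap ℝ (Polynomial ℝ)) (b α) = Polynomial.C (b α) from rfl,
    Polynomial.coeff_C_mul]
  rfl

open MvPolynomial in
lemma homog_zero {F : Finset (Fin n → ℕ)} {b : (Fin n → ℕ) → ℝ} {M j : ℕ} (hj : j ≤ M)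
    (h : ∀ v : Fin n → ℕ, (∀ i, v i ≤ M) → ∑ α ∈ F, b α * (LP (rc v) α).coeff j = 0) :
    homogeneousComponent j (HH F b) = 0 := by
  apply eq_zero_of_eval_zero_at_prod_finset _
    (fun _ => (Finset.range (M+1)).image (fun k : ℕ => (k : ℝ)))
  · intro i
    rw [Finset.card_image_of_injective _ Nat.cast_injective, Finset.card_range]
    have := degreeOf_le_totalDegree (homogeneousComponent j (HH F b)) i
    have h2 := (homogeneousComponent_isHomogeneous j (HH F b)).totalDegree_le
    omega
  · intro x hx
    have : ∀ i, ∃ k : ℕ, k ≤ M ∧ (k : ℝ) = x i := by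
      intro i
      obtain ⟨k, hk, hk'⟩ := Finset.mem_image.1 (hx i)
      exact ⟨k, by have := Finset.mem_range.1 hk; omega, hk'⟩
    choose v hv hvx using this
    have e : x = rc v := by funext i; exact (hvx i).symm
    rw [e, HH_line]
    exact h v hv

/-- low order coefficients -/
def TQ (p : Polynomial ℝ) (a q : ℝ) : Prop :=
  p.coeff 0 = 1 ∧ p.coeff 1 = a ∧ 2 * p.coeff 2 = a ^ 2 - q

lemma TQ.mul {p p' : Polynomial ℝ} {a a' q q' : ℝ} (h : TQ p a q) (h' : TQ p' a' q') :
    TQ (p * p') (a + a') (q + q') := by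
  obtain ⟨h0, h1, h2⟩ := h
  obtain ⟨h0', h1', h2'⟩ := h'
  refine ⟨?_, ?_, ?_⟩
  · simp [Polynomial.mul_coeff_zero, h0, h0']
  · rw [Polynomial.coeff_mul]
    simp [Finset.Nat.antidiagonal_succ, h0, h0', h1, h1']
    ring
  · rw [Polynomial.coeff_mul]
    simp [Finset.Nat.antidiagonal_succ, h0, h0', h1, h1']
    linarith

lemma TQ.one : TQ 1 0 0 := by
  refine ⟨?_, ?_, ?_⟩ <;> simp [Polynomial.coeff_one]

lemma TQ.pow {p : Polynomial ℝ} {a q : ℝ} (h : TQ p a q) (k : ℕ) : TQ (p ^ k) (k * a) (k * q) := by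
  induction k with
  | zero => simpa using TQ.one
  | succ k ih =>
    have := ih.mul h
    rw [← pow_succ] at this
    convert this using 1 <;> push_cast <;> ring

lemma TQ_LP (v : Fin n → ℝ) (α : Fin n → ℕ) :
    TQ (LP v α) (∑ i, α i * v i) (∑ i, α i * v i ^ 2) := by
  unfold LP
  have : ∀ s : Finset (Fin n), TQ (∏ i ∈ s, (1 + Polynomial.C (v i) * Polynomial.X) ^ (α i))
      (∑ i ∈ s, α i * v i) (∑ i ∈ s, α i * v i ^ 2) := by
    intro s
    induction s using Finset.induction_on with
    | empty => simpa using TQ.one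
    | insert i s his ih =>
      rw [Finset.prod_insert his, Finset.sum_insert his, Finset.sum_insert his]
      refine TQ.mul (TQ.pow ?_ _) ih
      refine ⟨?_, ?_, ?_⟩ <;> simp [Polynomial.coeff_one, Polynomial.coeff_X]
  exact this _

lemma face_low {F : Finset (Fin n → ℕ)} {b : (Fin n → ℕ) → ℝ} {w : Fin n → ℝ} {d : ℝ}
    (hw : ∀ i, 0 < w i) (hF : ∀ α ∈ F, dt w (rc α) = d) (h0 : (0 : Fin n → ℕ) ∉ F)
    (h1 : ∀ i, (Pi.single i 1 : Fin n → ℕ) ∉ F)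
    (hq : ∀ v : Fin n → ℝ, ∑ α ∈ F, b α * (LP v α).coeff 2 = 0) :
    ∑ α ∈ F, b α = 0 ∧ ∀ i, ∑ α ∈ F, b α * α i = 0 := by
  have hq' : ∀ v : Fin n → ℝ, ∑ α ∈ F, b α * ((∑ i, α i * v i)^2 - ∑ i, α i * v i ^ 2) = 0 := by
    intro v
    have : ∑ α ∈ F, b α * ((∑ i, α i * v i)^2 - ∑ i, α i * v i ^ 2)
        = 2 * ∑ α ∈ F, b α * (LP v α).coeff 2 := by
      rw [Finset.mul_sum]
      refine Finset.sum_congr rfl fun α _ => ?_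
      rw [← (TQ_LP v α).2.2]; ring
    rw [this, hq, mul_zero]
  have hdt : ∀ α : Fin n → ℕ, ∑ i, (α i : ℝ) * w i = dt w (rc α) := by
    intro α; unfold dt rc; exact Finset.sum_congr rfl fun i _ => mul_comm _ _
  have hi : ∀ i, ∑ α ∈ F, b α * α i = 0 := by
    intro i
    have e1 := hq' (Pi.single i 1)
    have e2 := hq' w
    have e3 := hq' (fun j => w j + (Pi.single i 1 : Fin n → ℝ) j)
    have key : ∑ α ∈ F, b α * ((∑ j, α j * (w j + (Pi.single i 1 : Fin n → ℝ) j))^2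
          - ∑ j, α j * (w j + (Pi.single i 1 : Fin n → ℝ) j) ^ 2)
        = ∑ α ∈ F, b α * ((∑ j, α j * w j)^2 - ∑ j, α j * w j ^ 2)
        + ∑ α ∈ F, b α * ((∑ j, α j * (Pi.single i 1 : Fin n → ℝ) j)^2
            - ∑ j, α j * ((Pi.single i 1 : Fin n → ℝ) j) ^ 2)
        + 2 * (d - w i) * ∑ α ∈ F, b α * α i := by
      rw [Finset.mul_sum, ← Finset.sum_add_distrib, ← Finset.sum_add_distrib]
      refine Finset.sum_congr rfl fun α hα => ?_
      have hs : ∑ j, (α j : ℝ) * (Pi.single i 1 : Fin n → ℝ) j = α i := by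
        simp [Pi.single_apply]
      have hs2 : ∑ j, (α j : ℝ) * ((Pi.single i 1 : Fin n → ℝ) j)^2 = α i := by
        simp [Pi.single_apply]
      have hs3 : ∑ j, (α j : ℝ) * (w j * (Pi.single i 1 : Fin n → ℝ) j) = α i * w i := by
        simp [Pi.single_apply]
      have ha : ∑ j, (α j : ℝ) * (w j + (Pi.single i 1 : Fin n → ℝ) j) = d + α i := by
        simp only [mul_add, Finset.sum_add_distrib]
        rw [hs, hdt, hF α hα]
      have hb : ∑ j, (α j : ℝ) * (w j + (Pi.single i 1 : Fin n → ℝ) j)^2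
          = ∑ j, (α j : ℝ) * w j ^ 2 + 2 * (α i * w i) + α i := by
        rw [← hs3, ← hs2, Finset.mul_sum, ← Finset.sum_add_distrib, ← Finset.sum_add_distrib]
        refine Finset.sum_congr rfl fun j _ => ?_
        ring
      rw [ha, hb, hs, hs2, hdt, hF α hα]; ring
    rw [key, e1, e2] at e3
    by_contra hne
    have hwd : d - w i = 0 := by
      by_contra h
      apply hne
      have : 2 * (d - w i) ≠ 0 := mul_ne_zero two_ne_zero h
      simpa [h] using e3
    have : ∃ α ∈ F, α i ≠ 0 := by
      by_contra hh
      push Not at hh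
      exact hne (Finset.sum_eq_zero fun α hα => by simp [hh α hα])
    obtain ⟨α, hα, hαi⟩ := this
    apply h1 i
    suffices (Pi.single i 1 : Fin n → ℕ) = α by rwa [this]
    apply rc_inj
    apply dt_eq_of_le hw
    · intro j
      by_cases hj : j = i
      · subst hj; simp [rc]; omega
      · simp [rc, Pi.single_eq_of_ne hj]
    · rw [hF α hα]
      have : dt w (rc (Pi.single i 1 : Fin n → ℕ)) = w i := by
        unfold dt rc
        rw [Finset.sum_eq_single i]
        · simp
        · intro j _ hj; simp [Pi.single_eq_of_ne hj]
        · simp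
      rw [this]; linarith
  refine ⟨?_, hi⟩
  rcases F.eq_empty_or_nonempty with rfl | ⟨α1, hα1⟩
  · simp
  have hd : 0 < d := by
    rw [← hF α1 hα1]
    have : α1 ≠ 0 := fun h => h0 (h ▸ hα1)
    obtain ⟨i, hi⟩ := Function.ne_iff.1 this
    have hi' : 0 < rc α1 i := by
      simp only [rc]; exact_mod_cast Nat.pos_of_ne_zero hi
    exact Finset.sum_pos' (fun j _ => mul_nonneg (hw j).le (Nat.cast_nonneg _))
      ⟨i, Finset.mem_univ _, mul_pos (hw i) hi'⟩
  have : d * ∑ α ∈ F, b α = ∑ i, w i * ∑ α ∈ F, b α * α i := by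
    simp only [Finset.mul_sum]
    rw [Finset.sum_comm]
    refine Finset.sum_congr rfl fun α hα => ?_
    rw [← hF α hα]
    unfold dt rc
    rw [Finset.sum_mul]
    exact Finset.sum_congr rfl fun i _ => by ring
  simp only [hi, mul_zero, Finset.sum_const_zero] at this
  exact (mul_eq_zero.1 this).resolve_left hd.ne'

lemma face_vanish {F : Finset (Fin n → ℕ)} {c : (Fin n → ℕ) → ℝ} {w u : Fin n → ℝ} {d : ℝ}
    (hw : ∀ i, 0 < w i) (hF : ∀ α ∈ F, dt w (rc α) = d) (h0 : (0 : Fin n → ℕ) ∉ F)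
    (h1 : ∀ i, (Pi.single i 1 : Fin n → ℕ) ∉ F) (hu : ∀ i, u i ≠ 0) {M : ℕ} (hM : 2 ≤ M)
    (h : ∀ v : Fin n → ℕ, (∀ i, v i ≤ M) → ∀ k, 2 ≤ k → k ≤ M →
      ∑ α ∈ F, c α * monomial α u * (LP (rc v) α).coeff k = 0) :
    Vord (fun t => ∑ α ∈ F, c α * monomial α t) u (M + 1) := by
  set b : (Fin n → ℕ) → ℝ := fun α => c α * monomial α u with hb
  have hk : ∀ k, 2 ≤ k → k ≤ M → MvPolynomial.homogeneousComponent k (HH F b) = 0 :=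
    fun k hk hkM => homog_zero hkM fun v hv => h v hv k hk hkM
  have hlow := face_low (b := b) hw hF h0 h1 (fun v => by
    rw [← HH_line, hk 2 le_rfl hM]; simp)
  have hall : ∀ k ≤ M, MvPolynomial.homogeneousComponent k (HH F b) = 0 := by
    intro k hkM
    by_cases h2 : 2 ≤ k
    · exact hk k h2 hkM
    apply homog_zero hkM
    intro v _
    have : k = 0 ∨ k = 1 := by omega
    rcases this with rfl | rfl
    · simp only [(TQ_LP (rc v) _).1, mul_one]; exact hlow.1
    · simp only [(TQ_LP (rc v) _).2.1, Finset.mul_sum]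
      rw [Finset.sum_comm]
      refine Finset.sum_eq_zero fun i _ => ?_
      have := hlow.2 i
      calc ∑ α ∈ F, b α * (α i * rc v i) = (∑ α ∈ F, b α * α i) * rc v i := by
            rw [Finset.sum_mul]; exact Finset.sum_congr rfl fun _ _ => by ring
        _ = 0 := by rw [this, zero_mul]
  have hsupp : ∀ e ∈ (HH F b).support, M + 1 ≤ ∑ i, e i := by
    intro e he
    by_contra hlt
    have hdeg : e.degree = ∑ i, e i := Finsupp.degree_eq_sum e
    have := congrArg (MvPolynomial.coeff e) (hall e.degree (by omega))
    rw [MvPolynomial.coeff_homogeneousComponent] at this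
    simp at this
    exact (MvPolynomial.mem_support_iff.1 he) this
  have hrepr : (fun t => ∑ α ∈ F, c α * monomial α t) = fun t => ∑ e ∈ (HH F b).support,
      MvPolynomial.coeff e (HH F b) * ∏ i, (t i / u i - 1) ^ e i := by
    funext t
    rw [← MvPolynomial.eval_eq']
    unfold HH
    simp only [map_sum, map_mul, map_prod, map_pow, map_add, map_one, MvPolynomial.eval_X,
      MvPolynomial.eval_C]
    refine Finset.sum_congr rfl fun α _ => ?_
    simp only [hb, mul_assoc]
    congr 1
    unfold monomial
    rw [← Finset.prod_mul_distrib]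
    refine Finset.prod_congr rfl fun i _ => ?_
    rw [← mul_pow]; congr 1
    have := hu i
    field_simp; ring
  rw [hrepr]
  refine Vord.sum _ fun e he => ?_
  have h2 : Vord (fun t : Fin n → ℝ => ∏ i, (t i / u i - 1) ^ e i) u (∑ i, e i * 1) :=
    Vord.prod Finset.univ fun i _ => (Vord.coord hu i).pow (e i)
  refine ((Vord.const _ u).mul h2).mono ?_
  simpa using hsupp e he

end

section

lemma order_contra {c : (Fin n → ℕ) → ℝ} (hc0 : c 0 = 0) (hc1 : ∀ i, c (Pi.single i 1) = 0)
    {oS : ℕ} (hoS : newtonOrder c = (oS : ℕ∞)) {F : Finset (Fin n → ℕ)} {w u : Fin n → ℝ} {d : ℝ}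
    (hw : ∀ i, 0 < w i) (hd : ∀ α, c α ≠ 0 → d ≤ dt w (rc α))
    (hF : ∀ α, α ∈ F ↔ c α ≠ 0 ∧ dt w (rc α) = d) (hne : F.Nonempty) (hu : ∀ i, u i ≠ 0)
    (h : ∀ v : Fin n → ℕ, (∀ i, v i ≤ max oS 2) → ∀ k, 2 ≤ k → k ≤ max oS 2 →
      ∑ α ∈ F, c α * monomial α u * (LP (rc v) α).coeff k = 0) : False := by
  have hv := face_vanish hw (fun α hα => ((hF α).1 hα).2) (fun h0 => ((hF _).1 h0).1 hc0)
    (fun i hi => ((hF _).1 hi).1 (hc1 i)) hu (le_max_right _ _) h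
  obtain ⟨α0, hα0⟩ := hne
  have hcf := wFace_isCompactFace hw hd ⟨α0, (hF α0).1 hα0⟩
  have hfp : facePoly c (wFace c w d) = fun t => ∑ α ∈ F, c α * monomial α t := by
    funext t
    unfold facePoly
    have e1 := tsum_subtype {α : Fin n → ℕ | (fun i => (α i : ℝ)) ∈ wFace c w d}
      (fun α => c α * monomial α t)
    refine e1.trans ?_
    rw [tsum_eq_sum (s := F)]
    · refine Finset.sum_congr rfl fun α hα => ?_
      rw [Set.indicator_of_mem]
      obtain ⟨h1, h2⟩ := (hF α).1 hα
      exact ⟨rc_mem_poly h1, h2⟩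
    · intro α hα
      by_cases hm : α ∈ {α : Fin n → ℕ | (fun i => (α i : ℝ)) ∈ wFace c w d}
      · rw [Set.indicator_of_mem hm]
        have : c α = 0 := by
          by_contra hcα
          exact hα ((hF α).2 ⟨hcα, hm.2⟩)
        rw [this, zero_mul]
      · rw [Set.indicator_of_notMem hm]
  have hz : facePoly c (wFace c w d) u = 0 := by
    have := hv.2 0 (by omega)
    rw [hfp]
    have h2 := congrArg (fun f => f 0) this
    simpa using h2
  have hord : ((max oS 2 + 1 : ℕ) : ℕ∞) ≤ vanishingOrder (facePoly c (wFace c w d)) u := by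
    apply le_sSup
    intro j hj
    rw [hfp]
    exact hv.2 j (by exact_mod_cast hj)
  have : ((max oS 2 + 1 : ℕ) : ℕ∞) ≤ newtonOrder c :=
    le_sSup ⟨_, hcf, u, hu, hz, hord⟩
  rw [hoS] at this
  have h3 : max oS 2 + 1 ≤ oS := by exact_mod_cast this
  have := le_max_left oS 2
  omega

lemma ultra_const {ι : Type*} [Finite ι] (𝒰 : Ultrafilter ℕ) (f : ℕ → ι) : ∃ a, ∀ᶠ N in 𝒰, f N = a := by
  have : ∀ᶠ N in (𝒰 : Filter ℕ), ∃ a ∈ (Set.univ : Set ι), f N = a := by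
    filter_upwards with N; exact ⟨f N, trivial, rfl⟩
  obtain ⟨a, _, h⟩ := (Ultrafilter.eventually_exists_mem_iff (Set.toFinite _)).1 this
  exact ⟨a, h⟩

lemma ultra_bdd (𝒰 : Ultrafilter ℕ) (f : ℕ → ℝ) (h : ¬ Tendsto f 𝒰 atTop) (h0 : ∀ᶠ N in 𝒰, 0 ≤ f N) :
    ∃ L, Tendsto f 𝒰 (𝓝 L) := by
  rw [tendsto_atTop] at h
  push Not at h
  obtain ⟨B, hB⟩ := h
  have hmem : ∀ᶠ N in 𝒰, f N ∈ Set.Icc 0 B := by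
    filter_upwards [h0, hB] with N h1 h2 using ⟨h1, h2.le⟩
  obtain ⟨L, _, hL⟩ := isCompact_Icc.ultrafilter_le_nhds (𝒰.map f) (le_principal_iff.2 hmem)
  exact ⟨L, hL⟩

lemma dt_sub (w x y : Fin n → ℝ) : dt w (x - y) = dt w x - dt w y := by
  simp [dt, mul_sub, Finset.sum_sub_distrib]

/-- The geometric core: unbounded weights degenerate to a face. -/
lemma degenerate {c : (Fin n → ℕ) → ℝ} (𝒰 : Ultrafilter ℕ) (x : ℕ → Fin n → ℝ) (α0 : Fin n → ℕ)
    (h0 : c α0 ≠ 0)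
    (hx : ∀ i, Tendsto (fun N => x N i) 𝒰 atTop)
    (hmin : ∀ᶠ N in 𝒰, ∀ α, c α ≠ 0 → dt (x N) (rc α0) ≤ dt (x N) (rc α)) :
    ∃ (F : Finset (Fin n → ℕ)) (w p : Fin n → ℝ) (d : ℝ), (∀ i, 0 < w i) ∧
      (∀ α, c α ≠ 0 → d ≤ dt w (rc α)) ∧ (∀ α, α ∈ F ↔ c α ≠ 0 ∧ dt w (rc α) = d) ∧ F.Nonempty ∧
      (∀ α ∈ F, Tendsto (fun N => dt (x N) (rc α) - dt (x N) (rc α0)) 𝒰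
        (𝓝 (dt p (rc α) - dt p (rc α0)))) ∧
      (∀ α, c α ≠ 0 → α ∉ F → Tendsto (fun N => dt (x N) (rc α) - dt (x N) (rc α0)) 𝒰 atTop) := by
  classical
  set f : (Fin n → ℕ) → ℕ → ℝ := fun α N => dt (x N) (rc α) - dt (x N) (rc α0) with hf
  set Fs : Set (Fin n → ℕ) := {α | c α ≠ 0 ∧ ¬ Tendsto (f α) 𝒰 atTop} with hFs
  have hxpos : ∀ᶠ N in 𝒰, ∀ i, 0 < x N i :=
    eventually_all.2 fun i => (hx i).eventually_gt_atTop 0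
  have hnn : ∀ α, c α ≠ 0 → ∀ᶠ N in 𝒰, 0 ≤ f α N := by
    intro α hα
    filter_upwards [hmin] with N hN
    simpa [hf] using hN α hα
  have hfin : Fs.Finite := by
    apply finite_of_antichain
    intro α hα β hβ hle
    by_contra hne
    apply hβ.2
    obtain ⟨i, hi⟩ := Function.ne_iff.1 hne
    have hi' : α i + 1 ≤ β i := by have h3 : α i ≤ β i := hle i; omega
    refine tendsto_atTop_mono' _ ?_ (hx i)
    filter_upwards [hxpos, hnn α hα.1] with N h1 h2
    have e : x N i ≤ dt (x N) (rc β) - dt (x N) (rc α) := by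
      rw [← dt_sub]
      unfold dt
      have hge : ∀ j, 0 ≤ x N j * (rc β - rc α) j := by
        intro j
        refine mul_nonneg (h1 j).le ?_
        simp only [rc, Pi.sub_apply, sub_nonneg]
        exact_mod_cast hle j
      refine le_trans ?_ (Finset.single_le_sum (fun j _ => hge j) (Finset.mem_univ i))
      have : (1:ℝ) ≤ (rc β - rc α) i := by
        simp only [rc, Pi.sub_apply]
        have : ((α i + 1 : ℕ) : ℝ) ≤ β i := by exact_mod_cast hi'
        push_cast at this; linarith
      nlinarith [h1 i]
    simp only [hf] at h2 ⊢; linarith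
  set F := hfin.toFinset with hF
  have hFmem : ∀ α, α ∈ F ↔ c α ≠ 0 ∧ ¬ Tendsto (f α) 𝒰 atTop := by
    intro α; rw [hF, Set.Finite.mem_toFinset]; rfl
  have hα0F : α0 ∈ F := by
    rw [hFmem]
    refine ⟨h0, ?_⟩
    have : f α0 = fun _ => 0 := by funext N; simp [hf]
    rw [this]
    exact not_tendsto_const_atTop _ _
  have hL : ∀ α : F, ∃ L, Tendsto (f α) 𝒰 (𝓝 L) := fun α =>
    ultra_bdd 𝒰 _ ((hFmem α).1 α.2).2 (hnn α ((hFmem α).1 α.2).1)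
  choose L hL using hL
  -- linear algebra
  let Φ : (Fin n → ℝ) →ₗ[ℝ] (F → ℝ) :=
    { toFun := fun q α => dt q (rc α.1) - dt q (rc α0)
      map_add' := by intro a b; funext α; simp [dt, add_mul, Finset.sum_add_distrib]; ring
      map_smul' := by
        intro a b; funext α
        simp [dt, Finset.mul_sum, mul_assoc, mul_sub] }
  obtain ⟨Ψ, hΨ⟩ := Φ.rangeRestrict.exists_rightInverse_of_surjective Φ.range_rangeRestrict
  have hΦx : Tendsto (fun N => Φ (x N)) 𝒰 (𝓝 L) := tendsto_pi_nhds.2 hL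
  have hLr : L ∈ LinearMap.range Φ := by
    have hcl : IsClosed (LinearMap.range Φ : Set (F → ℝ)) :=
      Submodule.closed_of_finiteDimensional _
    exact hcl.mem_of_tendsto hΦx (Eventually.of_forall fun N => ⟨x N, rfl⟩)
  set q : ℕ → Fin n → ℝ := fun N => Ψ (Φ.rangeRestrict (x N)) with hq
  have hΦq : ∀ y, Φ (Ψ y) = y := by
    intro y
    have := congrArg (fun g => ((g y : LinearMap.range Φ) : F → ℝ)) hΨ
    simpa using this
  have hqt : Tendsto q 𝒰 (𝓝 (Ψ ⟨L, hLr⟩)) := by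
    have hcont : Continuous Ψ := Ψ.continuous_of_finiteDimensional
    refine (hcont.tendsto _).comp ?_
    rw [tendsto_subtype_rng]
    exact hΦx
  set p := Ψ ⟨L, hLr⟩ with hp
  have hpF : ∀ α : F, dt p (rc α.1) - dt p (rc α0) = L α := by
    intro α
    have := congrFun (hΦq ⟨L, hLr⟩) α
    exact this
  have hqF : ∀ N, ∀ α ∈ F, dt (q N) (rc α) - dt (q N) (rc α0) = f α N := by
    intro N α hα
    have := congrFun (hΦq (Φ.rangeRestrict (x N))) ⟨α, hα⟩
    exact this
  -- positivity of w
  have hwpos : ∀ᶠ N in 𝒰, ∀ i, 0 < (x N - q N) i := by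
    refine eventually_all.2 fun i => ?_
    have h1 : Tendsto (fun N => q N i) 𝒰 (𝓝 (p i)) := (tendsto_pi_nhds.1 hqt) i
    have h2 : Tendsto (fun N => x N i + -(q N i)) 𝒰 atTop := (hx i).atTop_add h1.neg
    filter_upwards [h2.eventually_gt_atTop 0] with N hN
    simp only [Pi.sub_apply]; linarith
  -- the minimal elements outside F
  set Q : Set (Fin n → ℕ) := {α | c α ≠ 0 ∧ α ∉ F} with hQ
  have hQmin : {α | Minimal (· ∈ Q) α}.Finite := by
    apply finite_of_antichain
    intro a ha b hb hle
    exact le_antisymm hle (hb.2 ha.1 hle)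
  have hQpos : ∀ᶠ N in 𝒰, ∀ α ∈ {α | Minimal (· ∈ Q) α},
      0 < dt (x N - q N) (rc α) - dt (x N - q N) (rc α0) := by
    rw [eventually_all_finite hQmin]
    intro α hα
    have hα' : Tendsto (f α) 𝒰 atTop := by
      have := hα.1
      by_contra hh
      exact this.2 ((hFmem α).2 ⟨this.1, hh⟩)
    have hcd : Continuous (fun q : Fin n → ℝ => dt q (rc α) - dt q (rc α0)) := by
      unfold dt; fun_prop
    have h1 := ((hcd.tendsto p).comp hqt).neg
    have h2 := hα'.atTop_add h1
    filter_upwards [h2.eventually_gt_atTop 0] with N hN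
    have : dt (x N - q N) (rc α) - dt (x N - q N) (rc α0)
        = f α N + -(dt (q N) (rc α) - dt (q N) (rc α0)) := by
      simp only [hf, dt, Pi.sub_apply, sub_mul, Finset.sum_sub_distrib]; ring
    rw [this]; exact hN
  obtain ⟨N, hN1, hN2⟩ := (hwpos.and hQpos).exists
  set w := x N - q N with hw
  set d := dt w (rc α0) with hd
  have hwF : ∀ α ∈ F, dt w (rc α) = d := by
    intro α hα
    have := hqF N α hα
    have e : dt w (rc α) - d = f α N - (dt (q N) (rc α) - dt (q N) (rc α0)) := by
      simp only [hd, hw, hf, dt, Pi.sub_apply, sub_mul, Finset.sum_sub_distrib]; ring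
    rw [this] at e; linarith
  have hwQ : ∀ α ∈ Q, d < dt w (rc α) := by
    intro α hα
    obtain ⟨μ, hμle, hμ⟩ := exists_minimal_le_of_wellFoundedLT (· ∈ Q) α hα
    have h1 := hN2 μ hμ
    have h2 : dt w (rc μ) ≤ dt w (rc α) := dt_mono hN1 fun i => by
      simp only [rc]; exact_mod_cast hμle i
    linarith
  refine ⟨F, w, p, d, hN1, ?_, ?_, ⟨α0, hα0F⟩, ?_, ?_⟩
  · intro α hα
    by_cases h : α ∈ F
    · exact (hwF α h).ge
    · exact (hwQ α ⟨hα, h⟩).le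
  · intro α
    refine ⟨fun h => ⟨((hFmem α).1 h).1, hwF α h⟩, fun ⟨h1, h2⟩ => ?_⟩
    by_contra h
    exact (hwQ α ⟨h1, h⟩).ne' h2
  · intro α hα
    rw [hpF ⟨α, hα⟩]
    exact hL ⟨α, hα⟩
  · intro α h1 h2
    by_contra h
    exact h2 ((hFmem α).2 ⟨h1, h⟩)

end

section

lemma iter_eval_zero (p : Polynomial ℝ) (k : ℕ) :
    (Polynomial.derivative^[k] p).eval 0 = k.factorial * p.coeff k := by
  rw [← Polynomial.coeff_zero_eq_eval_zero, Polynomial.coeff_iterate_derivative]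
  simp [Nat.descFactorial_self]

lemma starFn_nonneg (c : (Fin n → ℕ) → ℝ) (t : Fin n → ℝ) : 0 ≤ starFn c t := by
  rw [starFn_eq]; exact Finset.sum_nonneg fun v _ => amon_nonneg v t

lemma grid_rho {M : ℕ} (hM : 2 ≤ M) {v : Fin n → ℕ} (hv : ∀ i, v i ≤ M) :
    (∀ i, 0 ≤ rc v i) ∧ ∀ i, 2 * (1 / (2 * (M:ℝ))) * rc v i ≤ 1 := by
  have hM' : (0:ℝ) < M := by positivity
  refine ⟨fun i => Nat.cast_nonneg _, fun i => ?_⟩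
  have : rc v i ≤ M := by simp only [rc]; exact_mod_cast hv i
  rw [show 2 * (1 / (2 * (M:ℝ))) * rc v i = rc v i / M by field_simp, div_le_one hM']
  exact this

lemma monomial_sign {σ t : Fin n → ℝ} (h : ∀ i, t i = σ i * |t i|) (α : Fin n → ℕ) :
    monomial α t = monomial α σ * amon α t := by
  unfold monomial amon
  rw [← Finset.prod_mul_distrib]
  refine Finset.prod_congr rfl fun i _ => ?_
  rw [← mul_pow, ← h i]

lemma lower_bound {S : (Fin n → ℝ) → ℝ} {c : (Fin n → ℕ) → ℝ} {r0 : ℝ} {u : (Fin n → ℕ) → ℝ}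
    (hS : SD S c r0 u) (hc0 : c 0 = 0) (hc1 : ∀ i, c (Pi.single i 1) = 0)
    {oS : ℕ} (hoS : newtonOrder c = (oS : ℕ∞)) :
    ∃ r c0 : ℝ, 0 < r ∧ r ≤ r0 ∧ 0 < c0 ∧ ∀ t : Fin n → ℝ, (∀ i, t i ≠ 0) → (∀ i, |t i| < r) →
      ∃ (v : Fin n → ℕ) (k : ℕ), (∀ i, v i ≤ max oS 2) ∧ 2 ≤ k ∧ k ≤ max oS 2 ∧
        c0 * starFn c t ≤ |GG c (rc v) k t| := by
  classical
  by_contra hcon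
  push Not at hcon
  have hr0 := hS.pos
  have hseq : ∀ N : ℕ, ∃ t : Fin n → ℝ, (∀ i, t i ≠ 0) ∧ (∀ i, |t i| < r0 / (N + 1)) ∧
      ∀ (v : Fin n → ℕ) (k : ℕ), (∀ i, v i ≤ max oS 2) → 2 ≤ k → k ≤ max oS 2 →
        |GG c (rc v) k t| < 1 / ((N:ℝ) + 1) * starFn c t := fun N =>
    hcon (r0 / (N+1)) (1/((N:ℝ)+1)) (by positivity)
      (div_le_self hr0.le (by have : (0:ℝ) ≤ N := Nat.cast_nonneg N
                              linarith)) (by positivity)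
  choose t ht htr htG using hseq
  have htr0 : ∀ N i, |t N i| < r0 := fun N i => (htr N i).trans_le
    (div_le_self hr0.le (by have : (0:ℝ) ≤ N := Nat.cast_nonneg N
                            linarith))
  have htr1 : ∀ N i, |t N i| < 1 := fun N i => (htr0 N i).trans hS.lt
  set 𝒰 : Ultrafilter ℕ := hyperfilter ℕ with h𝒰
  have h𝒰le : (𝒰 : Filter ℕ) ≤ atTop := by
    have := hyperfilter_le_cofinite (α := ℕ)
    rwa [Nat.cofinite_eq_atTop] at this
  -- signs
  obtain ⟨sg, hsg⟩ := ultra_const 𝒰 (fun N i => decide (0 < t N i))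
  set σ : Fin n → ℝ := fun i => if sg i then 1 else -1 with hσ
  have hσne : ∀ i, σ i ≠ 0 := by intro i; simp only [hσ]; split_ifs <;> norm_num
  have hσt : ∀ᶠ N in 𝒰, ∀ i, t N i = σ i * |t N i| := by
    filter_upwards [hsg] with N hN i
    have h1 := congrFun hN i
    simp only [hσ, ← h1, decide_eq_true_eq]
    split_ifs with h
    · rw [abs_of_pos h, one_mul]
    · rw [abs_of_nonpos (not_lt.1 h)]; ring
  -- vertex
  have hvx : ∀ N, ∃ v : VE c, ∀ α, c α ≠ 0 → amon α (t N) ≤ amon v.1 (t N) := fun N => by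
    obtain ⟨v, hv, h⟩ := exists_VE_min hS.hc (ht N) (htr1 N)
    exact ⟨⟨v, hv⟩, h⟩
  choose vx hvx using hvx
  obtain ⟨⟨α0, hα0⟩, hα0c⟩ := ultra_const 𝒰 vx
  have hdom : ∀ᶠ N in 𝒰, ∀ α, c α ≠ 0 → amon α (t N) ≤ amon α0 (t N) := by
    filter_upwards [hα0c] with N hN α hα
    have := hvx N α hα
    rwa [hN] at this
  have hcα0 : c α0 ≠ 0 := supp_of_vertex (mem_VE.1 hα0)
  set x : ℕ → Fin n → ℝ := fun N i => - Real.log |t N i| with hx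
  have hae : ∀ N α, amon α (t N) = Real.exp (- dt (x N) (rc α)) := fun N α => amon_eq_exp α (ht N)
  have hxt : ∀ i, Tendsto (fun N => x N i) 𝒰 atTop := by
    intro i
    have h1 : Tendsto (fun N => |t N i|) 𝒰 (𝓝[>] 0) := by
      rw [tendsto_nhdsWithin_iff]
      refine ⟨?_, Eventually.of_forall fun N => abs_pos.2 (ht N i)⟩
      have h2 : Tendsto (fun N : ℕ => r0 / ((N:ℝ) + 1)) atTop (𝓝 0) :=
        tendsto_const_div_atTop_nhds_zero_nat r0 |>.comp (tendsto_add_atTop_nat 1) |>.congr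
          (fun N => by simp)
      exact squeeze_zero (fun N => abs_nonneg _) (fun N => (htr N i).le) (h2.mono_left h𝒰le)
    exact tendsto_neg_atBot_atTop.comp (Real.tendsto_log_nhdsGT_zero.comp h1)
  obtain ⟨F, w, p, d, hw, hd, hF, hFne, hlim, hinf⟩ := degenerate (c := c) 𝒰 x α0 hcα0 hxt (by
    filter_upwards [hdom] with N hN α hα
    have := hN α hα
    rw [hae, hae, Real.exp_le_exp] at this
    linarith)
  set uu : Fin n → ℝ := fun i => σ i * Real.exp (-p i) with huu
  have huu0 : ∀ i, uu i ≠ 0 := fun i => mul_ne_zero (hσne i) (Real.exp_pos _).ne'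
  refine order_contra hc0 hc1 hoS hw hd hF hFne huu0 (fun v hv k hk hkM => ?_)
  -- ratio
  have hM2 : 2 ≤ max oS 2 := le_max_right _ _
  set ρ : ℝ := 1 / (2 * ((max oS 2 : ℕ):ℝ)) with hρ
  have hρ0 : 0 < ρ := by rw [hρ]; positivity
  obtain ⟨hv0, hvρ⟩ := grid_rho hM2 hv
  set V : ℝ := ((VE c).card : ℝ) with hV
  have hstar : ∀ᶠ N in 𝒰, starFn c (t N) ≤ V * amon α0 (t N) := by
    filter_upwards [hdom] with N hN
    rw [starFn_eq, hV, ← nsmul_eq_mul]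
    exact Finset.sum_le_card_nsmul _ _ _ fun v hv => hN v (supp_of_vertex (mem_VE.1 hv))
  set g : ℕ → (Fin n → ℕ) → ℝ := fun N α =>
    c α * monomial α (t N) * (Polynomial.derivative^[k] (LP (rc v) α)).eval 0 / amon α0 (t N) with hg
  set gl : (Fin n → ℕ) → ℝ := fun α => if α ∈ F then
    c α * (monomial α σ * Real.exp (-(dt p (rc α) - dt p (rc α0)))) *
      (Polynomial.derivative^[k] (LP (rc v) α)).eval 0 else 0 with hgl
  have hT : Tendsto (fun N => ∑' α, g N α) 𝒰 (𝓝 (∑' α, gl α)) := by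
    refine tendsto_tsum_of_dominated_convergence
      (bound := fun α => 1 * (k.factorial / ρ ^ k) * V * u α) (hS.summ.mul_left _) ?_ ?_
    · intro α
      by_cases hcα : c α = 0
      · have hnF : α ∉ F := fun h => ((hF α).1 h).1 hcα
        simp only [hg, hgl, hcα, hnF, if_false, zero_mul, zero_div]
        exact tendsto_const_nhds
      have hgN : (fun N => g N α) =ᶠ[𝒰] fun N => c α * (monomial α σ *
          Real.exp (-(dt (x N) (rc α) - dt (x N) (rc α0)))) *
          (Polynomial.derivative^[k] (LP (rc v) α)).eval 0 := by
        filter_upwards [hσt] with N hN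
        simp only [hg]
        rw [monomial_sign hN, hae, hae, neg_sub, sub_eq_add_neg, Real.exp_add,
          Real.exp_neg (dt (x N) (rc α0))]
        field_simp
      rw [tendsto_congr' hgN]
      by_cases hαF : α ∈ F
      · simp only [hgl, hαF, if_true]
        exact (((Real.continuous_exp.tendsto _).comp (hlim α hαF).neg).const_mul _).const_mul _
          |>.mul_const _
      · simp only [hgl, hαF, if_false]
        have h1 := Real.tendsto_exp_neg_atTop_nhds_zero.comp (hinf α hcα hαF)
        have h2 := ((h1.const_mul (monomial α σ)).const_mul (c α)).mul_const
          ((Polynomial.derivative^[k] (LP (rc v) α)).eval 0)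
        simpa using h2
    · filter_upwards [hstar] with N hN α
      have h1 := ser_term hS zero_le_one (Adm_self c) hv0 hρ0 hvρ (ht N) (htr0 N) k
        (s := 0) (by simpa using hρ0.le) α
      have hpos := amon_pos α0 (ht N)
      simp only [hg]
      rw [norm_div, Real.norm_of_nonneg hpos.le, div_le_iff₀ hpos]
      refine h1.trans ?_
      have hu0 := hS.unn α
      calc 1 * (k.factorial / ρ ^ k) * starFn c (t N) * u α
          ≤ 1 * (k.factorial / ρ ^ k) * (V * amon α0 (t N)) * u α := by gcongr
        _ = _ := by ring
  have hsum : ∀ N, ∑' α, g N α = GG c (rc v) k (t N) / amon α0 (t N) := by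
    intro N; simp only [hg]; rw [tsum_div_const]; rfl
  have hzero : Tendsto (fun N => ∑' α, g N α) 𝒰 (𝓝 0) := by
    have h2 : Tendsto (fun N : ℕ => V / ((N:ℝ) + 1)) atTop (𝓝 0) :=
      tendsto_const_div_atTop_nhds_zero_nat V |>.comp (tendsto_add_atTop_nat 1) |>.congr
        (fun N => by simp)
    refine squeeze_zero_norm' ?_ (h2.mono_left h𝒰le)
    filter_upwards [hstar] with N hN
    have hpos := amon_pos α0 (ht N)
    rw [hsum, norm_div, Real.norm_of_nonneg hpos.le, div_le_iff₀ hpos]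
    refine (htG N v k hv hk hkM).le.trans ?_
    calc 1 / ((N:ℝ) + 1) * starFn c (t N) ≤ 1 / ((N:ℝ) + 1) * (V * amon α0 (t N)) := by gcongr
      _ = _ := by ring
  have hgl0 : ∑' α, gl α = 0 := tendsto_nhds_unique hT hzero
  rw [tsum_eq_sum (s := F) (fun α hα => by simp [hgl, hα])] at hgl0
  have hmon : ∀ α : Fin n → ℕ, monomial α uu = monomial α σ * Real.exp (- dt p (rc α)) := by
    intro α
    unfold dt monomial rc
    rw [← Finset.sum_neg_distrib, Real.exp_sum, ← Finset.prod_mul_distrib]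
    refine Finset.prod_congr rfl fun i _ => ?_
    simp only [huu]
    rw [mul_pow, ← Real.exp_nat_mul]; congr 2; ring
  have hfac : ((k.factorial : ℝ) * Real.exp (dt p (rc α0))) *
      ∑ α ∈ F, c α * monomial α uu * (LP (rc v) α).coeff k = ∑ α ∈ F, gl α := by
    rw [Finset.mul_sum]
    refine Finset.sum_congr rfl fun α hα => ?_
    simp only [hgl, hα, if_true, hmon, iter_eval_zero]
    rw [neg_sub, sub_eq_add_neg, Real.exp_add]; ring
  rw [hgl0] at hfac
  exact (mul_eq_zero.1 hfac).resolve_left (by positivity)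

end

section

/-- Jacobian of the dilation -/
def Jac (v : Fin n → ℝ) (s : ℝ) : ℝ := ∏ i, (1 + s * v i)

lemma integral_dil {E : Type*} [NormedAddCommGroup E] [NormedSpace ℝ E] (Ψ : (Fin n → ℝ) → E)
    (v : Fin n → ℝ) (s : ℝ) (hJ : 0 < Jac v s) :
    ∫ t, Jac v s • Ψ (ln v t s) = ∫ t, Ψ t := by
  set D : Fin n → ℝ := fun i => 1 + s * v i with hD
  have hdet : (Matrix.diagonal D).det = Jac v s := by rw [Matrix.det_diagonal]; rfl
  have h := Real.smul_map_diagonal_volume_pi (D := D) (by rw [hdet]; exact hJ.ne')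
  have hln : ∀ t, ln v t s = Matrix.toLin' (Matrix.diagonal D) t := by
    intro t; funext i; simp [ln, hD, Matrix.mulVec_diagonal, mul_comm]
  have hemb : MeasurableEmbedding (Matrix.toLin' (Matrix.diagonal D)) := by
    have hinj : Function.Injective (Matrix.toLin' (Matrix.diagonal D)) := by
      intro x y hxy
      funext i
      have h1 := congrFun hxy i
      have hi : D i ≠ 0 := by
        have h2 : ∏ i, D i ≠ 0 := by have := hJ.ne'; exact this
        exact Finset.prod_ne_zero_iff.1 h2 i (Finset.mem_univ _)
      simp only [Matrix.toLin'_apply, Matrix.mulVec_diagonal] at h1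
      exact mul_left_cancel₀ hi h1
    exact (LinearMap.continuous_of_finiteDimensional _).measurableEmbedding hinj
  conv_rhs => rw [← h]
  rw [integral_smul_measure, hemb.integral_map, hdet, abs_of_pos hJ, ENNReal.toReal_ofReal hJ.le,
    integral_smul]
  simp only [hln]

lemma integrable_dil {Ψ : (Fin n → ℝ) → ℂ} (hΨ : Integrable Ψ)
    (v : Fin n → ℝ) (s : ℝ) (hJ : 0 < Jac v s) : Integrable (fun t => Ψ (ln v t s)) := by
  set D : Fin n → ℝ := fun i => 1 + s * v i with hD
  have hdet : (Matrix.diagonal D).det = Jac v s := by rw [Matrix.det_diagonal]; rfl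
  have h := Real.map_matrix_volume_pi_eq_smul_volume_pi (M := Matrix.diagonal D)
    (by rw [hdet]; exact hJ.ne')
  have hln : ∀ t, ln v t s = Matrix.toLin' (Matrix.diagonal D) t := by
    intro t; funext i; simp [ln, hD, Matrix.mulVec_diagonal, mul_comm]
  have h2 : Integrable Ψ (Measure.map (Matrix.toLin' (Matrix.diagonal D)) volume) := by
    rw [h]; exact hΨ.smul_measure ENNReal.ofReal_ne_top
  have := h2.comp_measurable (LinearMap.continuous_of_finiteDimensional _).measurable
  simpa only [Function.comp_def, ← hln] using this

lemma Jac_pos {v : Fin n → ℝ} (hv : ∀ i, 0 ≤ v i) {s : ℝ} (hs : 0 ≤ s) : 0 < Jac v s :=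
  Finset.prod_pos fun i _ => by have := mul_nonneg hs (hv i); linarith

lemma avg {Ψ : (Fin n → ℝ) → ℂ} (hm : Measurable Ψ) (hΨ : Integrable Ψ) {v : Fin n → ℝ}
    (hv : ∀ i, 0 ≤ v i) {h : ℝ} (hh : 0 < h) {B : (Fin n → ℝ) → ℝ} (hB : Integrable B)
    (hin : ∀ᵐ t, ‖∫ s in (0:ℝ)..h, (Jac v s : ℂ) * Ψ (ln v t s)‖ ≤ B t) :
    ‖∫ t, Ψ t‖ ≤ (1 / h) * ∫ t, B t := by
  set F : (Fin n → ℝ) × ℝ → ℂ := fun p => (Jac v p.2 : ℂ) * Ψ (ln v p.1 p.2) with hF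
  have hFm : Measurable F := by
    refine Measurable.mul ?_ (hm.comp ?_)
    · unfold Jac; fun_prop
    · unfold ln; fun_prop
  have hnorm : ∀ s ∈ Ioc (0:ℝ) h, ∫ t, ‖F (t, s)‖ = ∫ t, ‖Ψ t‖ := by
    intro s hs
    have hJ := Jac_pos hv hs.1.le
    rw [← integral_dil (fun t => ‖Ψ t‖) v s hJ]
    refine integral_congr_ae (ae_of_all _ fun t => ?_)
    simp [hF, abs_of_pos hJ]
  have hFi : Integrable F (volume.prod (volume.restrict (Ioc 0 h))) := by
    rw [integrable_prod_iff' hFm.aestronglyMeasurable]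
    constructor
    · filter_upwards [ae_restrict_mem measurableSet_Ioc] with s hs
      exact (integrable_dil hΨ v s (Jac_pos hv hs.1.le)).const_mul (Jac v s : ℂ)
    · refine (integrable_const (∫ t, ‖Ψ t‖)).congr ?_
      filter_upwards [ae_restrict_mem measurableSet_Ioc] with s hs
      exact (hnorm s hs).symm
  have hsw := integral_integral_swap (f := fun t s => F (t, s)) hFi
  have e1 : ∫ s in Ioc 0 h, ∫ t, F (t, s) = (h : ℂ) * ∫ t, Ψ t := by
    rw [setIntegral_congr_fun (g := fun _ => ∫ t, Ψ t) measurableSet_Ioc]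
    · simp [hh.le]
    · intro s hs
      dsimp only
      rw [← integral_dil Ψ v s (Jac_pos hv hs.1.le)]
      simp [hF]
  rw [e1] at hsw
  have h3 : ‖∫ t, ∫ s in Ioc 0 h, F (t, s)‖ ≤ ∫ t, B t := by
    refine norm_integral_le_of_norm_le hB ?_
    filter_upwards [hin] with t ht
    rwa [intervalIntegral.integral_of_le hh.le] at ht
  rw [hsw, norm_mul, Complex.norm_real, Real.norm_of_nonneg hh.le] at h3
  rw [one_div, ← div_eq_inv_mul, le_div_iff₀ hh, mul_comm]
  exact h3

end

section

/-- bounded and Lipschitz on `[0,h]` with the same constant -/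
def BL {E : Type*} [NormedAddCommGroup E] (h A : ℝ) (f : ℝ → E) : Prop :=
  (∀ s ∈ Icc 0 h, ‖f s‖ ≤ A) ∧ ∀ s ∈ Icc 0 h, ∀ s' ∈ Icc 0 h, ‖f s - f s'‖ ≤ A * |s - s'|

section
variable {E : Type*} [NormedAddCommGroup E] {h A B : ℝ}

lemma BL.nonneg {f : ℝ → E} (hh : 0 ≤ h) (hf : BL h A f) : 0 ≤ A :=
  (norm_nonneg _).trans (hf.1 0 ⟨le_rfl, hh⟩)

lemma BL.mono {f : ℝ → E} (hf : BL h A f) (hAB : A ≤ B) : BL h B f :=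
  ⟨fun s hs => (hf.1 s hs).trans hAB, fun s hs s' hs' => (hf.2 s hs s' hs').trans
    (mul_le_mul_of_nonneg_right hAB (abs_nonneg _))⟩

lemma BL.congr {f g : ℝ → E} (hf : BL h A f) (hfg : ∀ s ∈ Icc 0 h, f s = g s) : BL h A g :=
  ⟨fun s hs => by rw [← hfg s hs]; exact hf.1 s hs,
    fun s hs s' hs' => by rw [← hfg s hs, ← hfg s' hs']; exact hf.2 s hs s' hs'⟩

lemma BL.add {f g : ℝ → E} (hf : BL h A f) (hg : BL h B g) : BL h (A + B) (fun s => f s + g s) := by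
  refine ⟨fun s hs => (norm_add_le _ _).trans (add_le_add (hf.1 s hs) (hg.1 s hs)),
    fun s hs s' hs' => ?_⟩
  have e : f s + g s - (f s' + g s') = (f s - f s') + (g s - g s') := by abel
  rw [e, add_mul]
  exact (norm_add_le _ _).trans (add_le_add (hf.2 s hs s' hs') (hg.2 s hs s' hs'))

lemma BL.sum {ι : Type*} (F : Finset ι) {f : ι → ℝ → E} (hf : ∀ i ∈ F, BL h A (f i)) :
    BL h (F.card * A) (fun s => ∑ i ∈ F, f i s) := by
  classical
  induction F using Finset.induction_on with
  | empty => constructor <;> simp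
  | insert i F hi ih =>
    have h1 := (hf i (Finset.mem_insert_self _ _)).add
      (ih fun j hj => hf j (Finset.mem_insert_of_mem hj))
    rw [Finset.card_insert_of_notMem hi]
    refine (h1.mono ?_).congr fun s _ => ?_
    · push_cast; linarith
    · rw [Finset.sum_insert hi]

variable {𝕜 : Type*} [RCLike 𝕜]

lemma BL.mul {f g : ℝ → 𝕜} (hh : 0 ≤ h) (hf : BL h A f) (hg : BL h B g) :
    BL h (2 * A * B) (fun s => f s * g s) := by
  have hA := hf.nonneg hh
  have hB := hg.nonneg hh
  refine ⟨fun s hs => ?_, fun s hs s' hs' => ?_⟩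
  · rw [norm_mul]
    have := mul_le_mul (hf.1 s hs) (hg.1 s hs) (norm_nonneg _) hA
    nlinarith [mul_nonneg hA hB]
  · have e : f s * g s - f s' * g s' = (f s - f s') * g s + f s' * (g s - g s') := by ring
    rw [e]
    refine (norm_add_le _ _).trans ?_
    rw [norm_mul, norm_mul]
    have h1 := mul_le_mul (hf.2 s hs s' hs') (hg.1 s hs) (norm_nonneg _)
      (mul_nonneg hA (abs_nonneg _))
    have h2 := mul_le_mul (hf.1 s' hs') (hg.2 s hs s' hs') (norm_nonneg _) hA
    linarith

lemma BL.prod {ι : Type*} (hh : 0 ≤ h) (F : Finset ι) {f : ι → ℝ → 𝕜}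
    (hf : ∀ i ∈ F, BL h A (f i)) :
    BL h ((2 * A) ^ F.card) (fun s => ∏ i ∈ F, f i s) := by
  classical
  induction F using Finset.induction_on with
  | empty => constructor <;> simp
  | insert i F hi ih =>
    have h1 := (hf i (Finset.mem_insert_self _ _)).mul hh
      (ih fun j hj => hf j (Finset.mem_insert_of_mem hj))
    rw [Finset.card_insert_of_notMem hi]
    refine (h1.mono ?_).congr fun s _ => ?_
    · rw [pow_succ]; linarith
    · rw [Finset.prod_insert hi]

lemma BL.ofReal {f : ℝ → ℝ} (hf : BL h A f) : BL h A (fun s => (f s : ℂ)) := by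
  refine ⟨fun s hs => ?_, fun s hs s' hs' => ?_⟩
  · rw [Complex.norm_real]; exact hf.1 s hs
  · rw [← Complex.ofReal_sub, Complex.norm_real]; exact hf.2 s hs s' hs'

lemma BL.inv {f : ℝ → ℝ} {δ : ℝ} (hh : 0 ≤ h) (hδ : 0 < δ) (hf : BL h A f)
    (hl : ∀ s ∈ Icc 0 h, δ ≤ f s) :
    BL h (1 / δ + A / δ ^ 2) (fun s => (f s)⁻¹) := by
  have hA := hf.nonneg hh
  refine ⟨fun s hs => ?_, fun s hs s' hs' => ?_⟩
  · have h1 : 0 < f s := hδ.trans_le (hl s hs)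
    rw [Real.norm_of_nonneg (inv_nonneg.2 h1.le), ← one_div]
    have : 1 / f s ≤ 1 / δ := one_div_le_one_div_of_le hδ (hl s hs)
    have : 0 ≤ A / δ ^ 2 := by positivity
    linarith
  · have h1 : 0 < f s := hδ.trans_le (hl s hs)
    have h2 : 0 < f s' := hδ.trans_le (hl s' hs')
    have e : (f s)⁻¹ - (f s')⁻¹ = (f s' - f s) / (f s * f s') := by field_simp
    rw [e, norm_div, norm_sub_rev, Real.norm_of_nonneg (mul_pos h1 h2).le]
    have h3 : δ ^ 2 ≤ f s * f s' := by
      rw [sq]; exact mul_le_mul (hl s hs) (hl s' hs') hδ.le h1.le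
    have h4 : ‖f s - f s'‖ / (f s * f s') ≤ A * |s - s'| / δ ^ 2 :=
      div_le_div₀ (mul_nonneg hA (abs_nonneg _)) (hf.2 s hs s' hs') (by positivity) h3
    refine h4.trans ?_
    have h5 : 0 ≤ 1 / δ * |s - s'| := by positivity
    have h6 : A * |s - s'| / δ ^ 2 = A / δ ^ 2 * |s - s'| := by ring
    rw [add_mul]; linarith

lemma BL.posPart {f : ℝ → ℝ} {δ : ℝ} (hδ : 0 ≤ δ) (hf : BL h A f) :
    BL h A (fun s => max 0 (|f s| - δ)) := by
  refine ⟨fun s hs => ?_, fun s hs s' hs' => ?_⟩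
  · have := hf.1 s hs
    rw [Real.norm_eq_abs] at this
    rw [Real.norm_of_nonneg (le_max_left _ _)]
    exact max_le ((abs_nonneg _).trans this) (by linarith)
  · refine le_trans ?_ (hf.2 s hs s' hs')
    rw [Real.norm_eq_abs, Real.norm_eq_abs]
    refine (abs_max_sub_max_le_max _ _ _ _).trans ?_
    rw [sub_self, abs_zero, sub_sub_sub_cancel_right]
    exact max_le (abs_nonneg _) (abs_abs_sub_abs_le_abs_sub _ _)

/-- derivative criterion -/
lemma BL.of_deriv {f f' : ℝ → ℝ} (hb : ∀ s ∈ Icc 0 h, |f s| ≤ A)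
    (hd : ∀ s ∈ Icc 0 h, HasDerivAt f (f' s) s) (hd' : ∀ s ∈ Icc 0 h, |f' s| ≤ A) : BL h A f := by
  refine ⟨hb, fun s hs s' hs' => ?_⟩
  exact (convex_Icc 0 h).norm_image_sub_le_of_norm_hasDerivWithin_le
    (fun x hx => (hd x hx).hasDerivWithinAt) hd' hs' hs

end

/-- log-Lipschitz on `[0,h]` -/
def LL (h L : ℝ) (f : ℝ → ℝ) : Prop :=
  (∀ s ∈ Icc 0 h, 0 < f s) ∧ ∀ s ∈ Icc 0 h, ∀ s' ∈ Icc 0 h, f s ≤ f s' * exp (L * |s - s'|)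

section
variable {h L L' : ℝ}

lemma LL.mono {f : ℝ → ℝ} (hf : LL h L f) (hL : L ≤ L') : LL h L' f :=
  ⟨hf.1, fun s hs s' hs' => (hf.2 s hs s' hs').trans (mul_le_mul_of_nonneg_left
    (exp_le_exp.2 (mul_le_mul_of_nonneg_right hL (abs_nonneg _))) (hf.1 s' hs').le)⟩

lemma LL.min {f g : ℝ → ℝ} (hf : LL h L f) (hg : LL h L g) : LL h L (fun s => min (f s) (g s)) := by
  refine ⟨fun s hs => lt_min (hf.1 s hs) (hg.1 s hs), fun s hs s' hs' => ?_⟩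
  rw [min_mul_of_nonneg _ _ (exp_pos _).le]
  exact min_le_min (hf.2 s hs s' hs') (hg.2 s hs s' hs')

lemma LL.const_mul {f : ℝ → ℝ} {a : ℝ} (ha : 0 < a) (hf : LL h L f) : LL h L (fun s => a * f s) :=
  ⟨fun s hs => mul_pos ha (hf.1 s hs), fun s hs s' hs' => by
    rw [mul_assoc]; exact mul_le_mul_of_nonneg_left (hf.2 s hs s' hs') ha.le⟩

lemma LL.mul {f g : ℝ → ℝ} (hf : LL h L f) (hg : LL h L' g) :
    LL h (L + L') (fun s => f s * g s) := by
  refine ⟨fun s hs => mul_pos (hf.1 s hs) (hg.1 s hs), fun s hs s' hs' => ?_⟩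
  have := mul_le_mul (hf.2 s hs s' hs') (hg.2 s hs s' hs') (hg.1 s hs).le
    (mul_nonneg (hf.1 s' hs').le (exp_pos _).le)
  refine this.trans (le_of_eq ?_)
  rw [add_mul, exp_add]; ring

lemma LL.one : LL h 0 (fun _ => 1) := ⟨by simp, by simp⟩

lemma LL.pow {f : ℝ → ℝ} (hf : LL h L f) (k : ℕ) : LL h (k * L) (fun s => f s ^ k) := by
  induction k with
  | zero => simpa using LL.one
  | succ k ih =>
    have := ih.mul hf
    push_cast
    rw [add_mul, one_mul]
    simpa only [pow_succ] using this

lemma LL.prod {ι : Type*} (F : Finset ι) {f : ι → ℝ → ℝ} {l : ι → ℝ}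
    (hf : ∀ i ∈ F, LL h (l i) (f i)) :
    LL h (∑ i ∈ F, l i) (fun s => ∏ i ∈ F, f i s) := by
  classical
  induction F using Finset.induction_on with
  | empty => simpa using LL.one
  | insert i F hi ih =>
    have h1 := (hf i (Finset.mem_insert_self _ _)).mul
      (ih fun j hj => hf j (Finset.mem_insert_of_mem hj))
    rw [Finset.sum_insert hi]
    simpa only [Finset.prod_insert hi] using h1

lemma LL.sum {ι : Type*} {F : Finset ι} (hF : F.Nonempty) {f : ι → ℝ → ℝ}
    (hf : ∀ i ∈ F, LL h L (f i)) : LL h L (fun s => ∑ i ∈ F, f i s) := by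
  refine ⟨fun s hs => Finset.sum_pos (fun i hi => (hf i hi).1 s hs) hF, fun s hs s' hs' => ?_⟩
  rw [Finset.sum_mul]
  exact Finset.sum_le_sum fun i hi => (hf i hi).2 s hs s' hs'

lemma LL.ciInf {ι : Type*} [Finite ι] [Nonempty ι] {f : ι → ℝ → ℝ}
    (hf : ∀ i, LL h L (f i)) : LL h L (fun s => ⨅ i, f i s) := by
  refine ⟨fun s hs => ?_, fun s hs s' hs' => ?_⟩
  · obtain ⟨i, hi⟩ := exists_eq_ciInf_of_finite (f := fun i => f i s)
    dsimp only; rw [← hi]; exact (hf i).1 s hs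
  · obtain ⟨i, hi⟩ := exists_eq_ciInf_of_finite (f := fun i => f i s')
    dsimp only; rw [← hi]
    exact (ciInf_le (Set.finite_range _).bddBelow i).trans ((hf i).2 s hs s' hs')

lemma LL.lin {v : ℝ} (hv : 0 ≤ v) : LL h v (fun s => 1 + s * v) := by
  refine ⟨fun s hs => by have := mul_nonneg hs.1 hv; linarith, fun s hs s' hs' => ?_⟩
  have h1 : 1 + v * |s - s'| ≤ exp (v * |s - s'|) := by
    have := add_one_le_exp (v * |s - s'|); linarith
  have h2 : 0 ≤ s' * v := mul_nonneg hs'.1 hv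
  have h3 : s * v - s' * v ≤ v * |s - s'| := by
    have := mul_le_mul_of_nonneg_left (le_abs_self (s - s')) hv
    linarith
  have h4 : 0 ≤ v * |s - s'| := mul_nonneg hv (abs_nonneg _)
  have := mul_le_mul_of_nonneg_left h1 (by linarith : 0 ≤ 1 + s' * v)
  nlinarith

lemma LL.log_lip {f : ℝ → ℝ} (hf : LL h L f) {s s' : ℝ} (hs : s ∈ Icc 0 h) (hs' : s' ∈ Icc 0 h) :
    |log (f s) - log (f s')| ≤ L * |s - s'| := by
  have key : ∀ s ∈ Icc 0 h, ∀ s' ∈ Icc 0 h, log (f s) - log (f s') ≤ L * |s - s'| := by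
    intro s hs s' hs'
    have h1 := log_le_log (hf.1 s hs) (hf.2 s hs s' hs')
    rw [log_mul (hf.1 s' hs').ne' (exp_pos _).ne', log_exp] at h1
    linarith
  rw [abs_le]
  have := key s' hs' s hs
  rw [abs_sub_comm] at this
  exact ⟨by linarith, key s hs s' hs'⟩

lemma cexp_lip (z : ℂ) (a b Q : ℝ) (ha : exp (z.re * a) ≤ Q) (hb : exp (z.re * b) ≤ Q) :
    ‖Complex.exp (z * a) - Complex.exp (z * b)‖ ≤ ‖z‖ * Q * |a - b| := by
  have hd : ∀ x ∈ uIcc a b, HasDerivWithinAt (fun x : ℝ => Complex.exp (z * x))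
      (Complex.exp (z * x) * z) (uIcc a b) x := by
    intro x _
    have h1 : HasDerivAt (fun x : ℝ => z * (x:ℂ)) z x := by
      simpa using (Complex.ofRealCLM.hasDerivAt (x := x)).const_mul z
    exact h1.cexp.hasDerivWithinAt
  have hb' : ∀ x ∈ uIcc a b, ‖Complex.exp (z * x) * z‖ ≤ ‖z‖ * Q := by
    intro x hx
    rw [norm_mul, mul_comm]
    refine mul_le_mul_of_nonneg_left ?_ (norm_nonneg _)
    rw [Complex.norm_exp]
    have : (z * x).re = z.re * x := by simp
    rw [this]
    rcases le_total 0 z.re with hz | hz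
    · rcases le_total a b with h | h
      · rw [uIcc_of_le h] at hx
        exact (exp_le_exp.2 (mul_le_mul_of_nonneg_left hx.2 hz)).trans hb
      · rw [uIcc_of_ge h] at hx
        exact (exp_le_exp.2 (mul_le_mul_of_nonneg_left hx.2 hz)).trans ha
    · rcases le_total a b with h | h
      · rw [uIcc_of_le h] at hx
        exact (exp_le_exp.2 (mul_le_mul_of_nonpos_left hx.1 hz)).trans ha
      · rw [uIcc_of_ge h] at hx
        exact (exp_le_exp.2 (mul_le_mul_of_nonpos_left hx.1 hz)).trans hb
  exact (convex_uIcc a b).norm_image_sub_le_of_norm_hasDerivWithin_le hd hb'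
    right_mem_uIcc left_mem_uIcc

lemma LL.cpow {f : ℝ → ℝ} (hh : 0 ≤ h) (hL : 0 ≤ L) (hf : LL h L f) (z : ℂ) {Q : ℝ}
    (hQ : ∀ s ∈ Icc 0 h, f s ^ z.re ≤ Q) :
    BL h ((1 + ‖z‖ * L) * Q) (fun s => (f s : ℂ) ^ z) := by
  have hQ0 : 0 ≤ Q := (rpow_nonneg (hf.1 0 ⟨le_rfl, hh⟩).le _).trans (hQ 0 ⟨le_rfl, hh⟩)
  have hexp : ∀ s ∈ Icc 0 h, (f s : ℂ) ^ z = Complex.exp (z * (log (f s) : ℝ)) := by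
    intro s hs
    rw [Complex.cpow_def_of_ne_zero (by exact_mod_cast (hf.1 s hs).ne'), Complex.ofReal_log
      (hf.1 s hs).le, mul_comm]
  have hexp' : ∀ s ∈ Icc 0 h, exp (z.re * log (f s)) ≤ Q := by
    intro s hs
    rw [mul_comm, ← rpow_def_of_pos (hf.1 s hs)]; exact hQ s hs
  refine ⟨fun s hs => ?_, fun s hs s' hs' => ?_⟩
  · rw [Complex.norm_cpow_eq_rpow_re_of_pos (hf.1 s hs)]
    refine (hQ s hs).trans ?_
    have : 0 ≤ ‖z‖ * L * Q := by positivity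
    linarith
  · dsimp only; rw [hexp s hs, hexp s' hs']
    refine (cexp_lip z _ _ Q (hexp' s hs) (hexp' s' hs')).trans ?_
    have h1 := mul_le_mul_of_nonneg_left (hf.log_lip hs hs') (mul_nonneg (norm_nonneg z) hQ0)
    have : 0 ≤ Q * |s - s'| := by positivity
    linarith

end

end

section

variable {v t : Fin n → ℝ} {h M : ℝ} {c : (Fin n → ℕ) → ℝ}

lemma ln_zero (v t : Fin n → ℝ) : ln v t 0 = t := by funext i; simp [ln]

lemma ln_ne (hv : ∀ i, 0 ≤ v i) (ht : ∀ i, t i ≠ 0) {s : ℝ} (hs : 0 ≤ s) (i : Fin n) :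
    ln v t s i ≠ 0 := by
  unfold ln
  have := mul_nonneg hs (hv i)
  exact mul_ne_zero (ht i) (by positivity)

lemma abs_ln (hv : ∀ i, 0 ≤ v i) {s : ℝ} (hs : 0 ≤ s) (i : Fin n) :
    |ln v t s i| = |t i| * (1 + s * v i) := by
  unfold ln
  have := mul_nonneg hs (hv i)
  rw [abs_mul, abs_of_pos (by positivity : 0 < 1 + s * v i)]

lemma le_abs_ln (hv : ∀ i, 0 ≤ v i) {s : ℝ} (hs : 0 ≤ s) (i : Fin n) :
    |t i| ≤ |ln v t s i| := by
  rw [abs_ln hv hs]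
  have := mul_nonneg hs (hv i)
  nlinarith [abs_nonneg (t i)]

lemma abs_ln_le (hv : ∀ i, 0 ≤ v i) (hvM : ∀ i, v i ≤ M) (hhM : h * M ≤ 1) {s : ℝ}
    (hs : s ∈ Icc 0 h) (i : Fin n) : |ln v t s i| ≤ 2 * |t i| := by
  rw [abs_ln hv hs.1]
  have h1 : s * v i ≤ h * M := mul_le_mul hs.2 (hvM i) (hv i) (hs.1.trans hs.2)
  nlinarith [abs_nonneg (t i)]

lemma Jac_BL (hh : 0 ≤ h) (hv : ∀ i, 0 ≤ v i) (hvM : ∀ i, v i ≤ M) (hM : 0 ≤ M) (hhM : h * M ≤ 1) :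
    BL h ((2 * (2 + M)) ^ n) (Jac v) := by
  have := BL.prod (𝕜 := ℝ) hh (Finset.univ : Finset (Fin n)) (f := fun i s => 1 + s * v i)
    (A := 2 + M) (fun i _ => ?_)
  · rw [Finset.card_univ, Fintype.card_fin] at this
    exact this
  · refine ⟨fun s hs => ?_, fun s hs s' hs' => ?_⟩
    · have h1 : s * v i ≤ h * M := mul_le_mul hs.2 (hvM i) (hv i) hh
      have h2 := mul_nonneg hs.1 (hv i)
      rw [Real.norm_of_nonneg (by positivity)]; linarith
    · have e : 1 + s * v i - (1 + s' * v i) = v i * (s - s') := by ring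
      rw [e, norm_mul, Real.norm_of_nonneg (hv i), Real.norm_eq_abs]
      exact mul_le_mul_of_nonneg_right (by linarith [hvM i]) (abs_nonneg _)

lemma abs_LL (hv : ∀ i, 0 ≤ v i) (hvM : ∀ i, v i ≤ M) (ht : ∀ i, t i ≠ 0) (i : Fin n) :
    LL h M (fun s => |ln v t s i|) := by
  have h1 := ((LL.lin (h := h) (hv i)).const_mul (abs_pos.2 (ht i))).mono (hvM i)
  refine ⟨fun s hs => abs_pos.2 (ln_ne hv ht hs.1 i), fun s hs s' hs' => ?_⟩
  simpa only [abs_ln hv hs.1, abs_ln hv hs'.1] using h1.2 s hs s' hs'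

/-- total degree of vertices -/
def DD (c : (Fin n → ℕ) → ℝ) : ℝ := ∑ α ∈ VE c, (dg α : ℝ)

lemma DD_nonneg (c : (Fin n → ℕ) → ℝ) : 0 ≤ DD c := Finset.sum_nonneg fun _ _ => Nat.cast_nonneg _

lemma star_LL (hc : c ≠ 0) (hM : 0 ≤ M) (hv : ∀ i, 0 ≤ v i) (hvM : ∀ i, v i ≤ M)
    (ht : ∀ i, t i ≠ 0) : LL h (DD c * M) (fun s => starFn c (ln v t s)) := by
  have key := LL.sum (h := h) (L := DD c * M) (VE_nonempty hc) (f := fun α s => amon α (ln v t s))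
    (fun α hα => ?_)
  · simpa only [starFn_eq] using key
  · have h1 := LL.prod (h := h) (Finset.univ : Finset (Fin n)) (l := fun i => (α i : ℝ) * M)
      (f := fun i s => |ln v t s i| ^ α i) (fun i _ => (abs_LL hv hvM ht i).pow (α i))
    refine LL.mono (L := ∑ i, (α i : ℝ) * M) ?_ ?_
    · exact h1
    · rw [← Finset.sum_mul]
      refine mul_le_mul_of_nonneg_right ?_ hM
      have : ((dg α : ℕ) : ℝ) = ∑ i, (α i : ℝ) := by unfold dg; push_cast; rfl
      rw [← this]
      exact Finset.single_le_sum (f := fun α : Fin n → ℕ => (dg α : ℝ))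
        (fun _ _ => Nat.cast_nonneg _) hα

lemma min_LL (hn : 0 < n) (hc : c ≠ 0) (hM : 0 ≤ M) (hv : ∀ i, 0 ≤ v i) (hvM : ∀ i, v i ≤ M)
    (ht : ∀ i, t i ≠ 0) : LL h ((DD c + 1) * M) (fun s => minFactor c (ln v t s)) := by
  haveI : Nonempty (Fin n) := ⟨⟨0, hn⟩⟩
  have hD := DD_nonneg c
  have h1 : LL h ((DD c + 1) * M) (fun s => ⨅ i, |ln v t s i|) :=
    LL.ciInf fun i => (abs_LL hv hvM ht i).mono (by nlinarith)
  have h2 : LL h ((DD c + 1) * M) (fun s => starFn c (ln v t s)) :=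
    (star_LL hc hM hv hvM ht).mono (by nlinarith)
  exact h1.min h2

lemma star_mono (hv : ∀ i, 0 ≤ v i) {s : ℝ} (hs : 0 ≤ s) :
    starFn c t ≤ starFn c (ln v t s) := by
  rw [starFn_eq, starFn_eq]
  refine Finset.sum_le_sum fun α _ => ?_
  unfold amon
  exact Finset.prod_le_prod (fun i _ => by positivity)
    fun i _ => pow_le_pow_left₀ (abs_nonneg _) (le_abs_ln hv hs i) _

lemma minFactor_pos (hn : 0 < n) (hc : c ≠ 0) (ht : ∀ i, t i ≠ 0) : 0 < minFactor c t := by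
  haveI : Nonempty (Fin n) := ⟨⟨0, hn⟩⟩
  refine lt_min ?_ (star_pos hc ht)
  obtain ⟨i, hi⟩ := exists_eq_ciInf_of_finite (f := fun i => |t i|)
  rw [← hi]; exact abs_pos.2 (ht i)

lemma minFactor_le_abs (i : Fin n) : minFactor c t ≤ |t i| :=
  (min_le_left _ _).trans (ciInf_le (Set.finite_range _).bddBelow i)

lemma minFactor_le_star : minFactor c t ≤ starFn c t := min_le_right _ _

/-- constant for the power of the min factor -/
def CM (c : (Fin n → ℕ) → ℝ) (M s₁ : ℝ) : ℝ :=
  (1 + (DD c + 1) * M) * exp ((DD c + 1) * M) ^ s₁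

lemma min_cpow_BL (hn : 0 < n) (hc : c ≠ 0) (hM : 0 ≤ M) (hh : 0 ≤ h) (hh1 : h ≤ 1)
    (hv : ∀ i, 0 ≤ v i) (hvM : ∀ i, v i ≤ M) (ht : ∀ i, t i ≠ 0) {z : ℂ} {s₁ : ℝ}
    (hz : z.re = s₁) (hs₁ : 0 ≤ s₁) :
    BL h ((1 + ‖z‖) * CM c M s₁ * minFactor c t ^ s₁)
      (fun s => (minFactor c (ln v t s) : ℂ) ^ z) := by
  have hLL := min_LL (h := h) hn hc hM hv hvM ht
  have hD := DD_nonneg c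
  set L := (DD c + 1) * M with hL
  have hL0 : 0 ≤ L := by positivity
  have hm := minFactor_pos hn hc ht
  refine (hLL.cpow hh hL0 z (Q := exp L ^ s₁ * minFactor c t ^ s₁) fun s hs => ?_).mono ?_
  · rw [hz, ← mul_rpow (exp_pos _).le hm.le]
    refine rpow_le_rpow (hLL.1 s hs).le ?_ hs₁
    have := hLL.2 s hs 0 ⟨le_rfl, hh⟩
    dsimp only at this
    rw [ln_zero, sub_zero, abs_of_nonneg hs.1] at this
    refine this.trans ?_
    rw [mul_comm]
    refine mul_le_mul_of_nonneg_right (exp_le_exp.2 ?_) hm.le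
    nlinarith [hs.2]
  · have h1 : 0 ≤ exp L ^ s₁ * minFactor c t ^ s₁ := by positivity
    have h2 : 1 + ‖z‖ * L ≤ (1 + ‖z‖) * (1 + L) := by nlinarith [norm_nonneg z]
    unfold CM
    calc _ ≤ (1 + ‖z‖) * (1 + L) * (exp L ^ s₁ * minFactor c t ^ s₁) :=
          mul_le_mul_of_nonneg_right h2 h1
      _ = _ := by ring

/-! kernel -/
variable {grp : Fin n → Fin m} {a : Fin m → ℝ} {K : (Fin n → ℝ) → ℝ}

lemma grpNorm_pos (hgrp : Function.Surjective grp) (ht : ∀ i, t i ≠ 0) (k : Fin m) :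
    0 < grpNorm grp k t := by
  obtain ⟨i, hi⟩ := hgrp k
  refine Real.sqrt_pos.2 ?_
  refine Finset.sum_pos (fun j _ => by have := ht j; positivity) ⟨i, by simp [hi]⟩

lemma kernelWeight_nonneg (t : Fin n → ℝ) : 0 ≤ kernelWeight grp a t :=
  Finset.prod_nonneg fun k _ => rpow_nonneg (Real.sqrt_nonneg _) _

lemma kernelWeight_pos (hgrp : Function.Surjective grp) (ht : ∀ i, t i ≠ 0) :
    0 < kernelWeight grp a t :=
  Finset.prod_pos fun k _ => rpow_pos_of_pos (grpNorm_pos hgrp ht k) _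

lemma kernelWeight_anti (hgrp : Function.Surjective grp) (ha : ∀ k, 0 ≤ a k) {t t' : Fin n → ℝ}
    (ht : ∀ i, t i ≠ 0) (htt : ∀ i, |t i| ≤ |t' i|) :
    kernelWeight grp a t' ≤ kernelWeight grp a t := by
  refine Finset.prod_le_prod (fun k _ => rpow_nonneg (Real.sqrt_nonneg _) _) fun k _ => ?_
  refine rpow_le_rpow_of_nonpos (grpNorm_pos hgrp ht k) ?_ (by linarith [ha k])
  refine Real.sqrt_le_sqrt (Finset.sum_le_sum fun i _ => ?_)
  exact sq_le_sq.2 (htt i)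

lemma isOpen_U : IsOpen {t : Fin n → ℝ | ∀ i, t i ≠ 0} := by
  rw [Set.setOf_forall]
  exact isOpen_iInter_of_finite fun i => isOpen_ne_fun (continuous_apply i) continuous_const

lemma K_BL (hgrp : Function.Surjective grp) (ha : ∀ k, 0 ≤ a k)
    (hK : ContDiffOn ℝ 1 K {t | ∀ i, t i ≠ 0}) {C : ℝ} (hC0 : 0 ≤ C)
    (hC : ∀ t : Fin n → ℝ, (∀ i, t i ≠ 0) → |K t| ≤ C * kernelWeight grp a t ∧
      ∀ i : Fin n, |fderiv ℝ K t (Pi.single i 1)| ≤ C / |t i| * kernelWeight grp a t)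
    (hM : 0 ≤ M) (hv : ∀ i, 0 ≤ v i) (hvM : ∀ i, v i ≤ M) (ht : ∀ i, t i ≠ 0) :
    BL h ((1 + n * M) * C * kernelWeight grp a t) (fun s => K (ln v t s)) := by
  have hw := kernelWeight_pos (a := a) hgrp ht
  have hmono : ∀ s ∈ Icc 0 h, kernelWeight grp a (ln v t s) ≤ kernelWeight grp a t :=
    fun s hs => kernelWeight_anti hgrp ha ht (fun i => le_abs_ln hv hs.1 i)
  have hCw : 0 ≤ C * kernelWeight grp a t := by positivity
  refine BL.of_deriv (f' := fun s => fderiv ℝ K (ln v t s) (fun i => t i * v i))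
    (fun s hs => ?_) (fun s hs => ?_) (fun s hs => ?_)
  · refine ((hC _ (ln_ne hv ht hs.1)).1).trans ?_
    have := mul_le_mul_of_nonneg_left (hmono s hs) hC0
    have : 0 ≤ n * M * (C * kernelWeight grp a t) := by positivity
    linarith
  · have hd : DifferentiableAt ℝ K (ln v t s) :=
      ((hK.differentiableOn (by norm_num)) _ (ln_ne hv ht hs.1)).differentiableAt
        (isOpen_U.mem_nhds (ln_ne hv ht hs.1))
    refine hd.hasFDerivAt.comp_hasDerivAt s ?_
    rw [hasDerivAt_pi]
    intro i
    unfold ln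
    have := (((hasDerivAt_id s).mul_const (v i)).const_add 1).const_mul (t i)
    simpa using this
  · have e : (fun i => t i * v i) = ∑ i, (t i * v i) • (Pi.single i (1:ℝ) : Fin n → ℝ) := by
      funext j; simp [Finset.sum_apply, Pi.single_apply]
    rw [e, map_sum]
    refine (Finset.abs_sum_le_sum_abs _ _).trans ?_
    have hb : ∀ i ∈ (Finset.univ : Finset (Fin n)),
        |fderiv ℝ K (ln v t s) ((t i * v i) • (Pi.single i (1:ℝ) : Fin n → ℝ))| ≤
          M * (C * kernelWeight grp a t) := by
      intro i _
      rw [map_smul, smul_eq_mul, abs_mul, abs_mul, abs_of_nonneg (hv i)]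
      have h1 := (hC _ (ln_ne hv ht hs.1)).2 i
      have hp : 0 < |t i| := abs_pos.2 (ht i)
      have h2 : C / |ln v t s i| * kernelWeight grp a (ln v t s) ≤
          C / |t i| * kernelWeight grp a t :=
        mul_le_mul (div_le_div_of_nonneg_left hC0 hp (le_abs_ln hv hs.1 i)) (hmono s hs)
          (kernelWeight_nonneg _) (by positivity)
      calc _ ≤ |t i| * v i * (C / |t i| * kernelWeight grp a t) :=
            mul_le_mul_of_nonneg_left (h1.trans h2) (mul_nonneg hp.le (hv i))
        _ = v i * (C * kernelWeight grp a t) := by field_simp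
        _ ≤ _ := mul_le_mul_of_nonneg_right (hvM i) hCw
    refine (Finset.sum_le_sum hb).trans ?_
    rw [Finset.sum_const, Finset.card_univ, Fintype.card_fin, nsmul_eq_mul]
    linarith

end

section

/-- the phase -/
def ph (S : (Fin n → ℝ) → ℝ) (lam : Fin (n+1) → ℝ) (t : Fin n → ℝ) : ℝ :=
  (∑ i, lam i.castSucc * t i) + lam (Fin.last n) * S t

/-- phase along a line and its derivatives -/
def Phi (c : (Fin n → ℕ) → ℝ) (lam : Fin (n+1) → ℝ) (v t : Fin n → ℝ) : ℕ → ℝ → ℝ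
  | 0 => fun s => (∑ i, lam i.castSucc * (t i * (1 + s * v i))) + lam (Fin.last n) * ser c v t 0 s
  | 1 => fun s => (∑ i, lam i.castSucc * (t i * v i)) + lam (Fin.last n) * ser c v t 1 s
  | j + 2 => fun s => lam (Fin.last n) * ser c v t (j + 2) s

variable {S : (Fin n → ℝ) → ℝ} {c : (Fin n → ℕ) → ℝ} {r0 ρ h : ℝ} {u : (Fin n → ℕ) → ℝ}
  {v t : Fin n → ℝ} {lam : Fin (n+1) → ℝ}

lemma Phi_hasDerivAt (hS : SD S c r0 u) (hv : ∀ i, 0 ≤ v i) (hρ : 0 < ρ)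
    (hvρ : ∀ i, 2 * ρ * v i ≤ 1) (ht : ∀ i, t i ≠ 0) (htr : ∀ i, |t i| < r0)
    (lam : Fin (n+1) → ℝ) (j : ℕ) {s : ℝ} (hs : |s| < ρ) :
    HasDerivAt (Phi c lam v t j) (Phi c lam v t (j+1) s) s := by
  have hd := fun j => (ser_hasDerivAt hS zero_le_one (Adm_self c) hv hρ hvρ ht htr j hs).const_mul
    (lam (Fin.last n))
  match j with
  | 0 =>
    refine HasDerivAt.add ?_ (hd 0)
    refine HasDerivAt.fun_sum fun i _ => ?_
    have := ((((hasDerivAt_id s).mul_const (v i)).const_add 1).const_mul (t i)).const_mul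
      (lam i.castSucc)
    simpa using this
  | 1 =>
    have := (hd 1).const_add (∑ i, lam i.castSucc * (t i * v i))
    exact this
  | j + 2 => exact hd (j + 2)

lemma Phi_zero (hS : SD S c r0 u) (hv : ∀ i, 0 ≤ v i)
    (hvρ : ∀ i, 2 * ρ * v i ≤ 1) (htr : ∀ i, |t i| < r0)
    (lam : Fin (n+1) → ℝ) {s : ℝ} (hs : |s| ≤ ρ) :
    Phi c lam v t 0 s = ph S lam (ln v t s) := by
  unfold ph
  rw [← ser_zero hS hv hvρ htr hs]
  rfl

lemma innerB (hS : SD S c r0 u) (hv : ∀ i, 0 ≤ v i) (hρ : 0 < ρ)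
    (hvρ : ∀ i, 2 * ρ * v i ≤ 1) (ht : ∀ i, t i ≠ 0) (htr : ∀ i, |t i| < r0)
    (hhρ : h < ρ) (hh1 : h ≤ 1) {k : ℕ} (hk : 2 ≤ k) {M : ℝ} (hkM : k ≤ M) {c1 : ℝ}
    (hc1 : 0 < c1) (hlam : lam (Fin.last n) ≠ 0)
    (hl : (∀ s ∈ Icc 0 h, c1 * starFn c t ≤ ser c v t k s) ∨
      (∀ s ∈ Icc 0 h, ser c v t k s ≤ -(c1 * starFn c t))) {x : ℝ} (hx : x ∈ Icc 0 h) :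
    ‖∫ s in (0:ℝ)..x, osc (ph S lam (ln v t s))‖ ≤
      (1 + vdcC k) * (|lam (Fin.last n)| * (c1 * starFn c t)) ^ (-(1 / M)) := by
  have hst := star_pos hS.hc ht
  set L := lam (Fin.last n) with hL
  set Λ := |L| * (c1 * starFn c t) with hΛ
  have hΛ0 : 0 < Λ := by have := abs_pos.2 hlam; positivity
  have hk0 : (0:ℝ) < k := by exact_mod_cast (by omega : 0 < k)
  have hsub : ∀ s ∈ Icc 0 x, s ∈ Icc 0 h := fun s hs => ⟨hs.1, hs.2.trans hx.2⟩
  have habs : ∀ s ∈ Icc 0 h, |s| < ρ := fun s hs => by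
    rw [abs_of_nonneg hs.1]; exact hs.2.trans_lt hhρ
  have e : ∫ s in (0:ℝ)..x, osc (ph S lam (ln v t s)) = ∫ s in (0:ℝ)..x, osc (Phi c lam v t 0 s) := by
    refine intervalIntegral.integral_congr fun s hs => ?_
    rw [uIcc_of_le hx.1] at hs
    rw [Phi_zero hS hv hvρ htr lam (habs s (hsub s hs)).le]
  rw [e]
  have hpos : 0 ≤ Λ ^ (-(1 / M)) := by positivity
  have hvk := vdcC_nonneg k
  rcases le_or_gt 1 Λ with h1 | h1
  · have key : ‖∫ s in (0:ℝ)..x, osc (Phi c lam v t 0 s)‖ ≤ vdcC k * Λ ^ (-(1 / (k:ℝ))) := by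
      refine vdc hk hx.1 hΛ0 (fun j s hs => Phi_hasDerivAt hS hv hρ hvρ ht htr lam j
        (habs s (hsub s hs))) ?_
      obtain ⟨k', rfl⟩ : ∃ k', k = k' + 2 := ⟨k - 2, by omega⟩
      have hPhi : ∀ s, Phi c lam v t (k' + 2) s = L * ser c v t (k' + 2) s := fun s => rfl
      simp only [hPhi]
      rcases lt_or_gt_of_ne hlam with hneg | hpos
      · have ea : |L| = -L := abs_of_neg hneg
        rcases hl with hl | hl
        · right; intro s hs
          have := mul_le_mul_of_nonpos_left (hl s (hsub s hs)) hneg.le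
          rw [hΛ, ea]; linarith
        · left; intro s hs
          have := mul_le_mul_of_nonpos_left (hl s (hsub s hs)) hneg.le
          rw [hΛ, ea]; linarith
      · have ea : |L| = L := abs_of_pos hpos
        rcases hl with hl | hl
        · left; intro s hs
          have := mul_le_mul_of_nonneg_left (hl s (hsub s hs)) hpos.le
          rw [hΛ, ea]; linarith
        · right; intro s hs
          have := mul_le_mul_of_nonneg_left (hl s (hsub s hs)) hpos.le
          rw [hΛ, ea]; linarith
    refine key.trans ?_
    have h2 : Λ ^ (-(1 / (k:ℝ))) ≤ Λ ^ (-(1 / M)) := by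
      refine rpow_le_rpow_of_exponent_le h1 ?_
      exact neg_le_neg (one_div_le_one_div_of_le hk0 hkM)
    have := mul_le_mul_of_nonneg_left h2 hvk
    linarith
  · have h2 : 1 ≤ Λ ^ (-(1 / M)) := one_le_rpow_of_pos_of_le_one_of_nonpos hΛ0 h1.le (by
      have : 0 ≤ 1 / M := by have := hk0.le.trans hkM; positivity
      linarith)
    have h3 := norm_integral_osc_le (Phi c lam v t 0) hx.1
    have : 0 ≤ vdcC k * Λ ^ (-(1 / M)) := mul_nonneg hvk hpos
    linarith [hx.2]

/-- series derivative bound in a coordinate direction -/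
lemma ser_coord (hS : SD S c r0 u) (i : Fin n) (htr : ∀ i, |t i| < r0)
    (j : ℕ) (hj : 1 ≤ j) {s : ℝ} (hs : |s| ≤ 1/4) :
    |ser c (rc (Pi.single i 1)) t j s| ≤
      (j.factorial / (1/4) ^ j) * (∑' α, |c α| * 4 ^ dg α * r0 ^ dg α) / r0 * |t i| := by
  have hr := hS.pos
  set v : Fin n → ℝ := rc (Pi.single i 1) with hvdef
  have hv : ∀ i, 0 ≤ v i := fun i => by simp [hvdef, rc]
  have hv1 : ∀ k, v k ≤ 1 := fun k => by
    by_cases hk : k = i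
    · subst hk; simp [hvdef, rc]
    · simp [hvdef, rc, hk]
  have hvρ : ∀ k, 2 * (1/4) * v k ≤ 1 := fun k => by linarith [hv1 k]
  set J : ℝ := (j.factorial / (1/4) ^ j) with hJ
  have hJ0 : 0 ≤ J := by positivity
  have hterm : ∀ α, ‖c α * monomial α t * (Polynomial.derivative^[j] (LP v α)).eval s‖ ≤
      J / r0 * |t i| * (|c α| * 4 ^ dg α * r0 ^ dg α) := by
    intro α
    have hR : 0 ≤ J / r0 * |t i| * (|c α| * 4 ^ dg α * r0 ^ dg α) := by positivity
    by_cases hα : α i = 0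
    · have : LP v α = 1 := by
        unfold LP
        refine Finset.prod_eq_one fun k _ => ?_
        by_cases hk : k = i
        · subst hk; rw [hα, pow_zero]
        · simp [hvdef, rc, hk]
      rw [this, Polynomial.iterate_derivative_one]
      · simpa using hR
      · omega
    · have h1 := LP_deriv_bound hv α (by norm_num : (0:ℝ) < 1/4) hvρ hs j
      have h2 : amon α t ≤ |t i| / r0 * r0 ^ dg α := by
        unfold amon
        rw [← Finset.mul_prod_erase _ _ (Finset.mem_univ i)]
        have e : r0 ^ dg α = r0 ^ α i * ∏ k ∈ Finset.univ.erase i, r0 ^ α k := by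
          rw [Finset.mul_prod_erase _ (fun k => r0 ^ α k) (Finset.mem_univ i)]
          unfold dg; rw [Finset.prod_pow_eq_pow_sum]
        rw [e, ← mul_assoc]
        refine mul_le_mul ?_ (Finset.prod_le_prod (fun k _ => by positivity)
          fun k _ => pow_le_pow_left₀ (abs_nonneg _) (htr k).le _)
          (Finset.prod_nonneg fun k _ => by positivity) (by positivity)
        obtain ⟨q, hq⟩ : ∃ q, α i = q + 1 := ⟨α i - 1, by omega⟩
        rw [hq, pow_succ, pow_succ]
        have e2 : |t i| / r0 * (r0 ^ q * r0) = r0 ^ q * |t i| := by field_simp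
        rw [e2]
        exact mul_le_mul_of_nonneg_right (pow_le_pow_left₀ (abs_nonneg _) (htr i).le _)
          (abs_nonneg _)
      rw [Real.norm_eq_abs, abs_mul, abs_mul, abs_monomial]
      have h3 : (2:ℝ) ^ dg α ≤ 4 ^ dg α := pow_le_pow_left₀ (by norm_num) (by norm_num) _
      calc |c α| * amon α t * |(Polynomial.derivative^[j] (LP v α)).eval s|
          ≤ |c α| * (|t i| / r0 * r0 ^ dg α) * (J * 4 ^ dg α) := by
            refine mul_le_mul (mul_le_mul_of_nonneg_left h2 (abs_nonneg _))
              (h1.trans (mul_le_mul_of_nonneg_left h3 hJ0)) (abs_nonneg _) (by positivity)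
        _ = _ := by ring
  have := tsum_of_norm_bounded ((hS.summ'.mul_left (J / r0 * |t i|)).hasSum) hterm
  rw [tsum_mul_left] at this
  calc _ ≤ _ := this
    _ = _ := by ring

lemma innerA (hS : SD S c r0 u) (i : Fin n) (ht : ∀ i, t i ≠ 0) (htr : ∀ i, |t i| < r0)
    {Cs : ℝ} (hCs : 1 ≤ Cs) (h1 : ∀ s, |s| ≤ 1/4 → |ser c (rc (Pi.single i 1)) t 1 s| ≤ Cs * |t i|)
    (h2 : ∀ s, |s| ≤ 1/4 → |ser c (rc (Pi.single i 1)) t 2 s| ≤ Cs * |t i|)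
    (hlam : 2 * Cs * |lam (Fin.last n)| ≤ |lam i.castSucc|) (hlam0 : lam i.castSucc ≠ 0)
    (hhρ : h < 1/4) {β : ℝ} (hβ0 : 0 ≤ β) (hβ1 : β ≤ 1) {x : ℝ} (hx : x ∈ Icc 0 h) :
    ‖∫ s in (0:ℝ)..x, osc (ph S lam (ln (rc (Pi.single i 1)) t s))‖ ≤
      7 * (|lam i.castSucc| * |t i|) ^ (-β) := by
  set v : Fin n → ℝ := rc (Pi.single i 1) with hvdef
  have hv : ∀ i, 0 ≤ v i := fun i => by simp [hvdef, rc]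
  have hv1 : ∀ k, v k ≤ 1 := fun k => by
    by_cases hk : k = i
    · subst hk; simp [hvdef, rc]
    · simp [hvdef, rc, hk]
  have hvρ : ∀ k, 2 * (1/4) * v k ≤ 1 := fun k => by linarith [hv1 k]
  set L := lam (Fin.last n) with hL
  set Λ := |lam i.castSucc| * |t i| with hΛ
  have hti := abs_pos.2 (ht i)
  have hΛ0 : 0 < Λ := by have := abs_pos.2 hlam0; positivity
  have habs : ∀ s ∈ Icc 0 x, |s| < 1/4 := fun s hs => by
    rw [abs_of_nonneg hs.1]; exact (hs.2.trans hx.2).trans_lt hhρ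
  have e : ∫ s in (0:ℝ)..x, osc (ph S lam (ln v t s)) = ∫ s in (0:ℝ)..x, osc (Phi c lam v t 0 s) := by
    refine intervalIntegral.integral_congr fun s hs => ?_
    rw [uIcc_of_le hx.1] at hs
    rw [Phi_zero hS hv hvρ htr lam (habs s hs).le]
  rw [e]
  have hsum : ∑ k, lam k.castSucc * (t k * v k) = lam i.castSucc * t i := by
    rw [Finset.sum_eq_single i]
    · simp [hvdef, rc]
    · intro k _ hk; simp [hvdef, rc, hk]
    · simp
  have hpos : 0 ≤ Λ ^ (-β) := by positivity
  rcases le_or_gt 1 Λ with hΛ1 | hΛ1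
  · have hLb : |L| * (Cs * |t i|) ≤ Λ / 2 := by
      rw [hΛ]; nlinarith
    have hP1 : ∀ s ∈ Icc 0 x, Λ / 2 ≤ |Phi c lam v t 1 s| := by
      intro s hs
      have e1 : Phi c lam v t 1 s = lam i.castSucc * t i + L * ser c v t 1 s := by
        rw [← hsum]; rfl
      have h3 : |L * ser c v t 1 s| ≤ Λ / 2 := by
        rw [abs_mul]
        exact (mul_le_mul_of_nonneg_left (h1 s (habs s hs).le) (abs_nonneg _)).trans hLb
      have h4 : |lam i.castSucc * t i| = Λ := by rw [abs_mul]
      have h5 := abs_sub_abs_le_abs_add (lam i.castSucc * t i) (L * ser c v t 1 s)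
      rw [e1]; linarith
    have hP2 : ∀ s ∈ Icc 0 x, |Phi c lam v t 2 s| ≤ Λ / 2 := by
      intro s hs
      have e1 : Phi c lam v t 2 s = L * ser c v t 2 s := rfl
      rw [e1, abs_mul]
      exact (mul_le_mul_of_nonneg_left (h2 s (habs s hs).le) (abs_nonneg _)).trans hLb
    have hc2 : ContinuousOn (Phi c lam v t 2) (Icc 0 x) := fun s hs =>
      (Phi_hasDerivAt hS hv (by norm_num) hvρ ht htr lam 2
        (habs s hs)).continuousAt.continuousWithinAt
    have hc1 : ContinuousOn (Phi c lam v t 1) (Icc 0 x) := fun s hs =>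
      (Phi_hasDerivAt hS hv (by norm_num) hvρ ht htr lam 1
        (habs s hs)).continuousAt.continuousWithinAt
    have key := vdc_one (φ := Phi c lam v t 0) (φ1 := Phi c lam v t 1) (φ2 := Phi c lam v t 2)
      (a := 0) (b := x) (Λ := Λ / 2) hx.1 (by positivity)
      (fun s hs => Phi_hasDerivAt hS hv (by norm_num) hvρ ht htr lam 0 (habs s hs))
      (fun s hs => Phi_hasDerivAt hS hv (by norm_num) hvρ ht htr lam 1 (habs s hs)) hc2 hP1
    have hintg : ∫ s in (0:ℝ)..x, |Phi c lam v t 2 s| / Phi c lam v t 1 s ^ 2 ≤ 1 / (Λ / 2) := by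
      have hb : ∀ s ∈ uIoc (0:ℝ) x, ‖|Phi c lam v t 2 s| / Phi c lam v t 1 s ^ 2‖ ≤ 1 / (Λ / 2) := by
        intro s hs
        rw [uIoc_of_le hx.1] at hs
        have hs' : s ∈ Icc 0 x := ⟨hs.1.le, hs.2⟩
        have h3 := hP1 s hs'
        have h4 := hP2 s hs'
        rw [Real.norm_of_nonneg (by positivity), ← sq_abs (Phi c lam v t 1 s)]
        have h6 : (Λ/2)^2 ≤ |Phi c lam v t 1 s| ^ 2 := pow_le_pow_left₀ (by positivity) h3 2
        calc _ ≤ (Λ/2) / (Λ/2)^2 := div_le_div₀ (by positivity) h4 (by positivity) h6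
          _ = _ := by field_simp
      have := intervalIntegral.norm_integral_le_of_norm_le_const hb
      rw [sub_zero, abs_of_nonneg hx.1] at this
      refine (le_abs_self _).trans (this.trans ?_)
      have h6 : 0 ≤ 1 / (Λ/2) := by positivity
      nlinarith [hx.2]
    have h7 : Λ⁻¹ ≤ Λ ^ (-β) := by
      rw [← rpow_neg_one]
      exact rpow_le_rpow_of_exponent_le hΛ1 (by linarith)
    have e8 : 2 / (Λ/2) = 4 * Λ⁻¹ := by field_simp; norm_num
    have e9 : 1 / (Λ/2) = 2 * Λ⁻¹ := by field_simp
    rw [e8] at key; rw [e9] at hintg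
    linarith
  · have h2 : 1 ≤ Λ ^ (-β) := one_le_rpow_of_pos_of_le_one_of_nonpos hΛ0 hΛ1.le (by linarith)
    have h3 := norm_integral_osc_le (Phi c lam v t 0) hx.1
    linarith [hx.2]

end

section

/-- normalized derivative -/
def qf (c : (Fin n → ℕ) → ℝ) (p : (Fin n → ℕ) × ℕ) (t : Fin n → ℝ) : ℝ :=
  GG c (rc p.1) p.2 t * (starFn c t)⁻¹

/-- cutoff -/
def eta (c : (Fin n → ℕ) → ℝ) (c0 : ℝ) (p : (Fin n → ℕ) × ℕ) (t : Fin n → ℝ) : ℝ :=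
  max 0 (|qf c p t| - c0 / 2)

/-- index set -/
def PP (n M : ℕ) : Finset ((Fin n → ℕ) × ℕ) :=
  (Fintype.piFinset fun _ => Finset.range (M + 1)) ×ˢ Finset.Icc 2 M

lemma mem_PP {M : ℕ} {p : (Fin n → ℕ) × ℕ} :
    p ∈ PP n M ↔ (∀ i, p.1 i ≤ M) ∧ 2 ≤ p.2 ∧ p.2 ≤ M := by
  simp [PP, Nat.lt_succ_iff]

/-- partition of unity -/
def chi (c : (Fin n → ℕ) → ℝ) (c0 : ℝ) (M : ℕ) (p : (Fin n → ℕ) × ℕ) (t : Fin n → ℝ) : ℝ :=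
  eta c c0 p t * (∑ p' ∈ PP n M, eta c c0 p' t)⁻¹

variable {S : (Fin n → ℝ) → ℝ} {c : (Fin n → ℕ) → ℝ} {r0 r ρ h c0 : ℝ} {u : (Fin n → ℕ) → ℝ}
  {v t w : Fin n → ℝ} {lam : Fin (n+1) → ℝ} {M : ℕ}

lemma eta_nonneg (p : (Fin n → ℕ) × ℕ) (t : Fin n → ℝ) : 0 ≤ eta c c0 p t := le_max_left _ _

/-- lower bound hypothesis -/
def LB (c : (Fin n → ℕ) → ℝ) (M : ℕ) (r c0 : ℝ) : Prop :=
  ∀ t : Fin n → ℝ, (∀ i, t i ≠ 0) → (∀ i, |t i| < r) →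
    ∃ (v : Fin n → ℕ) (k : ℕ), (∀ i, v i ≤ M) ∧ 2 ≤ k ∧ k ≤ M ∧
      c0 * starFn c t ≤ |GG c (rc v) k t|

lemma sum_eta_ge (hc : c ≠ 0) (hLB : LB c M r c0) (ht : ∀ i, t i ≠ 0) (htr : ∀ i, |t i| < r) :
    c0 / 2 ≤ ∑ p' ∈ PP n M, eta c c0 p' t := by
  obtain ⟨v, k, hv, hk, hkM, hle⟩ := hLB t ht htr
  have hmem : (v, k) ∈ PP n M := mem_PP.2 ⟨hv, hk, hkM⟩
  refine le_trans ?_ (Finset.single_le_sum (f := fun p => eta c c0 p t)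
    (fun p _ => eta_nonneg p t) hmem)
  have hst := star_pos hc ht
  refine le_trans ?_ (le_max_right _ _)
  have : c0 ≤ |qf c (v, k) t| := by
    unfold qf
    rw [abs_mul, abs_of_pos (inv_pos.2 hst), ← div_eq_mul_inv, le_div_iff₀ hst]
    exact hle
  linarith

lemma sum_chi (hc : c ≠ 0) (hc0 : 0 < c0) (hLB : LB c M r c0) (ht : ∀ i, t i ≠ 0)
    (htr : ∀ i, |t i| < r) : ∑ p ∈ PP n M, chi c c0 M p t = 1 := by
  unfold chi
  rw [← Finset.sum_mul]
  refine mul_inv_cancel₀ ?_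
  have := sum_eta_ge hc hLB ht htr
  linarith

lemma BL_of_complex {A : ℝ} {f : ℝ → ℝ} (hf : BL h A (fun s => (f s : ℂ))) : BL h A f := by
  refine ⟨fun s hs => ?_, fun s hs s' hs' => ?_⟩
  · have := hf.1 s hs; rwa [Complex.norm_real] at this
  · have := hf.2 s hs s' hs'; rwa [← Complex.ofReal_sub, Complex.norm_real] at this

lemma star_inv_BL (hc : c ≠ 0) {M : ℝ} (hM : 0 ≤ M) (hh : 0 ≤ h) (hv : ∀ i, 0 ≤ v i)
    (hvM : ∀ i, v i ≤ M) (ht : ∀ i, t i ≠ 0) :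
    BL h ((1 + DD c * M) * (starFn c t)⁻¹) (fun s => (starFn c (ln v t s))⁻¹) := by
  have hst := star_pos hc ht
  refine BL_of_complex ?_
  have h1 := (star_LL (h := h) hc hM hv hvM ht).cpow hh (mul_nonneg (DD_nonneg c) hM) (-1)
    (Q := (starFn c t)⁻¹) (fun s hs => by
      have : (-1 : ℂ).re = -1 := by simp
      rw [this, rpow_neg_one]
      exact inv_anti₀ hst (star_mono hv hs.1))
  rw [norm_neg, norm_one, one_mul] at h1
  refine h1.congr fun s _ => ?_
  rw [Complex.cpow_neg_one, Complex.ofReal_inv]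

lemma q_BL (hS : SD S c r0 u) (hM : 2 ≤ M) {p : (Fin n → ℕ) × ℕ} (hp : ∀ i, p.1 i ≤ M)
    {w : Fin n → ℕ} (hw : ∀ i, w i ≤ M) (hh : 0 ≤ h) (hhρ : h < 1 / (2 * (M:ℝ))) :
    ∃ Cq, 0 ≤ Cq ∧ ∀ t : Fin n → ℝ, (∀ i, t i ≠ 0) → (∀ i, |t i| < r0) →
      BL h Cq (fun s => qf c p (ln (rc w) t s)) := by
  obtain ⟨hv0, hvρ⟩ := grid_rho hM hp
  obtain ⟨hw0, hwρ⟩ := grid_rho hM hw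
  set ρ : ℝ := 1 / (2 * (M:ℝ)) with hρdef
  have hM0 : (0:ℝ) < M := by exact_mod_cast (by omega : 0 < M)
  have hρ : 0 < ρ := by positivity
  set A : ℝ := p.2.factorial / ρ ^ p.2 with hA
  have hA0 : 0 ≤ A := by positivity
  have hU : 0 ≤ ∑' α, u α := tsum_nonneg hS.unn
  have hadm := eG_adm (c := c) hv0 hρ hvρ p.2
  have hD := DD_nonneg c
  refine ⟨2 * (A * (1 + 1 / ρ) * (∑' α, u α)) * (1 + DD c * M), by positivity, fun t ht htr => ?_⟩
  have hst := star_pos hS.hc ht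
  have habs : ∀ s ∈ Icc 0 h, |s| < ρ := fun s hs => by
    rw [abs_of_nonneg hs.1]; exact hs.2.trans_lt hhρ
  have h1 : BL h (A * (1 + 1 / ρ) * (∑' α, u α) * starFn c t)
      (fun s => GG c (rc p.1) p.2 (ln (rc w) t s)) := by
    simp only [GG_ln]
    refine BL.of_deriv (f' := ser (eG c (rc p.1) p.2) (rc w) t 1) (fun s hs => ?_) (fun s hs => ?_)
      (fun s hs => ?_)
    · refine (ser_bound hS hA0 hadm hw0 hρ hwρ ht htr 0 (habs s hs).le).trans ?_
      have : 0 ≤ A * (1 / ρ) * (∑' α, u α) * starFn c t := by positivity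
      simp only [Nat.factorial_zero, pow_zero, Nat.cast_one, div_one, mul_one]
      linarith
    · exact ser_hasDerivAt hS hA0 hadm hw0 hρ hwρ ht htr 0 (habs s hs)
    · refine (ser_bound hS hA0 hadm hw0 hρ hwρ ht htr 1 (habs s hs).le).trans ?_
      have : 0 ≤ A * (∑' α, u α) * starFn c t := by positivity
      simp only [Nat.factorial_one, pow_one, Nat.cast_one]
      linarith
  have h2 := star_inv_BL (h := h) hS.hc hM0.le hh hw0
    (fun i => by unfold rc; exact_mod_cast hw i) ht
  refine (h1.mul hh h2).mono (le_of_eq ?_)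
  field_simp

lemma chi_BL (hS : SD S c r0 u) (hM : 2 ≤ M) (hc0 : 0 < c0) (hr : r ≤ r0)
    (hLB : LB c M r c0) {p : (Fin n → ℕ) × ℕ} (hp : p ∈ PP n M)
    {w : Fin n → ℕ} (hw : ∀ i, w i ≤ M) (hh : 0 ≤ h) (hhρ : h < 1 / (2 * (M:ℝ))) :
    ∃ Cq, 0 ≤ Cq ∧ ∀ t : Fin n → ℝ, (∀ i, t i ≠ 0) → (∀ i, |t i| < r / 2) →
      BL h Cq (fun s => chi c c0 M p (ln (rc w) t s)) := by
  have hM0 : (0:ℝ) < M := by exact_mod_cast (by omega : 0 < M)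
  choose! Cq hCq0 hCq using fun (p : (Fin n → ℕ) × ℕ) (hp : p ∈ PP n M) =>
    q_BL (h := h) hS hM (mem_PP.1 hp).1 hw hh hhρ
  set C := ∑ p ∈ PP n M, Cq p with hC
  have hC0 : 0 ≤ C := Finset.sum_nonneg hCq0
  have hle : ∀ p ∈ PP n M, Cq p ≤ C := fun p hp => Finset.single_le_sum hCq0 hp
  have hcard : (0:ℝ) ≤ ((PP n M).card : ℝ) := Nat.cast_nonneg _
  refine ⟨2 * C * (1 / (c0/2) + (PP n M).card * C / (c0/2) ^ 2), by positivity,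
    fun t ht htr => ?_⟩
  have hrpos : ∀ i, |t i| < r0 := fun i => by
    have := htr i; have := abs_nonneg (t i); linarith
  have heta : ∀ p ∈ PP n M, BL h C (fun s => eta c c0 p (ln (rc w) t s)) := fun p hp =>
    ((hCq p hp t ht hrpos).mono (hle p hp)).posPart (by positivity)
  have hsum := BL.sum (PP n M) heta
  have hw0 : ∀ i, 0 ≤ rc w i := fun i => by simp [rc]
  have hinv := hsum.inv (δ := c0 / 2) hh (by positivity) (fun s hs => by
    refine sum_eta_ge hS.hc hLB (ln_ne hw0 ht hs.1) fun i => ?_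
    have := abs_ln_le (t := t) (M := (M:ℝ)) (h := h) hw0
      (fun i => by unfold rc; exact_mod_cast hw i) (by
        rw [lt_div_iff₀ (by positivity)] at hhρ; nlinarith) hs i
    linarith [htr i])
  exact (heta p hp).mul hh hinv

lemma sign_low (hS : SD S c r0 u) (hM : 2 ≤ M) (hc0 : 0 < c0) {p : (Fin n → ℕ) × ℕ}
    (hp : ∀ i, p.1 i ≤ M) :
    ∃ h, 0 < h ∧ h < 1 / (2 * (M:ℝ)) ∧ ∀ t : Fin n → ℝ, (∀ i, t i ≠ 0) → (∀ i, |t i| < r0) →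
      (∃ s ∈ Icc 0 h, eta c c0 p (ln (rc p.1) t s) ≠ 0) →
      (∀ s ∈ Icc 0 h, c0 / 4 * starFn c t ≤ ser c (rc p.1) t p.2 s) ∨
      (∀ s ∈ Icc 0 h, ser c (rc p.1) t p.2 s ≤ -(c0 / 4 * starFn c t)) := by
  obtain ⟨hv0, hvρ⟩ := grid_rho hM hp
  set ρ : ℝ := 1 / (2 * (M:ℝ)) with hρdef
  have hM0 : (0:ℝ) < M := by exact_mod_cast (by omega : 0 < M)
  have hρ : 0 < ρ := by positivity
  set A : ℝ := p.2.factorial / ρ ^ p.2 with hA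
  have hA0 : 0 ≤ A := by positivity
  have hU : 0 ≤ ∑' α, u α := tsum_nonneg hS.unn
  have hadm := eG_adm (c := c) hv0 hρ hvρ p.2
  set C1 : ℝ := A * (Nat.factorial 1 / ρ ^ 1) * (∑' α, u α) with hC1
  set C2 : ℝ := 1 * ((p.2 + 1).factorial / ρ ^ (p.2 + 1)) * (∑' α, u α) with hC2
  have hC10 : 0 ≤ C1 := by positivity
  have hC20 : 0 ≤ C2 := by positivity
  set h : ℝ := min (ρ / 2) (c0 / (4 * (C1 + C2 + 1))) with hh
  have hhpos : 0 < h := lt_min (by positivity) (by positivity)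
  have hhρ : h < ρ := (min_le_left _ _).trans_lt (by linarith)
  have hhC : (C1 + C2) * h ≤ c0 / 4 := by
    have h1 : h ≤ c0 / (4 * (C1 + C2 + 1)) := min_le_right _ _
    rw [le_div_iff₀ (by positivity)] at h1
    nlinarith
  refine ⟨h, hhpos, hhρ, fun t ht htr hex => ?_⟩
  obtain ⟨s0, hs0, hne⟩ := hex
  have hst := star_pos hS.hc ht
  have habs : ∀ s ∈ Icc 0 h, |s| < ρ := fun s hs => by
    rw [abs_of_nonneg hs.1]; exact hs.2.trans_lt hhρ
  have h0mem : (0:ℝ) ∈ Icc 0 h := ⟨le_rfl, hhpos.le⟩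
  set G0 := GG c (rc p.1) p.2 (ln (rc p.1) t s0) with hG0
  have hlow : c0 / 2 * starFn c t ≤ |G0| := by
    have h1 : 0 < |qf c p (ln (rc p.1) t s0)| - c0 / 2 := by
      by_contra hcon
      exact hne (max_eq_left (not_lt.1 hcon))
    have hst' := star_pos hS.hc (ln_ne hv0 ht hs0.1)
    unfold qf at h1
    rw [abs_mul, abs_of_pos (inv_pos.2 hst'), sub_pos, ← div_eq_mul_inv, lt_div_iff₀ hst'] at h1
    have := mul_le_mul_of_nonneg_left (star_mono (c := c) (t := t) hv0 hs0.1)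
      (by positivity : 0 ≤ c0 / 2)
    linarith
  have hd1 : |G0 - GG c (rc p.1) p.2 t| ≤ C1 * starFn c t * h := by
    have e1 : GG c (rc p.1) p.2 t = ser (eG c (rc p.1) p.2) (rc p.1) t 0 0 := by
      rw [← GG_ln, ln_zero]
    rw [hG0, GG_ln, e1]
    have := (convex_Icc 0 h).norm_image_sub_le_of_norm_hasDerivWithin_le
      (f := ser (eG c (rc p.1) p.2) (rc p.1) t 0)
      (fun x hx => (ser_hasDerivAt hS hA0 hadm hv0 hρ hvρ ht htr 0 (habs x hx)).hasDerivWithinAt)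
      (fun x hx => ser_bound hS hA0 hadm hv0 hρ hvρ ht htr 1 (habs x hx).le) h0mem hs0
    refine this.trans ?_
    refine mul_le_mul_of_nonneg_left ?_ (by positivity)
    rw [sub_zero, Real.norm_of_nonneg hs0.1]; exact hs0.2
  have hd2 : ∀ s ∈ Icc 0 h, |ser c (rc p.1) t p.2 s - GG c (rc p.1) p.2 t| ≤
      C2 * starFn c t * h := by
    intro s hs
    have := (convex_Icc 0 h).norm_image_sub_le_of_norm_hasDerivWithin_le
      (f := ser c (rc p.1) t p.2)
      (fun x hx => (ser_hasDerivAt hS zero_le_one (Adm_self c) hv0 hρ hvρ ht htr p.2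
        (habs x hx)).hasDerivWithinAt)
      (fun x hx => ser_bound hS zero_le_one (Adm_self c) hv0 hρ hvρ ht htr (p.2 + 1)
        (habs x hx).le) h0mem hs
    refine this.trans ?_
    refine mul_le_mul_of_nonneg_left ?_ (by positivity)
    rw [sub_zero, Real.norm_of_nonneg hs.1]; exact hs.2
  have hcomb : ∀ s ∈ Icc 0 h, |ser c (rc p.1) t p.2 s - G0| ≤ c0 / 4 * starFn c t := by
    intro s hs
    have h1 := hd2 s hs
    have h2 : C1 * starFn c t * h + C2 * starFn c t * h ≤ c0 / 4 * starFn c t := by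
      have := mul_le_mul_of_nonneg_right hhC hst.le
      nlinarith
    rw [abs_le] at h1 hd1 ⊢
    constructor <;> linarith
  rcases le_total 0 G0 with hpos | hneg
  · left; intro s hs
    rw [abs_of_nonneg hpos] at hlow
    have := (abs_le.1 (hcomb s hs)).1
    linarith
  · right; intro s hs
    rw [abs_of_nonpos hneg] at hlow
    have := (abs_le.1 (hcomb s hs)).2
    linarith

end

section

/-- open box -/
def bx (n : ℕ) (R : ℝ) : Set (Fin n → ℝ) := {t | ∀ i, |t i| < R}

lemma isOpen_bx (R : ℝ) : IsOpen (bx n R) := by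
  unfold bx
  rw [Set.setOf_forall]
  exact isOpen_iInter_of_finite fun i => isOpen_lt (continuous_apply i).abs continuous_const

lemma ae_U : ∀ᵐ t : Fin n → ℝ, ∀ i, t i ≠ 0 := by
  rw [eventually_countable_forall]
  intro i
  rw [ae_iff]
  simp only [not_not]
  exact Measure.addHaar_submodule volume (LinearMap.ker (LinearMap.proj i : (Fin n → ℝ) →ₗ[ℝ] ℝ))
    (fun h => by
      have h1 : (Pi.single i 1 : Fin n → ℝ) ∈ LinearMap.ker (LinearMap.proj i : (Fin n → ℝ) →ₗ[ℝ] ℝ) := by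
        rw [h]; trivial
      simp at h1)

lemma star_continuous (c : (Fin n → ℕ) → ℝ) : Continuous (starFn c) := by
  have : starFn c = fun t => ∑ v ∈ VE c, amon v t := funext fun t => starFn_eq c t
  rw [this]; unfold amon; fun_prop

lemma minFactor_measurable (c : (Fin n → ℕ) → ℝ) : Measurable (minFactor c) := by
  unfold minFactor
  refine Measurable.min (Measurable.iInf fun i => ?_) (star_continuous c).measurable
  exact (continuous_apply i).abs.measurable

variable {S : (Fin n → ℝ) → ℝ} {c : (Fin n → ℕ) → ℝ} {r0 R h : ℝ} {u : (Fin n → ℕ) → ℝ}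
  {grp : Fin n → Fin m} {a : Fin m → ℝ} {K : (Fin n → ℝ) → ℝ} {χ : (Fin n → ℝ) → ℝ}
  {lam : Fin (n+1) → ℝ} {z : ℂ} {s₁ : ℝ}

/-- integrand -/
def Fz (S K : (Fin n → ℝ) → ℝ) (c : (Fin n → ℕ) → ℝ) (z : ℂ) (lam : Fin (n+1) → ℝ)
    (χ : (Fin n → ℝ) → ℝ) (t : Fin n → ℝ) : ℂ :=
  osc (ph S lam t) * ((χ t : ℂ) * (minFactor c t : ℂ) ^ z * (K t : ℂ))

lemma Fz_norm (hn : 0 < n) (hc : c ≠ 0) (hR1 : R ≤ 1) (hz : z.re = s₁) (hs₁ : 0 ≤ s₁)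
    {C Cχ : ℝ} (hCχ0 : 0 ≤ Cχ) {t : Fin n → ℝ} (ht : ∀ i, t i ≠ 0) (htR : t ∈ bx n R)
    (hK : |K t| ≤ C * kernelWeight grp a t) (hχ : |χ t| ≤ Cχ) :
    ‖Fz S K c z lam χ t‖ ≤ Cχ * C * kernelWeight grp a t := by
  unfold Fz
  rw [norm_mul, norm_osc, one_mul, norm_mul, norm_mul, Complex.norm_real, Complex.norm_real,
    Complex.norm_cpow_eq_rpow_re_of_pos (minFactor_pos hn hc ht), hz]
  have h1 : minFactor c t ^ s₁ ≤ 1 := by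
    refine rpow_le_one (minFactor_pos hn hc ht).le ?_ hs₁
    have := minFactor_le_abs (c := c) (t := t) ⟨0, hn⟩
    linarith [htR ⟨0, hn⟩]
  have h2 : ‖χ t‖ * minFactor c t ^ s₁ ≤ Cχ := by
    calc _ ≤ Cχ * 1 := mul_le_mul hχ h1 (rpow_nonneg (minFactor_pos hn hc ht).le _) hCχ0
      _ = _ := mul_one _
  calc _ ≤ Cχ * (C * kernelWeight grp a t) :=
        mul_le_mul h2 hK (abs_nonneg _) hCχ0
    _ = _ := by ring

lemma Fz_ind_measurable (hS : SD S c r0 u) (hRr : 2 * R ≤ r0)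
    (hKc : ContinuousOn K {t | ∀ i, t i ≠ 0})
    (hχc : ContinuousOn χ (bx n (2 * R) ∩ {t | ∀ i, t i ≠ 0})) :
    Measurable ((bx n (2 * R) ∩ {t | ∀ i, t i ≠ 0}).indicator (Fz S K c z lam χ)) := by
  set O := bx n (2 * R) ∩ {t | ∀ i, t i ≠ 0} with hO
  have hOo : IsOpen O := (isOpen_bx _).inter isOpen_U
  have hSc : ContinuousOn S O := (S_continuousOn hS).mono fun t ht i => (ht.1 i).trans_le hRr
  have hph : ContinuousOn (ph S lam) O := by
    unfold ph
    refine ContinuousOn.add (Continuous.continuousOn (by fun_prop)) (continuousOn_const.mul hSc)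
  have h1 : ContinuousOn (fun t => osc (ph S lam t) * ((χ t : ℂ) * (K t : ℂ))) O := by
    refine ContinuousOn.fun_mul (continuous_osc.comp_continuousOn hph) ?_
    exact ContinuousOn.fun_mul (Complex.continuous_ofReal.comp_continuousOn hχc)
      (Complex.continuous_ofReal.comp_continuousOn (hKc.mono fun t ht => ht.2))
  have h2 : Measurable (O.indicator (fun t => osc (ph S lam t) * ((χ t : ℂ) * (K t : ℂ)))) := by
    classical
    have := ContinuousOn.measurable_piecewise (s := O) h1
      (continuousOn_const (c := (0:ℂ))) hOo.measurableSet
    rw [← Set.piecewise_eq_indicator]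
    exact this
  have h3 : Measurable (fun t => (minFactor c t : ℂ) ^ z) :=
    (Complex.measurable_ofReal.comp (minFactor_measurable c)).pow_const z
  have e : O.indicator (Fz S K c z lam χ) = fun t =>
      O.indicator (fun t => osc (ph S lam t) * ((χ t : ℂ) * (K t : ℂ))) t *
        (minFactor c t : ℂ) ^ z := by
    funext t
    by_cases ht : t ∈ O
    · rw [indicator_of_mem ht, indicator_of_mem ht]; unfold Fz; ring
    · rw [indicator_of_notMem ht, indicator_of_notMem ht, zero_mul]
  rw [e]
  exact h2.mul h3

lemma Fz_ae (hR : 0 < R) (hKs : Function.support K ⊆ bx n R) :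
    (bx n (2 * R) ∩ {t | ∀ i, t i ≠ 0}).indicator (Fz S K c z lam χ) =ᵐ[volume]
      Fz S K c z lam χ := by
  filter_upwards [ae_U] with t ht
  by_cases h : t ∈ bx n (2 * R) ∩ {t | ∀ i, t i ≠ 0}
  · rw [indicator_of_mem h]
  · rw [indicator_of_notMem h]
    have : K t = 0 := by
      by_contra hne
      exact h ⟨fun i => (hKs hne i).trans (by linarith), ht⟩
    simp [Fz, this]

lemma Fz_integrable (hn : 0 < n) (hS : SD S c r0 u) (hR : 0 < R) (hRr : 2 * R ≤ r0)
    (hKs : Function.support K ⊆ bx n R) (hKc : ContinuousOn K {t | ∀ i, t i ≠ 0}) {C Cχ : ℝ}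
    (hKb : ∀ t : Fin n → ℝ, (∀ i, t i ≠ 0) → |K t| ≤ C * kernelWeight grp a t)
    (hW : IntegrableOn (kernelWeight grp a) (bx n R))
    (hχc : ContinuousOn χ (bx n (2 * R) ∩ {t | ∀ i, t i ≠ 0})) (hCχ0 : 0 ≤ Cχ)
    (hχb : ∀ t, (∀ i, t i ≠ 0) → t ∈ bx n R → |χ t| ≤ Cχ)
    (hz : z.re = s₁) (hs₁ : 0 ≤ s₁) : Integrable (Fz S K c z lam χ) := by
  have hR1 : R ≤ 1 := by have := hS.lt; linarith
  have hm := Fz_ind_measurable (z := z) (lam := lam) hS hRr hKc hχc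
  have hae := Fz_ae (S := S) (c := c) (z := z) (lam := lam) (χ := χ) hR hKs
  have hi : Integrable ((bx n R).indicator (fun t => Cχ * C * kernelWeight grp a t)) :=
    (integrable_indicator_iff (isOpen_bx R).measurableSet).2 (hW.const_mul _)
  refine hi.mono' (hm.aestronglyMeasurable.congr hae) ?_
  filter_upwards [ae_U] with t ht
  by_cases h : t ∈ bx n R
  · rw [indicator_of_mem h]
    exact Fz_norm hn hS.hc hR1 hz hs₁ hCχ0 ht h (hKb t ht) (hχb t ht h)
  · rw [indicator_of_notMem h]
    have : K t = 0 := by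
      by_contra hne; exact h (hKs hne)
    simp [Fz, this]

lemma main_avg (hn : 0 < n) (hS : SD S c r0 u) (hR : 0 < R) (hRr : 2 * R ≤ r0)
    (hKs : Function.support K ⊆ bx n R) (hKc : ContinuousOn K {t | ∀ i, t i ≠ 0}) {C Cχ : ℝ}
    (hKb : ∀ t : Fin n → ℝ, (∀ i, t i ≠ 0) → |K t| ≤ C * kernelWeight grp a t)
    (hW : IntegrableOn (kernelWeight grp a) (bx n R))
    (hχc : ContinuousOn χ (bx n (2 * R) ∩ {t | ∀ i, t i ≠ 0})) (hCχ0 : 0 ≤ Cχ)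
    (hχb : ∀ t, (∀ i, t i ≠ 0) → t ∈ bx n R → |χ t| ≤ Cχ)
    (hz : z.re = s₁) (hs₁ : 0 ≤ s₁) {v : Fin n → ℝ} (hv : ∀ i, 0 ≤ v i) {M : ℝ}
    (hvM : ∀ i, v i ≤ M) (hh : 0 < h) (hhM : h * M ≤ 1)
    {B : (Fin n → ℝ) → ℝ} (hB : IntegrableOn B (bx n R))
    (hin : ∀ t : Fin n → ℝ, (∀ i, t i ≠ 0) → t ∈ bx n R →
      ‖∫ s in (0:ℝ)..h, osc (ph S lam (ln v t s)) * ((Jac v s : ℂ) * ((χ (ln v t s) : ℂ) *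
        (minFactor c (ln v t s) : ℂ) ^ z * (K (ln v t s) : ℂ)))‖ ≤ B t) :
    ‖∫ t, Fz S K c z lam χ t‖ ≤ (1 / h) * ∫ t in bx n R, B t := by
  have hm := Fz_ind_measurable (z := z) (lam := lam) hS hRr hKc hχc
  have hae := Fz_ae (S := S) (c := c) (z := z) (lam := lam) (χ := χ) hR hKs
  have hintg := Fz_integrable (lam := lam) hn hS hR hRr hKs hKc hKb hW hχc hCχ0 hχb hz hs₁
  rw [← integral_congr_ae hae, ← integral_indicator (isOpen_bx R).measurableSet]
  refine avg hm (hintg.congr hae.symm) hv hh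
    ((integrable_indicator_iff (isOpen_bx R).measurableSet).2 hB) ?_
  filter_upwards [ae_U] with t ht
  by_cases h : t ∈ bx n R
  · rw [indicator_of_mem h]
    refine le_trans (le_of_eq ?_) (hin t ht h)
    congr 1
    refine intervalIntegral.integral_congr fun s hs => ?_
    rw [uIcc_of_le hh.le] at hs
    have hmem : ln v t s ∈ bx n (2 * R) ∩ {t | ∀ i, t i ≠ 0} :=
      ⟨fun i => by
        have := abs_ln_le (t := t) hv hvM hhM hs i
        linarith [h i], ln_ne hv ht hs.1⟩
    simp only [indicator_of_mem hmem, Fz]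
    ring
  · rw [indicator_of_notMem h]
    refine le_of_eq ?_
    rw [norm_eq_zero]
    rw [intervalIntegral.integral_congr (g := fun _ => 0)]
    · simp
    · intro s hs
      rw [uIcc_of_le hh.le] at hs
      have : K (ln v t s) = 0 := by
        by_contra hne
        exact h fun i => (le_abs_ln hv hs.1 i).trans_lt (hKs hne i)
      have h0 : Fz S K c z lam χ (ln v t s) = 0 := by simp [Fz, this]
      have h1 := Set.indicator_apply_eq_zero (s := bx n (2 * R) ∩ {t | ∀ i, t i ≠ 0})
        (f := Fz S K c z lam χ) (a := ln v t s) |>.2 fun _ => h0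
      simp only [h1, mul_zero]

end

section

variable {S : (Fin n → ℝ) → ℝ} {c : (Fin n → ℕ) → ℝ} {r0 r R h c0 : ℝ} {u : (Fin n → ℕ) → ℝ}
  {grp : Fin n → Fin m} {a : Fin m → ℝ} {K : (Fin n → ℝ) → ℝ} {χ : (Fin n → ℝ) → ℝ}
  {s₁ : ℝ} {M : ℕ}

lemma osc_ph_continuousOn (hS : SD S c r0 u) {ρ : ℝ} {v t : Fin n → ℝ} (hv : ∀ i, 0 ≤ v i)
    (hρ : 0 < ρ) (hvρ : ∀ i, 2 * ρ * v i ≤ 1) (ht : ∀ i, t i ≠ 0) (htr : ∀ i, |t i| < r0)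
    (hhρ : h < ρ) (lam : Fin (n+1) → ℝ) :
    ContinuousOn (fun s => osc (ph S lam (ln v t s))) (Icc 0 h) := by
  have habs : ∀ s ∈ Icc 0 h, |s| < ρ := fun s hs => by
    rw [abs_of_nonneg hs.1]; exact hs.2.trans_lt hhρ
  have h1 : ContinuousOn (Phi c lam v t 0) (Icc 0 h) := fun s hs =>
    (Phi_hasDerivAt hS hv hρ hvρ ht htr lam 0 (habs s hs)).continuousAt.continuousWithinAt
  refine continuous_osc.comp_continuousOn (h1.congr fun s hs => ?_)
  exact (Phi_zero hS hv hvρ htr lam (habs s hs).le).symm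

lemma amp_BL (hn : 0 < n) (hc : c ≠ 0) (hgrp : Function.Surjective grp) (ha : ∀ k, 0 ≤ a k)
    (hK : ContDiffOn ℝ 1 K {t | ∀ i, t i ≠ 0}) {C : ℝ} (hC0 : 0 ≤ C)
    (hC : ∀ t : Fin n → ℝ, (∀ i, t i ≠ 0) → |K t| ≤ C * kernelWeight grp a t ∧
      ∀ i : Fin n, |fderiv ℝ K t (Pi.single i 1)| ≤ C / |t i| * kernelWeight grp a t)
    {M : ℝ} (hM : 0 ≤ M) {v t : Fin n → ℝ} (hv : ∀ i, 0 ≤ v i) (hvM : ∀ i, v i ≤ M)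
    (ht : ∀ i, t i ≠ 0) (hh : 0 ≤ h) (hh1 : h ≤ 1) (hhM : h * M ≤ 1) {z : ℂ} (hz : z.re = s₁)
    (hs₁ : 0 ≤ s₁) {Cχ : ℝ} (hχ : BL h Cχ (fun s => χ (ln v t s))) :
    BL h ((2 * (2 * (2 + M)) ^ n * (2 * (2 * Cχ * CM c M s₁) * ((1 + n * M) * C))) * (1 + ‖z‖) *
        (minFactor c t ^ s₁ * kernelWeight grp a t))
      (fun s => (Jac v s : ℂ) * ((χ (ln v t s) : ℂ) *
        (minFactor c (ln v t s) : ℂ) ^ z * (K (ln v t s) : ℂ))) := by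
  have h1 := (Jac_BL hh hv hvM hM hhM).ofReal
  have h2 := min_cpow_BL hn hc hM hh hh1 hv hvM ht hz hs₁
  have h3 := (K_BL (h := h) hgrp ha hK hC0 hC hM hv hvM ht).ofReal
  refine (h1.mul hh ((hχ.ofReal.mul hh h2).mul hh h3)).mono (le_of_eq ?_)
  ring

lemma chi_continuousOn (hS : SD S c r0 u) (hM : 2 ≤ M) (hc0 : 0 < c0) (hr : r ≤ r0)
    (hLB : LB c M r c0) {p : (Fin n → ℕ) × ℕ} (hp : p ∈ PP n M) :
    ContinuousOn (chi c c0 M p) (bx n r ∩ {t | ∀ i, t i ≠ 0}) := by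
  have heta : ∀ p ∈ PP n M, ContinuousOn (eta c c0 p) (bx n r ∩ {t | ∀ i, t i ≠ 0}) := by
    intro p hp
    obtain ⟨hv0, hvρ⟩ := grid_rho hM (mem_PP.1 hp).1
    have hM0 : (0:ℝ) < M := by exact_mod_cast (by omega : 0 < M)
    have h1 : ContinuousOn (GG c (rc p.1) p.2) (bx n r ∩ {t | ∀ i, t i ≠ 0}) :=
      (ser_continuousOn hS zero_le_one (Adm_self c) hv0 (by positivity) hvρ p.2
        (s := 0) (by rw [abs_zero]; positivity)).mono fun t ht i => (ht.1 i).trans_le hr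
    have h2 : ContinuousOn (fun t => (starFn c t)⁻¹) (bx n r ∩ {t | ∀ i, t i ≠ 0}) :=
      (star_continuous c).continuousOn.inv₀ fun t ht => (star_pos hS.hc ht.2).ne'
    have h3 : ContinuousOn (qf c p) (bx n r ∩ {t | ∀ i, t i ≠ 0}) := h1.mul h2
    exact ContinuousOn.sup continuousOn_const (h3.abs.sub continuousOn_const)
  refine (heta p hp).mul (ContinuousOn.inv₀ (continuousOn_finset_sum _ heta) fun t ht => ?_)
  have := sum_eta_ge hS.hc hLB ht.2 ht.1
  linarith

lemma chi_le_one (p : (Fin n → ℕ) × ℕ) (hp : p ∈ PP n M) (t : Fin n → ℝ) :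
    |chi c c0 M p t| ≤ 1 := by
  have h0 : 0 ≤ ∑ p' ∈ PP n M, eta c c0 p' t := Finset.sum_nonneg fun p _ => eta_nonneg p t
  have h1 := Finset.single_le_sum (f := fun p => eta c c0 p t) (fun p _ => eta_nonneg p t) hp
  unfold chi
  rw [abs_of_nonneg (mul_nonneg (eta_nonneg p t) (inv_nonneg.2 h0)), ← div_eq_mul_inv]
  exact div_le_one_of_le₀ h1 h0

lemma caseB (hn : 0 < n) (hS : SD S c r0 u) (hM : 2 ≤ M) (hc0 : 0 < c0) (hR : 0 < R)
    (hRr : 2 * R ≤ r0) (hLB : LB c M (2 * R) c0)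
    (hgrp : Function.Surjective grp) (ha : ∀ k, 0 ≤ a k)
    (hKs : Function.support K ⊆ bx n R)
    (hK : ContDiffOn ℝ 1 K {t | ∀ i, t i ≠ 0}) {C : ℝ} (hC0 : 0 ≤ C)
    (hC : ∀ t : Fin n → ℝ, (∀ i, t i ≠ 0) → |K t| ≤ C * kernelWeight grp a t ∧
      ∀ i : Fin n, |fderiv ℝ K t (Pi.single i 1)| ≤ C / |t i| * kernelWeight grp a t)
    (hs₁ : 0 ≤ s₁) (hW : IntegrableOn (kernelWeight grp a) (bx n R))
    (hI : IntegrableOn (fun t => starFn c t ^ (s₁ - 1 / (M:ℝ)) * kernelWeight grp a t) (bx n R))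
    {p : (Fin n → ℕ) × ℕ} (hp : p ∈ PP n M) :
    ∃ D, 0 ≤ D ∧ ∀ (z : ℂ) (lam : Fin (n+1) → ℝ), z.re = s₁ → lam (Fin.last n) ≠ 0 →
      ‖∫ t, Fz S K c z lam (chi c c0 M p) t‖ ≤
        D * (1 + ‖z‖) * |lam (Fin.last n)| ^ (-(1 / (M:ℝ))) := by
  obtain ⟨hpM, hk2, hkM⟩ := mem_PP.1 hp
  obtain ⟨hv0, hvρ⟩ := grid_rho hM hpM
  obtain ⟨h, hh, hhρ, hsign⟩ := sign_low hS hM hc0 hpM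
  have hM0 : (0:ℝ) < M := by exact_mod_cast (by omega : 0 < M)
  have hM2 : (2:ℝ) ≤ M := by exact_mod_cast hM
  obtain ⟨Cχ, hCχ0, hCχ⟩ := chi_BL hS hM hc0 hRr hLB hp hpM hh.le hhρ
  have hhM : h * M ≤ 1 := by
    rw [lt_div_iff₀ (by positivity)] at hhρ; nlinarith
  have hh1 : h ≤ 1 := by nlinarith
  have hvM : ∀ i, rc p.1 i ≤ (M:ℝ) := fun i => by unfold rc; exact_mod_cast hpM i
  set Q0 : ℝ := 2 * (2 * (2 + (M:ℝ))) ^ n * (2 * (2 * Cχ * CM c M s₁) * ((1 + n * M) * C)) with hQ0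
  have hCM : 0 ≤ CM c M s₁ := by have := DD_nonneg c; unfold CM; positivity
  have hQ00 : 0 ≤ Q0 := by positivity
  have hvk := vdcC_nonneg p.2
  set Q1 : ℝ := 4 * (1 + vdcC p.2) * (c0 / 4) ^ (-(1 / (M:ℝ))) * Q0 * 2 with hQ1
  have hQ10 : 0 ≤ Q1 := by positivity
  set I := ∫ t in bx n R, starFn c t ^ (s₁ - 1 / (M:ℝ)) * kernelWeight grp a t with hIdef
  have hI0 : 0 ≤ I := by
    refine setIntegral_nonneg (isOpen_bx R).measurableSet fun t _ => ?_
    have := kernelWeight_nonneg (grp := grp) (a := a) t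
    have := starFn_nonneg (c := c) t
    positivity
  refine ⟨(1 / h) * (Q1 * I), by positivity, fun z lam hz hlam => ?_⟩
  set β : ℝ := 1 / (M:ℝ) with hβ
  set L := lam (Fin.last n) with hL
  have hL0 : 0 < |L| := abs_pos.2 hlam
  have key := main_avg (lam := lam) (χ := chi c c0 M p) (v := rc p.1) (h := h)
    (B := fun t => (Q1 * (1 + ‖z‖) * |L| ^ (-β)) * (starFn c t ^ (s₁ - β) * kernelWeight grp a t))
    hn hS hR hRr hKs hK.continuousOn (fun t ht => (hC t ht).1) hW
    (chi_continuousOn hS hM hc0 hRr hLB hp) zero_le_one (fun t _ _ => chi_le_one p hp t) hz hs₁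
    hv0 hvM hh hhM (hI.const_mul _) ?_
  · rw [integral_const_mul, ← hIdef] at key
    refine key.trans (le_of_eq ?_)
    ring
  · intro t ht htR
    have htr : ∀ i, |t i| < r0 := fun i => (htR i).trans_le (by linarith)
    have hst := star_pos hS.hc ht
    have hw := kernelWeight_nonneg (grp := grp) (a := a) t
    have hmp := minFactor_pos hn hS.hc ht
    by_cases hex : ∃ s ∈ Icc 0 h, eta c c0 p (ln (rc p.1) t s) ≠ 0
    · have hamp := amp_BL hn hS.hc hgrp ha hK hC0 hC hM0.le hv0 hvM ht hh.le hh1 hhM hz hs₁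
        (hCχ t ht (fun i => by have := htR i; linarith))
      have hB := fun x (hx : x ∈ Icc 0 h) => innerB (lam := lam) hS hv0 (by positivity) hvρ ht htr
        hhρ hh1 hk2 (M := (M:ℝ)) (by exact_mod_cast hkM) (by positivity : 0 < c0 / 4) hlam
        (hsign t ht htr hex) hx
      have := cplx_amp hh.le (hamp.nonneg hh.le)
        (osc_ph_continuousOn hS hv0 (by positivity) hvρ ht htr hhρ lam) hB hamp.1 hamp.2
      refine this.trans ?_
      rw [← hQ0, mul_rpow hL0.le (by positivity), mul_rpow (by positivity) hst.le, ← hβ]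
      have h1 : minFactor c t ^ s₁ ≤ starFn c t ^ s₁ :=
        rpow_le_rpow hmp.le minFactor_le_star hs₁
      have h2 : starFn c t ^ (s₁ - β) = starFn c t ^ (-β) * starFn c t ^ s₁ := by
        rw [← rpow_add hst]; congr 1; ring
      rw [h2]
      have h3 : 1 + h ≤ 2 := by linarith
      set LL1 := |L| ^ (-β)
      set CC := (c0 / 4) ^ (-β)
      set SS := starFn c t ^ (-β)
      have hLL : 0 ≤ LL1 := by positivity
      have hCC : 0 ≤ CC := by positivity
      have hSS : 0 ≤ SS := by positivity
      calc 4 * ((1 + vdcC p.2) * (LL1 * (CC * SS))) *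
            (Q0 * (1 + ‖z‖) * (minFactor c t ^ s₁ * kernelWeight grp a t)) * (1 + h)
          ≤ 4 * ((1 + vdcC p.2) * (LL1 * (CC * SS))) *
            (Q0 * (1 + ‖z‖) * (starFn c t ^ s₁ * kernelWeight grp a t)) * 2 := by
            gcongr
        _ = _ := by rw [hQ1]; ring
    · push Not at hex
      have : ∫ s in (0:ℝ)..h, osc (ph S lam (ln (rc p.1) t s)) * ((Jac (rc p.1) s : ℂ) *
          ((chi c c0 M p (ln (rc p.1) t s) : ℂ) *
          (minFactor c (ln (rc p.1) t s) : ℂ) ^ z * (K (ln (rc p.1) t s) : ℂ))) = 0 := by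
        rw [intervalIntegral.integral_congr (g := fun _ => 0)]
        · simp
        · intro s hs
          rw [uIcc_of_le hh.le] at hs
          simp [chi, hex s hs]
      rw [this, norm_zero]
      positivity

lemma caseA (hn : 0 < n) (hS : SD S c r0 u) (hR : 0 < R) (hRr : 2 * R ≤ r0)
    (hgrp : Function.Surjective grp) (ha : ∀ k, 0 ≤ a k)
    (hKs : Function.support K ⊆ bx n R)
    (hK : ContDiffOn ℝ 1 K {t | ∀ i, t i ≠ 0}) {C : ℝ} (hC0 : 0 ≤ C)
    (hC : ∀ t : Fin n → ℝ, (∀ i, t i ≠ 0) → |K t| ≤ C * kernelWeight grp a t ∧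
      ∀ i : Fin n, |fderiv ℝ K t (Pi.single i 1)| ≤ C / |t i| * kernelWeight grp a t)
    (hs₁ : 0 ≤ s₁) (hW : IntegrableOn (kernelWeight grp a) (bx n R)) {β : ℝ} (hβ0 : 0 ≤ β)
    (hβ1 : β ≤ 1)
    (hI : ∀ i, IntegrableOn (fun t => |t i| ^ (s₁ - β) * kernelWeight grp a t) (bx n R)) :
    ∃ E D, 1 ≤ E ∧ 0 ≤ D ∧ ∀ (z : ℂ) (lam : Fin (n+1) → ℝ) (i : Fin n), z.re = s₁ →
      lam i.castSucc ≠ 0 → E * |lam (Fin.last n)| ≤ |lam i.castSucc| →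
      ‖∫ t, Fz S K c z lam (fun _ => 1) t‖ ≤ D * (1 + ‖z‖) * |lam i.castSucc| ^ (-β) := by
  set T := ∑' α, |c α| * 4 ^ dg α * r0 ^ dg α with hT
  have hr0 := hS.pos
  have hT0 : 0 ≤ T := tsum_nonneg fun α => by positivity
  set Cs : ℝ := 1 + 32 * T / r0 with hCs
  have hCs1 : 1 ≤ Cs := by have : 0 ≤ 32 * T / r0 := by positivity
                           linarith
  set h : ℝ := 1/8 with hh
  have hhpos : 0 < h := by norm_num [hh]
  have hhρ : h < 1/4 := by norm_num [hh]
  set Q0 : ℝ := 2 * (2 * (2 + (1:ℝ))) ^ n * (2 * (2 * 1 * CM c 1 s₁) * ((1 + n * 1) * C)) with hQ0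
  have hCM : 0 ≤ CM c 1 s₁ := by have := DD_nonneg c; unfold CM; positivity
  have hQ00 : 0 ≤ Q0 := by positivity
  set Q1 : ℝ := 4 * 7 * Q0 * 2 with hQ1
  have hQ10 : 0 ≤ Q1 := by positivity
  have hIn : ∀ i, 0 ≤ ∫ t in bx n R, |t i| ^ (s₁ - β) * kernelWeight grp a t := fun i => by
    refine setIntegral_nonneg (isOpen_bx R).measurableSet fun t _ => ?_
    have := kernelWeight_nonneg (grp := grp) (a := a) t
    positivity
  set I := ∑ i, ∫ t in bx n R, |t i| ^ (s₁ - β) * kernelWeight grp a t with hIdef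
  have hI0 : 0 ≤ I := Finset.sum_nonneg fun i _ => hIn i
  refine ⟨2 * Cs, (1 / h) * (Q1 * I), by linarith, by positivity, fun z lam i hz hlam hE => ?_⟩
  set v : Fin n → ℝ := rc (Pi.single i 1) with hvdef
  have hv0 : ∀ i, 0 ≤ v i := fun i => by simp [hvdef, rc]
  have hv1 : ∀ k, v k ≤ 1 := fun k => by
    by_cases hk : k = i
    · subst hk; simp [hvdef, rc]
    · simp [hvdef, rc, hk]
  have hvρ : ∀ k, 2 * (1/4) * v k ≤ 1 := fun k => by linarith [hv1 k]
  set L := lam i.castSucc with hL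
  have hL0 : 0 < |L| := abs_pos.2 hlam
  have key := main_avg (lam := lam) (χ := fun _ => 1) (v := v) (h := h) (M := 1)
    (B := fun t => (Q1 * (1 + ‖z‖) * |L| ^ (-β)) * (|t i| ^ (s₁ - β) * kernelWeight grp a t))
    hn hS hR hRr hKs hK.continuousOn (fun t ht => (hC t ht).1) hW
    continuousOn_const zero_le_one (fun t _ _ => by simp) hz hs₁
    hv0 hv1 hhpos (by norm_num [hh]) ((hI i).const_mul _) ?_
  · rw [integral_const_mul] at key
    have hle : ∫ t in bx n R, |t i| ^ (s₁ - β) * kernelWeight grp a t ≤ I :=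
      Finset.single_le_sum (f := fun i => ∫ t in bx n R, |t i| ^ (s₁ - β) * kernelWeight grp a t)
        (fun i _ => hIn i) (Finset.mem_univ i)
    refine key.trans ?_
    calc _ ≤ 1 / h * (Q1 * (1 + ‖z‖) * |L| ^ (-β) * I) := by gcongr
      _ = _ := by ring
  · intro t ht htR
    have htr : ∀ i, |t i| < r0 := fun i => (htR i).trans_le (by linarith)
    have hti := abs_pos.2 (ht i)
    have hw := kernelWeight_nonneg (grp := grp) (a := a) t
    have hmp := minFactor_pos hn hS.hc ht
    have hamp := amp_BL (h := h) (χ := fun _ => (1:ℝ)) hn hS.hc hgrp ha hK hC0 hC zero_le_one hv0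
      hv1 ht hhpos.le (by norm_num [hh]) (by norm_num [hh]) hz hs₁ (Cχ := 1)
      ⟨fun s _ => by simp, fun s _ s' _ => by simp⟩
    have hc1 : ∀ s, |s| ≤ 1/4 → |ser c v t 1 s| ≤ Cs * |t i| := fun s hs => by
      refine (ser_coord hS i htr 1 le_rfl hs).trans (mul_le_mul_of_nonneg_right ?_ hti.le)
      rw [← hT, hCs]
      have e : (Nat.factorial 1 / (1/4)^1 : ℝ) * T / r0 = 4 * T / r0 := by norm_num
      rw [e]
      have : 4 * T / r0 ≤ 32 * T / r0 := by gcongr; norm_num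
      linarith
    have hc2 : ∀ s, |s| ≤ 1/4 → |ser c v t 2 s| ≤ Cs * |t i| := fun s hs => by
      refine (ser_coord hS i htr 2 (by norm_num) hs).trans (mul_le_mul_of_nonneg_right ?_ hti.le)
      rw [← hT, hCs]
      have e : (Nat.factorial 2 / (1/4)^2 : ℝ) * T / r0 = 32 * T / r0 := by norm_num [Nat.factorial]
      rw [e]
      linarith
    have hB := fun x (hx : x ∈ Icc 0 h) => innerA (lam := lam) hS i ht htr hCs1 hc1 hc2 hE hlam
      hhρ hβ0 hβ1 hx
    have := cplx_amp hhpos.le (hamp.nonneg hhpos.le)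
      (osc_ph_continuousOn hS hv0 (by norm_num) hvρ ht htr hhρ lam) hB hamp.1 hamp.2
    refine this.trans ?_
    rw [← hQ0, mul_rpow hL0.le hti.le]
    have h1 : minFactor c t ^ s₁ ≤ |t i| ^ s₁ :=
      rpow_le_rpow hmp.le (minFactor_le_abs i) hs₁
    have h2 : |t i| ^ (s₁ - β) = |t i| ^ (-β) * |t i| ^ s₁ := by
      rw [← rpow_add hti]; congr 1; ring
    rw [h2]
    have h3 : 1 + h ≤ 2 := by norm_num [hh]
    set LL1 := |L| ^ (-β)
    set SS := |t i| ^ (-β)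
    have hLL : 0 ≤ LL1 := by positivity
    have hSS : 0 ≤ SS := by positivity
    calc 4 * (7 * (LL1 * SS)) *
          (Q0 * (1 + ‖z‖) * (minFactor c t ^ s₁ * kernelWeight grp a t)) * (1 + h)
        ≤ 4 * (7 * (LL1 * SS)) *
          (Q0 * (1 + ‖z‖) * (|t i| ^ s₁ * kernelWeight grp a t)) * 2 := by
          gcongr
      _ = _ := by rw [hQ1]; ring

end

section

lemma abs_rpow_integrableOn {b R : ℝ} (hb : b < 1) (hR : 0 < R) :
    IntegrableOn (fun x : ℝ => |x| ^ (-b)) (Ioo (-R) R) := by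
  have h1 : IntegrableOn (fun x : ℝ => x ^ (-b)) (Ioo 0 R) := by
    have := intervalIntegral.intervalIntegrable_rpow' (a := 0) (b := R) (r := -b) (by linarith)
    rw [intervalIntegrable_iff_integrableOn_Ioo_of_le hR.le] at this
    exact this
  have h2 : IntegrableOn (fun x : ℝ => |x| ^ (-b)) (Ioo 0 R) :=
    h1.congr_fun (fun x hx => by simp only [abs_of_pos hx.1]) measurableSet_Ioo
  have h3 : IntegrableOn (fun x : ℝ => |x| ^ (-b)) (Ioo (-R) 0) := by
    have := ((Measure.measurePreserving_neg (volume : Measure ℝ)).integrableOn_comp_preimage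
      (Homeomorph.neg ℝ).measurableEmbedding (f := fun x : ℝ => |x| ^ (-b)) (s := Ioo 0 R)).2 h2
    have hs : (Neg.neg ⁻¹' (Ioo 0 R) : Set ℝ) = Ioo (-R) 0 := by
      ext x; simp only [mem_preimage, mem_Ioo]; constructor <;> rintro ⟨h, h'⟩ <;> constructor <;> linarith
    rw [hs] at this
    refine this.congr_fun (fun x _ => by simp) measurableSet_Ioo
  refine (h3.union h2).mono_set_ae ?_
  have : ∀ᵐ x : ℝ, x ≠ 0 := by simp [ae_iff]
  filter_upwards [this] with x hx hxm
  rcases lt_or_gt_of_ne hx with h | h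
  · exact Or.inl ⟨hxm.1, h⟩
  · exact Or.inr ⟨h, hxm.2⟩

lemma prod_integrableOn {b : Fin n → ℝ} {R : ℝ} (hb : ∀ i, b i < 1) (hR : 0 < R) :
    IntegrableOn (fun t : Fin n → ℝ => ∏ i, |t i| ^ (-(b i))) (bx n R) := by
  have hs : bx n R = Set.pi univ (fun _ : Fin n => Ioo (-R) R) := by
    ext t; simp [bx, abs_lt]
  rw [hs]
  unfold IntegrableOn
  rw [volume_pi, Measure.restrict_pi_pi]
  exact Integrable.fintype_prod (f := fun i x => |x| ^ (-(b i))) fun i => abs_rpow_integrableOn (hb i) hR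

variable {grp : Fin n → Fin m} {a : Fin m → ℝ} {c : (Fin n → ℕ) → ℝ} {R : ℝ}

lemma weight_le (hgrp : Function.Surjective grp) {b : Fin n → ℝ} (hb : ∀ j, 0 ≤ b j)
    (hsum : ∀ k, ∑ j ∈ Finset.univ.filter (fun j => grp j = k), b j = a k) {t : Fin n → ℝ}
    (ht : ∀ i, t i ≠ 0) : kernelWeight grp a t ≤ ∏ j, |t j| ^ (-(b j)) := by
  unfold kernelWeight
  rw [← Finset.prod_fiberwise (s := Finset.univ) (g := grp) (f := fun j => |t j| ^ (-(b j)))]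
  refine Finset.prod_le_prod (fun k _ => rpow_nonneg (Real.sqrt_nonneg _) _) fun k _ => ?_
  rw [← hsum k, ← Finset.sum_neg_distrib, rpow_sum_of_pos (grpNorm_pos hgrp ht k)]
  refine Finset.prod_le_prod (fun j _ => rpow_nonneg (Real.sqrt_nonneg _) _) fun j hj => ?_
  refine rpow_le_rpow_of_nonpos (abs_pos.2 (ht j)) ?_ (by linarith [hb j])
  unfold grpNorm
  refine Real.le_sqrt_of_sq_le ?_
  rw [sq_abs]
  exact Finset.single_le_sum (f := fun i => t i ^ 2) (fun i _ => sq_nonneg _) hj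

lemma kernelWeight_measurable : Measurable (kernelWeight grp a) := by
  unfold kernelWeight grpNorm
  refine Finset.measurable_prod _ fun k _ => ?_
  refine Measurable.pow_const ?_ _
  refine Measurable.sqrt ?_
  exact Finset.measurable_sum _ fun i _ => (measurable_pi_apply i).pow_const 2

lemma weight_integrable (hgrp : Function.Surjective grp)
    {l : Fin m → ℕ} (hl : ∀ k, l k = (Finset.univ.filter (fun i => grp i = k)).card)
    (ha : ∀ k, 0 ≤ a k) {θ : ℝ} (hθ0 : 0 ≤ θ) (hθ1 : θ < 1) (hθ : ∀ k, θ < l k - a k)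
    (hR : 0 < R) (i : Fin n) :
    IntegrableOn (fun t => |t i| ^ (-θ) * kernelWeight grp a t) (bx n R) := by
  set th : Fin n → ℝ := fun j => if j = i then θ else 0 with hth
  set Th : Fin m → ℝ := fun k => if grp i = k then θ else 0 with hTh
  have hThle : ∀ k, Th k ≤ θ := fun k => by simp only [hTh]; split_ifs <;> linarith
  have hden : ∀ k, a k < l k - Th k := fun k => by linarith [hThle k, hθ k]
  have hden0 : ∀ k, 0 < l k - Th k := fun k => (ha k).trans_lt (hden k)
  have hth1 : ∀ j, th j < 1 := fun j => by simp only [hth]; split_ifs <;> linarith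
  have hth0 : ∀ j, 0 ≤ th j := fun j => by simp only [hth]; split_ifs <;> linarith
  set b : Fin n → ℝ := fun j => a (grp j) * (1 - th j) / (l (grp j) - Th (grp j)) with hb
  have hb0 : ∀ j, 0 ≤ b j := fun j =>
    div_nonneg (mul_nonneg (ha _) (by linarith [hth1 j])) (hden0 _).le
  have hb1 : ∀ j, b j + th j < 1 := by
    intro j
    have : b j < 1 - th j := by
      simp only [hb]
      rw [div_lt_iff₀ (hden0 _), mul_comm]
      exact mul_lt_mul_of_pos_left (hden _) (by linarith [hth1 j])
    linarith
  have hsum : ∀ k, ∑ j ∈ Finset.univ.filter (fun j => grp j = k), b j = a k := by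
    intro k
    have h1 : ∑ j ∈ Finset.univ.filter (fun j => grp j = k), b j =
        ∑ j ∈ Finset.univ.filter (fun j => grp j = k), a k / (l k - Th k) * (1 - th j) := by
      refine Finset.sum_congr rfl fun j hj => ?_
      have : grp j = k := (Finset.mem_filter.1 hj).2
      simp only [hb, this]; ring
    have h2 : ∑ j ∈ Finset.univ.filter (fun j => grp j = k), (1 - th j) = l k - Th k := by
      rw [Finset.sum_sub_distrib, Finset.sum_const, nsmul_eq_mul, mul_one, ← hl k]
      congr 1
      simp only [hth, hTh, Finset.sum_ite_eq', Finset.mem_filter, Finset.mem_univ, true_and]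
    rw [h1, ← Finset.mul_sum, h2, div_mul_cancel₀ _ (hden0 k).ne']
  have hI := prod_integrableOn (b := fun j => b j + th j) hb1 hR
  refine hI.mono' ?_ ?_
  · refine (Measurable.mul ?_ kernelWeight_measurable).aestronglyMeasurable
    exact (continuous_apply i).abs.measurable.pow_const _
  · filter_upwards [ae_restrict_of_ae ae_U] with t ht
    rw [Real.norm_of_nonneg (mul_nonneg (rpow_nonneg (abs_nonneg _) _) (kernelWeight_nonneg t))]
    have h1 : ∏ j, |t j| ^ (-(b j + th j)) = |t i| ^ (-θ) * ∏ j, |t j| ^ (-(b j)) := by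
      have : ∀ j, |t j| ^ (-(b j + th j)) = |t j| ^ (-(th j)) * |t j| ^ (-(b j)) := fun j => by
        rw [← rpow_add (abs_pos.2 (ht j))]; congr 1; ring
      rw [Finset.prod_congr rfl fun j _ => this j, Finset.prod_mul_distrib]
      congr 1
      rw [Finset.prod_eq_single i]
      · simp [hth]
      · intro j _ hj; simp [hth, hj]
      · simp
    rw [h1]
    exact mul_le_mul_of_nonneg_left (weight_le hgrp hb0 hsum ht) (rpow_nonneg (abs_nonneg _) _)

lemma weight_integrable0 (hn : 0 < n) (hgrp : Function.Surjective grp)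
    {l : Fin m → ℕ} (hl : ∀ k, l k = (Finset.univ.filter (fun i => grp i = k)).card)
    (ha : ∀ k, 0 ≤ a k ∧ a k < l k) (hR : 0 < R) :
    IntegrableOn (kernelWeight grp a) (bx n R) := by
  have := weight_integrable hgrp hl (fun k => (ha k).1) le_rfl zero_lt_one
    (fun k => by linarith [(ha k).2]) hR ⟨0, hn⟩
  simpa using this

lemma I2 (hn : 0 < n) (hgrp : Function.Surjective grp)
    {l : Fin m → ℕ} (hl : ∀ k, l k = (Finset.univ.filter (fun i => grp i = k)).card)
    (ha : ∀ k, 0 ≤ a k ∧ a k < l k) (hR : 0 < R) (hR1 : R ≤ 1) {s β : ℝ} (h1 : β - s < 1)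
    (h2 : ∀ k, β - s < l k - a k) (i : Fin n) :
    IntegrableOn (fun t => |t i| ^ (s - β) * kernelWeight grp a t) (bx n R) := by
  rcases le_or_gt 0 (β - s) with h | h
  · have := weight_integrable hgrp hl (fun k => (ha k).1) h h1 h2 hR i
    rwa [neg_sub] at this
  · refine (weight_integrable0 hn hgrp hl ha hR).mono' ?_ ?_
    · refine (Measurable.mul ?_ kernelWeight_measurable).aestronglyMeasurable
      exact (continuous_apply i).abs.measurable.pow_const _
    · filter_upwards [ae_restrict_mem (isOpen_bx R).measurableSet] with t ht
      rw [Real.norm_of_nonneg (mul_nonneg (rpow_nonneg (abs_nonneg _) _) (kernelWeight_nonneg t))]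
      refine mul_le_of_le_one_left (kernelWeight_nonneg t) ?_
      exact rpow_le_one (abs_nonneg _) ((ht i).le.trans hR1) (by linarith)

/-- symmetric functions: integrability on the positive cube suffices -/
lemma integrableOn_bx_of_even {F : (Fin n → ℝ) → ℝ} {r : ℝ}
    (hF : ∀ t t' : Fin n → ℝ, (∀ i, |t i| = |t' i|) → F t = F t')
    (hI : IntegrableOn F {t | ∀ i, t i ∈ Ioo 0 r}) : IntegrableOn F (bx n r) := by
  set Q : Set (Fin n → ℝ) := {t | ∀ i, t i ∈ Ioo 0 r} with hQ
  set e : (Fin n → Bool) → (Fin n → ℝ) → (Fin n → ℝ) := fun σ t i => if σ i then t i else - t i with he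
  have hee : ∀ σ t, e σ (e σ t) = t := by
    intro σ t; funext i; simp only [he]; split_ifs <;> simp
  have hmp : ∀ σ, MeasurePreserving (e σ) volume volume := by
    intro σ
    refine volume_preserving_pi (f := fun i x => if σ i then x else -x) fun i => ?_
    by_cases h : σ i
    · simp only [h, if_true]; exact MeasurePreserving.id _
    · simp only [h]; exact Measure.measurePreserving_neg _
  have hme : ∀ σ, MeasurableEmbedding (e σ) := by
    intro σ
    refine Continuous.measurableEmbedding ?_ (Function.LeftInverse.injective (hee σ))
    refine continuous_pi fun i => ?_
    simp only [he]; split_ifs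
    · exact continuous_apply i
    · exact (continuous_apply i).neg
  have h1 : ∀ σ, IntegrableOn F (e σ ⁻¹' Q) := by
    intro σ
    have := ((hmp σ).integrableOn_comp_preimage (hme σ) (f := F) (s := Q)).2 hI
    have h2 : F ∘ e σ = F := funext fun t => hF _ _ fun i => by
      simp only [he]; split_ifs <;> simp
    rwa [h2] at this
  have h2 : IntegrableOn F (⋃ σ ∈ (Finset.univ : Finset (Fin n → Bool)), e σ ⁻¹' Q) :=
    (integrableOn_finset_iUnion).2 fun σ _ => h1 σ
  refine h2.mono_set_ae ?_
  filter_upwards [ae_U] with t ht htb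
  refine mem_iUnion₂.2 ⟨fun i => decide (0 < t i), Finset.mem_univ _, fun i => ?_⟩
  have := htb i
  simp only [he, decide_eq_true_eq]
  split_ifs with h
  · exact ⟨h, by rwa [abs_of_pos h] at this⟩
  · have h' : t i < 0 := lt_of_le_of_ne (not_lt.1 h) (ht i)
    exact ⟨by linarith, by rwa [abs_of_neg h'] at this⟩

lemma dyadic_bound {x θ : ℝ} (hx : 0 < x) (hθ : 0 < θ) :
    ENNReal.ofReal (x ^ (-θ)) ≤ ENNReal.ofReal ((8:ℝ) ^ θ) +
      ∑' j : ℕ, ENNReal.ofReal (((2:ℝ) ^ θ) ^ (j + 4)) *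
        (if x < (1/2:ℝ) ^ (j + 2) then 1 else 0) := by
  by_cases h : x < 1/8
  · obtain ⟨k, hk1, hk2⟩ := exists_nat_pow_near_of_lt_one hx (by linarith : x ≤ 1)
      (by norm_num : (0:ℝ) < 1/2) (by norm_num)
    have hk : 3 ≤ k := by
      by_contra hk
      have : (1/2:ℝ)^3 ≤ (1/2)^(k+1) := pow_le_pow_of_le_one (by norm_num) (by norm_num) (by omega)
      norm_num at this hk1 h
      linarith
    obtain ⟨j, rfl⟩ : ∃ j, k = j + 3 := ⟨k - 3, by omega⟩
    refine le_add_left ?_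
    refine le_trans ?_ (ENNReal.le_tsum j)
    rw [if_pos, mul_one]
    · refine ENNReal.ofReal_le_ofReal ?_
      rw [rpow_neg hx.le, ← inv_rpow hx.le, ← rpow_natCast, ← rpow_mul (by norm_num), mul_comm θ,
        rpow_mul (by norm_num), rpow_natCast]
      refine rpow_le_rpow (by positivity) ?_ hθ.le
      rw [inv_le_comm₀ hx (by positivity), ← inv_pow]
      rw [one_div] at hk1
      exact hk1.le
    · refine hk2.trans_lt ?_
      exact pow_lt_pow_right_of_lt_one₀ (by norm_num) (by norm_num) (by omega)
  · refine le_add_right (ENNReal.ofReal_le_ofReal ?_)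
    rw [rpow_neg hx.le, ← inv_rpow hx.le]
    refine rpow_le_rpow (by positivity) ?_ hθ.le
    rw [inv_le_comm₀ hx (by norm_num)]; linarith

lemma star_even (t t' : Fin n → ℝ) (h : ∀ i, |t i| = |t' i|) : starFn c t = starFn c t' := by
  unfold starFn; simp only [h]

lemma weight_even (t t' : Fin n → ℝ) (h : ∀ i, |t i| = |t' i|) :
    kernelWeight grp a t = kernelWeight grp a t' := by
  unfold kernelWeight grpNorm
  have : ∀ i, t i ^ 2 = t' i ^ 2 := fun i => by rw [← sq_abs, h, sq_abs]
  simp only [this]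

lemma I1_pos (hc : c ≠ 0) {a₀ : ℝ} {d₀ : ℕ} {r B : ℝ} (hB0 : 0 < B)
    (hB : ∀ ε : ℝ, 0 < ε → ε < 1/2 →
      fracMeasure grp a {t | (∀ i, t i ∈ Set.Ioo 0 r) ∧ starFn c t < ε} ≤
          ENNReal.ofReal (B * ε ^ a₀ * |Real.log ε| ^ d₀))
    (hW : IntegrableOn (kernelWeight grp a) (bx n r)) {θ : ℝ} (hθ0 : 0 < θ) (hθ : θ < a₀) :
    IntegrableOn (fun t => starFn c t ^ (-θ) * kernelWeight grp a t) {t | ∀ i, t i ∈ Set.Ioo 0 r} := by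
  set Q : Set (Fin n → ℝ) := {t | ∀ i, t i ∈ Set.Ioo 0 r} with hQ
  have hQm : MeasurableSet Q := by
    rw [hQ, Set.setOf_forall]
    exact MeasurableSet.iInter fun i => (measurable_pi_apply i) measurableSet_Ioo
  have hwm : Measurable (fun t => ENNReal.ofReal (kernelWeight grp a t)) :=
    kernelWeight_measurable.ennreal_ofReal
  have hsm : Measurable (fun t => starFn c t ^ (-θ)) := (star_continuous c).measurable.pow_const _
  refine ⟨(hsm.mul kernelWeight_measurable).aestronglyMeasurable, ?_⟩
  have hQb : Q ⊆ bx n r := fun t ht i => by rw [abs_of_pos (ht i).1]; exact (ht i).2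
  have hμQ : fracMeasure grp a Q < ⊤ := by
    rw [fracMeasure, withDensity_apply _ hQm]
    have := (hW.mono_set hQb).lintegral_lt_top
    exact this
  have e1 : ∫⁻ t in Q, ‖starFn c t ^ (-θ) * kernelWeight grp a t‖ₑ =
      ∫⁻ t in Q, ENNReal.ofReal (starFn c t ^ (-θ)) ∂(fracMeasure grp a) := by
    rw [fracMeasure, restrict_withDensity hQm, lintegral_withDensity_eq_lintegral_mul _ hwm
      hsm.ennreal_ofReal]
    refine lintegral_congr fun t => ?_
    rw [Pi.mul_apply, ← ENNReal.ofReal_mul (kernelWeight_nonneg t), mul_comm,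
      Real.enorm_of_nonneg (mul_nonneg (kernelWeight_nonneg t) (rpow_nonneg (starFn_nonneg c t) _))]
  unfold HasFiniteIntegral
  rw [e1]
  have e2 : ∫⁻ t in Q, ENNReal.ofReal (starFn c t ^ (-θ)) ∂(fracMeasure grp a) ≤
      ∫⁻ t in Q, (ENNReal.ofReal ((8:ℝ) ^ θ) +
      ∑' j : ℕ, ENNReal.ofReal (((2:ℝ) ^ θ) ^ (j + 4)) *
        ({t | starFn c t < (1/2:ℝ) ^ (j + 2)}.indicator 1 t)) ∂(fracMeasure grp a) := by
    refine setLIntegral_mono' hQm fun t ht => ?_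
    refine (dyadic_bound (star_pos hc fun i => (ht i).1.ne') hθ0).trans (le_of_eq ?_)
    congr 1
  have hSm : ∀ j : ℕ, MeasurableSet {t | starFn c t < (1/2:ℝ) ^ (j + 2)} := fun j =>
    (isOpen_lt (star_continuous c) continuous_const).measurableSet
  have hsum : Summable (fun j : ℕ => ((2:ℝ) ^ θ) ^ (j + 4) *
      (B * ((1/2:ℝ) ^ (j + 2)) ^ a₀ * |Real.log ((1/2:ℝ) ^ (j + 2))| ^ d₀)) := by
    set q : ℝ := 2 ^ θ * (1/2) ^ a₀ with hq
    have hq1 : q < 1 := by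
      rw [hq, one_div, inv_rpow (by norm_num), ← rpow_neg (by norm_num), ← rpow_add (by norm_num)]
      exact rpow_lt_one_of_one_lt_of_neg (by norm_num) (by linarith)
    have hq0 : 0 ≤ q := by positivity
    have h1 : Summable (fun j : ℕ => (j:ℝ) ^ d₀ * q ^ j) :=
      summable_pow_mul_geometric_of_norm_lt_one d₀ (by rwa [Real.norm_of_nonneg hq0])
    have h2 := ((summable_nat_add_iff 2).2 h1).mul_left (((2:ℝ)^θ)^2 * B * (Real.log 2) ^ d₀)
    refine h2.congr fun j => ?_
    have e3 : |Real.log ((1/2:ℝ) ^ (j + 2))| = ((j + 2 : ℕ) : ℝ) * Real.log 2 := by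
      rw [Real.log_pow, one_div, Real.log_inv, mul_neg, abs_neg, abs_of_nonneg]
      have := Real.log_pos (by norm_num : (1:ℝ) < 2)
      positivity
    have e4 : ((1/2:ℝ) ^ (j + 2)) ^ a₀ = ((1/2:ℝ) ^ a₀) ^ (j + 2) := by
      rw [← rpow_natCast, ← rpow_natCast, ← rpow_mul (by norm_num), ← rpow_mul (by norm_num), mul_comm]
    rw [e3, e4, hq, mul_pow, mul_pow]
    ring
  refine e2.trans_lt ?_
  rw [lintegral_add_left measurable_const, lintegral_tsum]
  · refine ENNReal.add_lt_top.2 ⟨?_, ?_⟩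
    · rw [setLIntegral_const]
      exact ENNReal.mul_lt_top ENNReal.ofReal_lt_top hμQ
    · refine lt_of_le_of_lt ?_ (hsum.tsum_ofReal_lt_top)
      refine ENNReal.tsum_le_tsum fun j => ?_
      rw [lintegral_const_mul _ (measurable_one.indicator (hSm j)), lintegral_indicator_one (hSm j),
        Measure.restrict_apply (hSm j), ENNReal.ofReal_mul (by positivity)]
      gcongr
      have : {t | starFn c t < (1/2:ℝ) ^ (j + 2)} ∩ Q =
          {t | (∀ i, t i ∈ Set.Ioo 0 r) ∧ starFn c t < (1/2:ℝ) ^ (j + 2)} := by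
        ext t; exact and_comm
      rw [this]
      refine hB _ (by positivity) ?_
      calc (1/2:ℝ) ^ (j + 2) ≤ (1/2:ℝ)^2 :=
            pow_le_pow_of_le_one (by norm_num) (by norm_num) (by omega)
        _ < 1/2 := by norm_num
  · intro j
    exact (measurable_const.mul (measurable_one.indicator (hSm j))).aemeasurable

lemma I1 (hc : c ≠ 0) {a₀ : ℝ} {d₀ : ℕ} {r B : ℝ} (hB0 : 0 < B) (hr1 : r ≤ 1)
    (hB : ∀ ε : ℝ, 0 < ε → ε < 1/2 →
      fracMeasure grp a {t | (∀ i, t i ∈ Set.Ioo 0 r) ∧ starFn c t < ε} ≤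
          ENNReal.ofReal (B * ε ^ a₀ * |Real.log ε| ^ d₀))
    (hW : IntegrableOn (kernelWeight grp a) (bx n r)) {s β : ℝ} (hθ : β - s < a₀) :
    IntegrableOn (fun t => starFn c t ^ (s - β) * kernelWeight grp a t) (bx n r) := by
  rcases lt_or_ge 0 (β - s) with h | h
  · have := I1_pos hc hB0 hB hW h hθ
    rw [neg_sub] at this
    refine integrableOn_bx_of_even (fun t t' htt => ?_) this
    rw [star_even t t' htt, weight_even t t' htt]
  · have hb : ∀ t ∈ bx n r, starFn c t ≤ (VE c).card := by
      intro t ht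
      rw [starFn_eq, ← nsmul_one, ← Finset.sum_const]
      refine Finset.sum_le_sum fun v _ => ?_
      unfold amon
      exact Finset.prod_le_one (fun i _ => by positivity) fun i _ =>
        pow_le_one₀ (abs_nonneg _) ((ht i).le.trans hr1)
    refine (hW.const_mul (((VE c).card : ℝ) ^ (s - β))).mono' ?_ ?_
    · exact (((star_continuous c).measurable.pow_const _).mul
        kernelWeight_measurable).aestronglyMeasurable
    · filter_upwards [ae_restrict_mem (isOpen_bx r).measurableSet] with t ht
      rw [Real.norm_of_nonneg (mul_nonneg (rpow_nonneg (starFn_nonneg c t) _) (kernelWeight_nonneg t))]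
      refine mul_le_mul_of_nonneg_right ?_ (kernelWeight_nonneg t)
      exact rpow_le_rpow (starFn_nonneg c t) (hb t ht) (by linarith)

end

section

lemma pow_cmp {x G N β : ℝ} (hG : 1 ≤ G) (hN : 0 ≤ N) (h : 1 + N ≤ G * x) (hβ0 : 0 ≤ β)
    (hβ1 : β ≤ 1) : x ^ (-β) ≤ G * (1 + N) ^ (-β) := by
  have hx : 0 < x := by
    by_contra hx
    nlinarith
  have h1 : (G * x) ^ (-β) ≤ (1 + N) ^ (-β) := rpow_le_rpow_of_nonpos (by linarith) h (by linarith)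
  rw [mul_rpow (by linarith) hx.le] at h1
  have h2 : 1 ≤ G * G ^ (-β) := by
    nth_rw 1 [← rpow_one G]
    rw [← rpow_add (by linarith)]
    exact one_le_rpow hG (by linarith)
  have h3 : 0 ≤ x ^ (-β) := rpow_nonneg hx.le _
  calc x ^ (-β) ≤ (G * G ^ (-β)) * x ^ (-β) := le_mul_of_one_le_left h3 h2
    _ = G * (G ^ (-β) * x ^ (-β)) := by ring
    _ ≤ _ := mul_le_mul_of_nonneg_left h1 (by linarith)

lemma exp_sq_bound {z : ℂ} {s₁ : ℝ} (hz : z.re = s₁) :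
    ‖Complex.exp (z ^ 2)‖ * (1 + ‖z‖) ≤ Real.exp (s₁ ^ 2) * (2 + |s₁|) := by
  rw [Complex.norm_exp]
  have h1 : (z ^ 2).re = s₁ ^ 2 - z.im ^ 2 := by rw [sq, Complex.mul_re, hz]; ring
  rw [h1, Real.exp_sub, div_mul_eq_mul_div, mul_div_assoc]
  refine mul_le_mul_of_nonneg_left ?_ (Real.exp_pos _).le
  rw [div_le_iff₀ (Real.exp_pos _)]
  have h2 := Complex.norm_le_abs_re_add_abs_im z
  rw [hz] at h2
  have h3 := Real.add_one_le_exp (z.im ^ 2)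
  have h4 : |z.im| ≤ 1 + z.im ^ 2 := by
    rw [← sq_abs]; nlinarith [sq_nonneg (|z.im| - 1), abs_nonneg z.im]
  have h5 : 1 ≤ Real.exp (z.im ^ 2) := Real.one_le_exp (sq_nonneg _)
  nlinarith [abs_nonneg s₁]

lemma sqrt_le_card {N : ℕ} {lam : Fin N → ℝ} {x : ℝ} (hx : ∀ i, |lam i| ≤ x) (hx0 : 0 ≤ x) :
    Real.sqrt (∑ i, lam i ^ 2) ≤ N * x := by
  rw [Real.sqrt_le_left (by positivity)]
  have h1 : ∑ i, lam i ^ 2 ≤ ∑ i : Fin N, x ^ 2 := Finset.sum_le_sum fun i _ => by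
    rw [← sq_abs]; exact pow_le_pow_left₀ (abs_nonneg _) (hx i) 2
  rw [Finset.sum_const, Finset.card_univ, Fintype.card_fin, nsmul_eq_mul] at h1
  refine h1.trans ?_
  rw [mul_pow]
  refine mul_le_mul_of_nonneg_right ?_ (sq_nonneg _)
  have : N ≤ N ^ 2 := Nat.le_self_pow (by norm_num) N
  exact_mod_cast this

variable {S : (Fin n → ℝ) → ℝ} {c : (Fin n → ℕ) → ℝ} {r0 R c0 : ℝ} {u : (Fin n → ℕ) → ℝ}
  {grp : Fin n → Fin m} {a : Fin m → ℝ} {K : (Fin n → ℝ) → ℝ} {s₁ : ℝ} {M : ℕ}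

lemma nuHatZ_eq (z : ℂ) (lam : Fin (n+1) → ℝ) :
    nuHatZ S K c z lam = Complex.exp (z ^ 2) * ∫ t, Fz S K c z lam (fun _ => 1) t := by
  unfold nuHatZ
  congr 1
  refine integral_congr_ae (Eventually.of_forall fun t => ?_)
  simp only [Fz, osc, ph, Complex.ofReal_one, one_mul]
  ring

lemma Fz_split (hn : 0 < n) (hS : SD S c r0 u) (hM : 2 ≤ M) (hc0 : 0 < c0) (hR : 0 < R)
    (hRr : 2 * R ≤ r0) (hLB : LB c M (2 * R) c0)
    (hKs : Function.support K ⊆ bx n R)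
    (hK : ContDiffOn ℝ 1 K {t | ∀ i, t i ≠ 0}) {C : ℝ}
    (hKb : ∀ t : Fin n → ℝ, (∀ i, t i ≠ 0) → |K t| ≤ C * kernelWeight grp a t)
    (hs₁ : 0 ≤ s₁) (hW : IntegrableOn (kernelWeight grp a) (bx n R)) {z : ℂ} (hz : z.re = s₁)
    (lam : Fin (n+1) → ℝ) :
    ∫ t, Fz S K c z lam (fun _ => 1) t = ∑ p ∈ PP n M, ∫ t, Fz S K c z lam (chi c c0 M p) t := by
  rw [← integral_finset_sum]
  · refine integral_congr_ae ?_
    filter_upwards [ae_U] with t ht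
    by_cases h : K t = 0
    · simp [Fz, h]
    · have hb : t ∈ bx n R := hKs h
      have h1 := sum_chi hS.hc hc0 hLB ht fun i => (hb i).trans (by linarith)
      simp only [Fz]
      rw [← Finset.mul_sum, ← Finset.sum_mul, ← Finset.sum_mul]
      congr 3
      rw [← h1]; push_cast; rfl
  · intro p hp
    exact Fz_integrable hn hS hR hRr hKs hK.continuousOn hKb hW
      (chi_continuousOn hS hM hc0 hRr hLB hp) zero_le_one (fun t _ _ => chi_le_one p hp t) hz hs₁

lemma nu_bound (hn : 0 < n) (hS : SD S c r0 u) (hM : 2 ≤ M) (hc0 : 0 < c0) (hR : 0 < R)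
    (hRr : 2 * R ≤ r0) (hLB : LB c M (2 * R) c0)
    (hgrp : Function.Surjective grp) (ha : ∀ k, 0 ≤ a k)
    (hKs : Function.support K ⊆ bx n R)
    (hK : ContDiffOn ℝ 1 K {t | ∀ i, t i ≠ 0}) {C : ℝ} (hC0 : 0 ≤ C)
    (hC : ∀ t : Fin n → ℝ, (∀ i, t i ≠ 0) → |K t| ≤ C * kernelWeight grp a t ∧
      ∀ i : Fin n, |fderiv ℝ K t (Pi.single i 1)| ≤ C / |t i| * kernelWeight grp a t)
    (hs₁ : 0 ≤ s₁) (hW : IntegrableOn (kernelWeight grp a) (bx n R))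
    (hI1 : IntegrableOn (fun t => starFn c t ^ (s₁ - 1 / (M:ℝ)) * kernelWeight grp a t) (bx n R))
    (hI2 : ∀ i, IntegrableOn (fun t => |t i| ^ (s₁ - 1 / (M:ℝ)) * kernelWeight grp a t) (bx n R)) :
    ∃ D, 0 ≤ D ∧ ∀ (z : ℂ) (lam : Fin (n+1) → ℝ), z.re = s₁ →
      ‖nuHatZ S K c z lam‖ ≤ D * (1 + Real.sqrt (∑ i, lam i ^ 2)) ^ (-(1 / (M:ℝ))) := by
  have hM0 : (0:ℝ) < M := by exact_mod_cast (by omega : 0 < M)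
  have hM1 : (1:ℝ) ≤ M := by exact_mod_cast (by omega : 1 ≤ M)
  set β : ℝ := 1 / (M:ℝ) with hβ
  have hβ0 : 0 ≤ β := by positivity
  have hβ1 : β ≤ 1 := by rw [hβ, div_le_one hM0]; exact hM1
  have hR1 : R ≤ 1 := by have := hS.lt; linarith
  have hKb := fun t ht => (hC t ht).1
  obtain ⟨E, DA, hE, hDA, hA⟩ := caseA hn hS hR hRr hgrp ha hKs hK hC0 hC hs₁ hW hβ0 hβ1 hI2
  have hBB : ∀ p : (Fin n → ℕ) × ℕ, ∃ D, 0 ≤ D ∧ (p ∈ PP n M → ∀ (z : ℂ) (lam : Fin (n+1) → ℝ),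
      z.re = s₁ → lam (Fin.last n) ≠ 0 → ‖∫ t, Fz S K c z lam (chi c c0 M p) t‖ ≤
        D * (1 + ‖z‖) * |lam (Fin.last n)| ^ (-β)) := by
    intro p
    by_cases hp : p ∈ PP n M
    · obtain ⟨D, h0, h⟩ := caseB hn hS hM hc0 hR hRr hLB hgrp ha hKs hK hC0 hC hs₁ hW hI1 hp
      exact ⟨D, h0, fun _ => h⟩
    · exact ⟨0, le_rfl, fun h => absurd h hp⟩
  choose DB hDB0 hDB using hBB
  set D0 : ℝ := ∫ t in bx n R, C * kernelWeight grp a t with hD0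
  have hD00 : 0 ≤ D0 := integral_nonneg fun t => mul_nonneg hC0 (kernelWeight_nonneg t)
  have hsB : 0 ≤ ∑ p ∈ PP n M, DB p := Finset.sum_nonneg fun p _ => hDB0 p
  set G : ℝ := 2 * ((n:ℝ) + 1) * E with hG
  have hn1 : (1:ℝ) ≤ (n:ℝ) + 1 := by linarith [Nat.cast_nonneg (α := ℝ) n]
  have hG2 : 2 ≤ G := by rw [hG]; nlinarith
  set D : ℝ := (D0 + DA + ∑ p ∈ PP n M, DB p) * G with hD
  have hDn : 0 ≤ D := by positivity
  have key : ∀ (z : ℂ) (lam : Fin (n+1) → ℝ), z.re = s₁ →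
      ‖∫ t, Fz S K c z lam (fun _ => 1) t‖ ≤
        D * (1 + ‖z‖) * (1 + Real.sqrt (∑ i, lam i ^ 2)) ^ (-β) := by
    intro z lam hz
    set N := Real.sqrt (∑ i, lam i ^ 2) with hN
    have hN0 : 0 ≤ N := Real.sqrt_nonneg _
    have hNp : 0 ≤ (1 + N) ^ (-β) := rpow_nonneg (by linarith) _
    have hz1 : 1 ≤ 1 + ‖z‖ := by linarith [norm_nonneg z]
    -- auxiliary: from a bound by `D1 x^{-β}`
    have aux : ∀ D1 x : ℝ, 0 ≤ D1 → D1 ≤ D0 + DA + ∑ p ∈ PP n M, DB p → 1 + N ≤ G * x →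
        ‖∫ t, Fz S K c z lam (fun _ => 1) t‖ ≤ D1 * (1 + ‖z‖) * x ^ (-β) →
        ‖∫ t, Fz S K c z lam (fun _ => 1) t‖ ≤ D * (1 + ‖z‖) * (1 + N) ^ (-β) := by
      intro D1 x hD1 hD1' hx hb
      have h1 := pow_cmp (by linarith) hN0 hx hβ0 hβ1
      calc _ ≤ D1 * (1 + ‖z‖) * x ^ (-β) := hb
        _ ≤ D1 * (1 + ‖z‖) * (G * (1 + N) ^ (-β)) :=
          mul_le_mul_of_nonneg_left h1 (by positivity)
        _ = (D1 * G) * ((1 + ‖z‖) * (1 + N) ^ (-β)) := by ring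
        _ ≤ D * ((1 + ‖z‖) * (1 + N) ^ (-β)) :=
          mul_le_mul_of_nonneg_right (mul_le_mul_of_nonneg_right hD1' (by linarith)) (by positivity)
        _ = _ := by ring
    rcases le_or_gt N 1 with h1 | h1
    · refine aux D0 1 hD00 (by linarith) (by linarith) ?_
      rw [one_rpow, mul_one]
      refine le_trans ?_ (le_mul_of_one_le_right hD00 hz1)
      have hi : Integrable ((bx n R).indicator (fun t => C * kernelWeight grp a t)) :=
        (integrable_indicator_iff (isOpen_bx R).measurableSet).2 (hW.const_mul _)
      rw [hD0, ← integral_indicator (isOpen_bx R).measurableSet]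
      refine norm_integral_le_of_norm_le hi ?_
      filter_upwards [ae_U] with t ht
      by_cases h : t ∈ bx n R
      · rw [indicator_of_mem h]
        have := Fz_norm (S := S) (lam := lam) (χ := fun _ => 1) hn hS.hc hR1 hz hs₁ zero_le_one ht h (hKb t ht) (by simp)
        simpa using this
      · rw [indicator_of_notMem h]
        have : K t = 0 := by
          by_contra hne; exact h (hKs hne)
        simp [Fz, this]
    · haveI : Nonempty (Fin n) := ⟨⟨0, hn⟩⟩
      obtain ⟨i, hi⟩ := Finite.exists_max (fun i : Fin n => |lam i.castSucc|)
      have hfin : ∀ x : ℝ, 0 ≤ x → (∀ i : Fin n, |lam i.castSucc| ≤ E * x) →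
          |lam (Fin.last n)| ≤ E * x → 1 + N ≤ G * x := by
        intro x hx h2 h3
        have h4 : ∀ j, |lam j| ≤ E * x := fun j => Fin.lastCases h3 h2 j
        have h5 := sqrt_le_card h4 (by positivity)
        push_cast at h5
        calc 1 + N ≤ 2 * N := by linarith
          _ ≤ 2 * (((n:ℝ) + 1) * (E * x)) := by linarith
          _ = G * x := by rw [hG]; ring
      rcases le_or_gt (E * |lam (Fin.last n)|) |lam i.castSucc| with h2 | h2
      · have hb : 1 + N ≤ G * |lam i.castSucc| := by
          refine hfin _ (abs_nonneg _) (fun j => ?_) ?_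
          · exact (hi j).trans (le_mul_of_one_le_left (abs_nonneg _) hE)
          · refine le_trans ?_ (h2.trans (le_mul_of_one_le_left (abs_nonneg _) hE))
            exact le_mul_of_one_le_left (abs_nonneg _) hE
        have hne : lam i.castSucc ≠ 0 := by
          intro h; rw [h, abs_zero, mul_zero] at hb; linarith
        exact aux DA _ hDA (by linarith) hb (hA z lam i hz hne h2)
      · have hb : 1 + N ≤ G * |lam (Fin.last n)| := by
          refine hfin _ (abs_nonneg _) (fun j => ?_) (le_mul_of_one_le_left (abs_nonneg _) hE)
          exact (hi j).trans h2.le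
        have hne : lam (Fin.last n) ≠ 0 := by
          intro h; rw [h, abs_zero, mul_zero] at hb; linarith
        refine aux (∑ p ∈ PP n M, DB p) _ hsB (by linarith) hb ?_
        rw [Fz_split hn hS hM hc0 hR hRr hLB hKs hK hKb hs₁ hW hz lam, Finset.sum_mul, Finset.sum_mul]
        exact (norm_sum_le _ _).trans (Finset.sum_le_sum fun p hp => hDB p hp z lam hz hne)
  refine ⟨Real.exp (s₁ ^ 2) * (2 + |s₁|) * D, by positivity, fun z lam hz => ?_⟩
  rw [nuHatZ_eq, norm_mul]
  have h1 := exp_sq_bound hz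
  have h2 := key z lam hz
  have hNp : 0 ≤ (1 + Real.sqrt (∑ i, lam i ^ 2)) ^ (-β) :=
    rpow_nonneg (by linarith [Real.sqrt_nonneg (∑ i, lam i ^ 2)]) _
  calc _ ≤ ‖Complex.exp (z ^ 2)‖ * (D * (1 + ‖z‖) * (1 + Real.sqrt (∑ i, lam i ^ 2)) ^ (-β)) :=
        mul_le_mul_of_nonneg_left h2 (norm_nonneg _)
    _ = (‖Complex.exp (z ^ 2)‖ * (1 + ‖z‖)) * (D * (1 + Real.sqrt (∑ i, lam i ^ 2)) ^ (-β)) := by ring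
    _ ≤ (Real.exp (s₁ ^ 2) * (2 + |s₁|)) * (D * (1 + Real.sqrt (∑ i, lam i ^ 2)) ^ (-β)) :=
        mul_le_mul_of_nonneg_right h1 (by positivity)
    _ = _ := by ring

end

section

section planch
open scoped FourierTransform SchwartzMap ContDiff RealInnerProductSpace
variable {V : Type*} [NormedAddCommGroup V] [InnerProductSpace ℝ V] [FiniteDimensional ℝ V]
  [MeasurableSpace V] [BorelSpace V]

lemma fourier_selfadj {f g : V → ℂ} (hf : Integrable f) (hg : Integrable g) :
    ∫ ξ, 𝓕 f ξ • g ξ = ∫ x, f x • 𝓕 g x := by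
  have := VectorFourier.integral_fourierIntegral_smul_eq_flip (L := innerₗ V) (μ := volume)
    (ν := volume) continuous_fourierChar continuous_inner hf hg
  rw [flip_innerₗ] at this
  exact this

lemma fourier_continuous {g : V → ℂ} (hg : Integrable g) : Continuous (𝓕 g) :=
  VectorFourier.fourierIntegral_continuous continuous_fourierChar
    (by exact continuous_inner) hg

lemma planch {g : V → ℂ} (h1 : Integrable g) (h2 : MemLp g 2) :
    eLpNorm (𝓕 g) 2 = eLpNorm g 2 := by
  set G : Lp ℂ 2 (volume : Measure V) := h2.toLp g with hG
  have hae : ∀ᵐ x : V, (𝓕 G : Lp ℂ 2 (volume : Measure V)) x = 𝓕 g x := by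
    refine ae_eq_of_integral_contDiff_smul_eq ((Lp.memLp _).locallyIntegrable (by norm_num))
      (fourier_continuous h1).locallyIntegrable fun φ hφ hφc => ?_
    have hc : HasCompactSupport (fun x => (φ x : ℂ)) := hφc.comp_left (g := Complex.ofReal) rfl
    set ψ : 𝓢(V, ℂ) := hc.toSchwartzMap (Complex.ofRealCLM.contDiff.comp hφ) with hψ
    have hψφ : ∀ x, ψ x = (φ x : ℂ) := fun x => rfl
    have e1 : ∫ x, φ x • (𝓕 G : Lp ℂ 2 (volume : Measure V)) x =
        ((𝓕 G : Lp ℂ 2 (volume : Measure V)) : 𝓢'(V, ℂ)) ψ := by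
      rw [Lp.toTemperedDistribution_apply]
      simp only [hψφ, Complex.coe_smul]
    rw [e1, ← Lp.fourier_toTemperedDistribution_eq, TemperedDistribution.fourier_apply,
      Lp.toTemperedDistribution_apply]
    have e2 : ∫ x, (𝓕 ψ) x • G x = ∫ x, 𝓕 (ψ : V → ℂ) x • g x := by
      refine integral_congr_ae ?_
      filter_upwards [h2.coeFn_toLp] with x hx
      rw [hG, hx, SchwartzMap.fourier_coe]
    rw [e2, fourier_selfadj ψ.integrable h1]
    simp only [hψφ, Complex.coe_smul]
  rw [← eLpNorm_congr_ae hae]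
  have h3 : ‖(𝓕 G : Lp ℂ 2 (volume : Measure V))‖ = ‖G‖ := Lp.norm_fourier_eq G
  rw [Lp.norm_def, Lp.norm_def, ENNReal.toReal_eq_toReal_iff' (Lp.eLpNorm_ne_top _)
    (Lp.eLpNorm_ne_top _)] at h3
  rw [h3, hG, eLpNorm_congr_ae h2.coeFn_toLp]

end planch

end

section

section trans
open scoped FourierTransform SchwartzMap
variable {N : ℕ}

lemma ft_eq (G : (Fin N → ℝ) → ℂ) (ξ : Fin N → ℝ) :
    fourierTransform G ξ = 𝓕 (fun x : EuclideanSpace ℝ (Fin N) => G (WithLp.ofLp x)) (WithLp.toLp 2 ξ) := by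
  rw [Real.fourier_eq', ← (PiLp.volume_preserving_toLp (Fin N)).integral_comp
    (MeasurableEquiv.toLp 2 (Fin N → ℝ)).measurableEmbedding]
  unfold fourierTransform
  refine integral_congr_ae (Eventually.of_forall fun x => ?_)
  simp only [smul_eq_mul]
  congr 2
  rw [PiLp.inner_apply]
  simp only [RCLike.inner_apply, conj_trivial]
  push_cast
  rw [show (∑ i, (ξ i : ℂ) * (x i : ℂ)) = ∑ i, (x i : ℂ) * (ξ i : ℂ) from
    Finset.sum_congr rfl fun i _ => mul_comm _ _]
  ring

lemma ftinv_eq (G : (Fin N → ℝ) → ℂ) (x : Fin N → ℝ) :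
    fourierInv G x = fourierTransform G (-x) := by
  unfold fourierInv fourierTransform
  refine integral_congr_ae (Eventually.of_forall fun ξ => ?_)
  dsimp only
  congr 2
  simp only [Pi.neg_apply, mul_neg, Finset.sum_neg_distrib]
  rw [show (∑ i, x i * ξ i) = ∑ i, ξ i * x i from Finset.sum_congr rfl fun i _ => mul_comm _ _]
  push_cast; ring

lemma eLpNorm_ft {G : (Fin N → ℝ) → ℂ} (h1 : Integrable G) (h2 : MemLp G 2) :
    eLpNorm (fourierTransform G) 2 = eLpNorm G 2 := by
  have hmp := PiLp.volume_preserving_ofLp (Fin N)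
  have hmp' := PiLp.volume_preserving_toLp (Fin N)
  have hG1 : Integrable (G ∘ WithLp.ofLp : EuclideanSpace ℝ (Fin N) → ℂ) :=
    hmp.integrable_comp_of_integrable h1
  have hG2 : MemLp (G ∘ WithLp.ofLp : EuclideanSpace ℝ (Fin N) → ℂ) 2 :=
    h2.comp_measurePreserving hmp
  have e1 : fourierTransform G =
      𝓕 (G ∘ WithLp.ofLp : EuclideanSpace ℝ (Fin N) → ℂ) ∘ (WithLp.toLp 2 : (Fin N → ℝ) → _) :=
    funext fun ξ => ft_eq G ξ
  rw [e1, eLpNorm_comp_measurePreserving (fourier_continuous hG1).aestronglyMeasurable hmp',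
    planch hG1 hG2, eLpNorm_comp_measurePreserving h1.aestronglyMeasurable hmp]

lemma ft_continuous {G : (Fin N → ℝ) → ℂ} (h1 : Integrable G) : Continuous (fourierTransform G) := by
  have hG1 : Integrable (G ∘ WithLp.ofLp : EuclideanSpace ℝ (Fin N) → ℂ) :=
    (PiLp.volume_preserving_ofLp (Fin N)).integrable_comp_of_integrable h1
  have e1 : fourierTransform G =
      𝓕 (G ∘ WithLp.ofLp : EuclideanSpace ℝ (Fin N) → ℂ) ∘ (WithLp.toLp 2 : (Fin N → ℝ) → _) :=
    funext fun ξ => ft_eq G ξ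
  rw [e1]
  exact (fourier_continuous hG1).comp (PiLp.continuous_toLp 2 _)

lemma eLpNorm_ftinv {G : (Fin N → ℝ) → ℂ} (h1 : Integrable G) (h2 : MemLp G 2) :
    eLpNorm (fourierInv G) 2 = eLpNorm G 2 := by
  have e1 : fourierInv G = fourierTransform G ∘ Neg.neg := funext fun x => ftinv_eq G x
  rw [e1, eLpNorm_comp_measurePreserving (ft_continuous h1).aestronglyMeasurable
    (Measure.measurePreserving_neg _), eLpNorm_ft h1 h2]

lemma ft_schwartz (f : 𝓢(Fin N → ℝ, ℂ)) :
    Integrable (fourierTransform f) ∧ MemLp (fourierTransform f) 2 := by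
  set L := (EuclideanSpace.equiv (Fin N) ℝ) with hL
  set f' : 𝓢(EuclideanSpace ℝ (Fin N), ℂ) := SchwartzMap.compCLMOfContinuousLinearEquiv ℂ L f with hf'
  have e1 : fourierTransform f = (𝓕 f' : 𝓢(EuclideanSpace ℝ (Fin N), ℂ)) ∘
      (WithLp.toLp 2 : (Fin N → ℝ) → _) := by
    funext ξ
    rw [ft_eq, Function.comp_apply, SchwartzMap.fourier_coe]
    rfl
  have hmp' := PiLp.volume_preserving_toLp (Fin N)
  rw [e1]
  exact ⟨hmp'.integrable_comp_of_integrable (𝓕 f').integrable,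
    ((𝓕 f').memLp 2).comp_measurePreserving hmp'⟩

end trans

end

section

/-- character -/
def ec {N : ℕ} (x ξ : Fin N → ℝ) : ℂ :=
  Complex.exp (-2 * (Real.pi : ℂ) * Complex.I * ((∑ i, x i * ξ i : ℝ) : ℂ))

lemma ec_eq_osc {N : ℕ} (x ξ : Fin N → ℝ) : ec x ξ = osc (∑ i, (-2 * Real.pi * ξ i) * x i) := by
  unfold ec osc
  congr 1
  have : (∑ i, (-2 * Real.pi * ξ i) * x i) = (-2 * Real.pi) * ∑ i, x i * ξ i := by
    rw [Finset.mul_sum]; exact Finset.sum_congr rfl fun i _ => by ring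
  rw [this]; push_cast; ring

lemma ec_norm {N : ℕ} (x ξ : Fin N → ℝ) : ‖ec x ξ‖ = 1 := by rw [ec_eq_osc, norm_osc]

lemma ec_add {N : ℕ} (x y ξ : Fin N → ℝ) : ec (x + y) ξ = ec x ξ * ec y ξ := by
  unfold ec
  rw [← Complex.exp_add]
  congr 1
  simp only [Pi.add_apply, add_mul, Finset.sum_add_distrib]
  push_cast; ring

lemma ec_continuous {N : ℕ} (ξ : Fin N → ℝ) : Continuous (fun x => ec x ξ) := by
  unfold ec; fun_prop

lemma ft_conv {N : ℕ} {H : (Fin n → ℝ) → ℂ} (hH : Integrable H) {γ : (Fin n → ℝ) → (Fin N → ℝ)}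
    (hγ : Measurable γ) {f : (Fin N → ℝ) → ℂ} (hf : Integrable f) (hfc : Continuous f)
    (ξ : Fin N → ℝ) :
    fourierTransform (fun x => ∫ t, H t * f (x - γ t)) ξ =
      (∫ t, ec (γ t) ξ * H t) * fourierTransform f ξ := by
  have hintg : Integrable (Function.uncurry fun (x : Fin N → ℝ) (t : Fin n → ℝ) =>
      ec x ξ * (H t * f (x - γ t))) (volume.prod volume) := by
    have hm : AEStronglyMeasurable (Function.uncurry fun (x : Fin N → ℝ) (t : Fin n → ℝ) =>
      ec x ξ * (H t * f (x - γ t))) (volume.prod volume) := by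
      refine AEStronglyMeasurable.mul ?_ (AEStronglyMeasurable.mul ?_ ?_)
      · exact ((ec_continuous ξ).measurable.comp measurable_fst).aestronglyMeasurable
      · exact hH.aestronglyMeasurable.comp_snd
      · exact (hfc.measurable.comp (measurable_fst.sub (hγ.comp measurable_snd))).aestronglyMeasurable
    rw [integrable_prod_iff' hm]
    constructor
    · refine Eventually.of_forall fun t => ?_
      have h1 : Integrable (fun x => H t * f (x - γ t)) := (hf.comp_sub_right (γ t)).const_mul _
      exact h1.bdd_mul (c := 1) (ec_continuous ξ).aestronglyMeasurable
        (Eventually.of_forall fun x => (ec_norm x ξ).le)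
    · have : (fun t : Fin n → ℝ => ∫ x : Fin N → ℝ, ‖Function.uncurry (fun (x : Fin N → ℝ) (t : Fin n → ℝ) =>
          ec x ξ * (H t * f (x - γ t))) (x, t)‖) = fun t => ‖H t‖ * ∫ x, ‖f x‖ := by
        funext t
        simp only [Function.uncurry_apply_pair, norm_mul, ec_norm, one_mul]
        rw [integral_const_mul, integral_sub_right_eq_self (fun x => ‖f x‖) (γ t)]
      rw [this]
      exact hH.norm.mul_const _
  have e1 : fourierTransform (fun x => ∫ t, H t * f (x - γ t)) ξ =
      ∫ x, ∫ t, ec x ξ * (H t * f (x - γ t)) := by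
    unfold fourierTransform
    refine integral_congr_ae (Eventually.of_forall fun x => ?_)
    dsimp only
    rw [← integral_const_mul]; rfl
  rw [e1, integral_integral_swap hintg, ← integral_mul_const]
  refine integral_congr_ae (Eventually.of_forall fun t => ?_)
  dsimp only
  have e2 : ∀ x, ec x ξ * (H t * f (x - γ t)) =
      (fun y => ec (γ t) ξ * H t * (ec y ξ * f y)) (x - γ t) := by
    intro x
    dsimp only
    have : ec x ξ = ec (x - γ t) ξ * ec (γ t) ξ := by rw [← ec_add, sub_add_cancel]
    rw [this]; ring
  simp only [e2]
  rw [integral_sub_right_eq_self (fun y => ec (γ t) ξ * H t * (ec y ξ * f y)) (γ t),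
    integral_const_mul]
  rfl

variable {S : (Fin n → ℝ) → ℝ} {c : (Fin n → ℕ) → ℝ} {r0 R : ℝ} {u : (Fin n → ℕ) → ℝ}
  {grp : Fin n → Fin m} {a : Fin m → ℝ} {K : (Fin n → ℝ) → ℝ} {s₁ : ℝ} {z : ℂ}

lemma H_integrable (hn : 0 < n) (hS : SD S c r0 u) (hR : 0 < R) (hRr : 2 * R ≤ r0)
    (hKs : Function.support K ⊆ bx n R) (hK : ContinuousOn K {t | ∀ i, t i ≠ 0}) {C : ℝ}
    (hKb : ∀ t : Fin n → ℝ, (∀ i, t i ≠ 0) → |K t| ≤ C * kernelWeight grp a t)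
    (hs₁ : 0 ≤ s₁) (hW : IntegrableOn (kernelWeight grp a) (bx n R)) (hz : z.re = s₁) :
    Integrable (fun t => (minFactor c t : ℂ) ^ z * (K t : ℂ)) := by
  have := Fz_integrable (lam := 0) (χ := fun _ => 1) hn hS hR hRr hKs hK hKb hW continuousOn_const zero_le_one
    (fun t _ _ => by simp) hz hs₁
  refine this.congr (Eventually.of_forall fun t => ?_)
  simp [Fz, osc, ph]

lemma nuHat_continuous (hH : ∀ lam, Integrable (Fz S K c z lam (fun _ => 1))) :
    Continuous (nuHatZ S K c z) := by
  have e : nuHatZ S K c z = fun lam => Complex.exp (z ^ 2) * ∫ t, Fz S K c z lam (fun _ => 1) t :=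
    funext fun lam => nuHatZ_eq z lam
  rw [e]
  refine continuous_const.mul (continuous_of_dominated (fun lam => (hH lam).aestronglyMeasurable)
    (bound := fun t => ‖Fz S K c z 0 (fun _ => 1) t‖) (fun lam => Eventually.of_forall fun t => ?_)
    (hH 0).norm (Eventually.of_forall fun t => ?_))
  · simp only [Fz, norm_mul, norm_osc]; exact le_rfl
  · unfold Fz osc ph; fun_prop

lemma ft_radon (hS : SD S c r0 u) (hR : 0 < R) (hRr : 2 * R ≤ r0)
    (hKs : Function.support K ⊆ bx n R)
    (hH : Integrable (fun t => (minFactor c t : ℂ) ^ z * (K t : ℂ)))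
    {f : (Fin (n+1) → ℝ) → ℂ} (hf : Integrable f) (hfc : Continuous f) (ξ : Fin (n+1) → ℝ) :
    fourierTransform (radonOpZ S K c z f) ξ =
      nuHatZ S K c z (fun i => -2 * Real.pi * ξ i) * fourierTransform f ξ := by
  set S' : (Fin n → ℝ) → ℝ := (bx n r0).indicator S with hS'
  have hS'm : Measurable S' := by
    classical
    have h1 : ContinuousOn S (bx n r0) := (S_continuousOn hS).mono fun t ht i => ht i
    have := ContinuousOn.measurable_piecewise (s := bx n r0) h1
      (continuousOn_const (c := (0:ℝ))) (isOpen_bx r0).measurableSet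
    rw [hS', ← Set.piecewise_eq_indicator]
    exact this
  set γ : (Fin n → ℝ) → (Fin (n+1) → ℝ) := fun t => Fin.snoc (α := fun _ => ℝ) t (S' t) with hγ
  have hγm : Measurable γ := by
    refine measurable_pi_lambda _ fun j => ?_
    refine Fin.lastCases ?_ (fun i => ?_) j
    · simp only [hγ, Fin.snoc_last]; exact hS'm
    · simp only [hγ, Fin.snoc_castSucc]; exact measurable_pi_apply i
  have hSS : ∀ t, K t ≠ 0 → S' t = S t := fun t ht =>
    indicator_of_mem (show t ∈ bx n r0 from fun i => (hKs ht i).trans (by linarith)) S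
  have e1 : radonOpZ S K c z f = fun x => Complex.exp (z ^ 2) *
      ∫ t, ((minFactor c t : ℂ) ^ z * (K t : ℂ)) * f (x - γ t) := by
    funext x
    unfold radonOpZ
    congr 1
    refine integral_congr_ae (Eventually.of_forall fun t => ?_)
    dsimp only
    by_cases h : K t = 0
    · simp [h]
    · rw [hγ]; dsimp only; rw [hSS t h]; rfl
  have e2 : fourierTransform (radonOpZ S K c z f) ξ = Complex.exp (z ^ 2) *
      fourierTransform (fun x => ∫ t, ((minFactor c t : ℂ) ^ z * (K t : ℂ)) * f (x - γ t)) ξ := by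
    rw [e1]
    unfold fourierTransform
    rw [← integral_const_mul]
    refine integral_congr_ae (Eventually.of_forall fun t => ?_)
    dsimp only; ring
  rw [e2, ft_conv hH hγm hf hfc, nuHatZ_eq, ← mul_assoc]
  congr 2
  refine integral_congr_ae (Eventually.of_forall fun t => ?_)
  dsimp only
  by_cases h : K t = 0
  · simp [h, Fz]
  · rw [ec_eq_osc, Fz]
    have : ∑ i, -2 * Real.pi * ξ i * γ t i = ph S (fun i => -2 * Real.pi * ξ i) t := by
      rw [Fin.sum_univ_castSucc]
      simp only [hγ, Fin.snoc_last, Fin.snoc_castSucc, hSS t h, ph]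
    rw [this]; simp

lemma sob_bound (hn : 0 < n) (hS : SD S c r0 u) (hR : 0 < R) (hRr : 2 * R ≤ r0)
    (hKs : Function.support K ⊆ bx n R) (hK : ContinuousOn K {t | ∀ i, t i ≠ 0}) {C : ℝ}
    (hKb : ∀ t : Fin n → ℝ, (∀ i, t i ≠ 0) → |K t| ≤ C * kernelWeight grp a t)
    (hs₁ : 0 ≤ s₁) (hW : IntegrableOn (kernelWeight grp a) (bx n R)) (hz : z.re = s₁)
    {D β : ℝ} (hD : 0 ≤ D) (hβ : 0 ≤ β)
    (hnu : ∀ lam, ‖nuHatZ S K c z lam‖ ≤ D * (1 + Real.sqrt (∑ i, lam i ^ 2)) ^ (-β))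
    (f : SchwartzMap (Fin (n+1) → ℝ) ℂ) :
    eLpNorm (besselPotential β (radonOpZ S K c z ⇑f)) 2 volume ≤
            ENNReal.ofReal D * eLpNorm (⇑f) 2 volume := by
  have hH := H_integrable hn hS hR hRr hKs hK hKb hs₁ hW hz
  have hF : ∀ lam, Integrable (Fz S K c z lam (fun _ => 1)) := fun lam =>
    Fz_integrable hn hS hR hRr hKs hK hKb hW continuousOn_const zero_le_one
    (fun t _ _ => by simp) hz hs₁
  have hnc := nuHat_continuous hF
  obtain ⟨hf1, hf2⟩ := ft_schwartz f
  set g : (Fin (n+1) → ℝ) → ℂ := fun ξ => (((1 + ∑ i, ξ i ^ 2) ^ (β / 2) : ℝ) : ℂ) *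
    fourierTransform (radonOpZ S K c z ⇑f) ξ with hg
  have hge : g = fun ξ => ((((1 + ∑ i, ξ i ^ 2) ^ (β / 2) : ℝ) : ℂ) *
      nuHatZ S K c z (fun i => -2 * Real.pi * ξ i)) * fourierTransform f ξ := by
    funext ξ
    rw [hg]; dsimp only
    rw [ft_radon hS hR hRr hKs hH f.integrable f.continuous, mul_assoc]
  have hpos : ∀ ξ : Fin (n+1) → ℝ, 0 < 1 + ∑ i, ξ i ^ 2 := fun ξ => by positivity
  have hmc : Continuous (fun ξ : Fin (n+1) → ℝ => (((1 + ∑ i, ξ i ^ 2) ^ (β / 2) : ℝ) : ℂ) *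
      nuHatZ S K c z (fun i => -2 * Real.pi * ξ i)) := by
    refine Continuous.mul (Complex.continuous_ofReal.comp ?_) (hnc.comp (by fun_prop))
    exact Continuous.rpow_const (by fun_prop) fun ξ => Or.inl (hpos ξ).ne'
  have hmb : ∀ ξ : Fin (n+1) → ℝ, ‖(((1 + ∑ i, ξ i ^ 2) ^ (β / 2) : ℝ) : ℂ) *
      nuHatZ S K c z (fun i => -2 * Real.pi * ξ i)‖ ≤ D := by
    intro ξ
    rw [norm_mul, Complex.norm_real, Real.norm_of_nonneg (rpow_nonneg (hpos ξ).le _)]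
    set N := Real.sqrt (∑ i, ξ i ^ 2) with hN
    have hN0 : 0 ≤ N := Real.sqrt_nonneg _
    have hN2 : N ^ 2 = ∑ i, ξ i ^ 2 := Real.sq_sqrt (Finset.sum_nonneg fun i _ => sq_nonneg _)
    have h1 := hnu (fun i => -2 * Real.pi * ξ i)
    have h2 : Real.sqrt (∑ i, (-2 * Real.pi * ξ i) ^ 2) = 2 * Real.pi * N := by
      have : ∑ i, (-2 * Real.pi * ξ i) ^ 2 = (2 * Real.pi) ^ 2 * ∑ i, ξ i ^ 2 := by
        rw [Finset.mul_sum]; exact Finset.sum_congr rfl fun i _ => by ring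
      rw [this, Real.sqrt_mul (sq_nonneg _), Real.sqrt_sq (by positivity)]
    rw [h2] at h1
    have hpi := Real.pi_gt_three
    have hb : 0 < 1 + 2 * Real.pi * N := by positivity
    have h3 : (1 + ∑ i, ξ i ^ 2) ^ (β / 2) ≤ (1 + 2 * Real.pi * N) ^ β := by
      have : (1 + 2 * Real.pi * N) ^ β = ((1 + 2 * Real.pi * N) ^ 2) ^ (β / 2) := by
        rw [← rpow_natCast, ← rpow_mul hb.le]; congr 1; push_cast; ring
      rw [this, ← hN2]
      refine rpow_le_rpow (by positivity) ?_ (by linarith)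
      nlinarith [mul_nonneg hN0 hN0, mul_nonneg (by linarith : (0:ℝ) ≤ Real.pi - 3) hN0]
    calc _ ≤ (1 + 2 * Real.pi * N) ^ β * (D * (1 + 2 * Real.pi * N) ^ (-β)) :=
          mul_le_mul h3 h1 (norm_nonneg _) (rpow_nonneg hb.le _)
      _ = D * ((1 + 2 * Real.pi * N) ^ β * (1 + 2 * Real.pi * N) ^ (-β)) := by ring
      _ = D := by rw [← rpow_add hb, add_neg_cancel, rpow_zero, mul_one]
  have hgm : AEStronglyMeasurable g := by
    rw [hge]; exact hmc.aestronglyMeasurable.mul hf1.aestronglyMeasurable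
  have hgb : ∀ ξ, ‖g ξ‖ ≤ D * ‖fourierTransform f ξ‖ := fun ξ => by
    rw [hge]; dsimp only; rw [norm_mul]
    exact mul_le_mul_of_nonneg_right (hmb ξ) (norm_nonneg _)
  have hg1 : Integrable g := (hf1.norm.const_mul D).mono' hgm (Eventually.of_forall hgb)
  have hg2 : MemLp g 2 := hf2.of_le_mul hgm (Eventually.of_forall hgb)
  have e3 : besselPotential β (radonOpZ S K c z ⇑f) = fourierInv g := rfl
  rw [e3, eLpNorm_ftinv hg1 hg2, ← eLpNorm_ft f.integrable (f.memLp 2)]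
  exact eLpNorm_le_mul_eLpNorm_of_ae_le_mul (Eventually.of_forall hgb) 2

end

/-- **Lemma 3.2.** For `s₁ > max(0, 1/max(o(S),2) - g)` and `β = 1/max(o(S),2)`,
provided `K` is supported in a sufficiently small neighborhood of the origin, there is
a constant `C_{s₁}` such that for all `z` with `Re(z) = s₁` one has
`|ν̂_z(λ)| ≤ C_{s₁} (1+|λ|)^{-β}` for all `λ ∈ ℝ^{n+1}`; equivalently
`‖T_z f‖_{L²_β} ≤ C_{s₁} ‖f‖_{L²}`. -/
theorem lemma_3_2
    (n m : ℕ) (hn : 0 < n) (hm : 0 < m)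
    (grp : Fin n → Fin m) (hgrp : Function.Surjective grp)
    (l : Fin m → ℕ) (hl : ∀ k, l k = (Finset.univ.filter (fun i => grp i = k)).card)
    (a : Fin m → ℝ) (ha : ∀ k, 0 ≤ a k ∧ a k < l k)
    (S : (Fin n → ℝ) → ℝ) (c : (Fin n → ℕ) → ℝ)
    (hSc : HasTaylorSeriesAtOrigin S c) (hc : c ≠ 0)
    (hS0 : S 0 = 0) (hS1 : fderiv ℝ S 0 = 0)
    (a₀ : ℝ) (d₀ : ℕ) (ha₀ : IsSublevelExponent grp a c a₀ d₀)
    (oS : ℕ) (hoS : newtonOrder c = (oS : ℕ∞))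
    (g : ℝ) (hg : g = min a₀ (⨅ k, ((l k : ℝ) - a k)))
    (s₁ : ℝ) (hs₁ : max 0 (1 / max (oS : ℝ) 2 - g) < s₁) :
    ∃ V ∈ 𝓝 (0 : Fin n → ℝ), ∀ K : (Fin n → ℝ) → ℝ,
      Function.support K ⊆ V → KernelBounds grp a K →
      ∃ C : ℝ, 0 ≤ C ∧ ∀ z : ℂ, z.re = s₁ →
        (∀ lam : Fin (n+1) → ℝ,
          ‖nuHatZ S K c z lam‖ ≤
            C * (1 + Real.sqrt (∑ i, lam i ^ 2)) ^ (-(1 / max (oS : ℝ) 2))) ∧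
        ∀ f : SchwartzMap (Fin (n+1) → ℝ) ℂ,
          eLpNorm (besselPotential (1 / max (oS : ℝ) 2) (radonOpZ S K c z ⇑f)) 2 volume ≤
            ENNReal.ofReal C * eLpNorm (⇑f) 2 volume := by
  have hMc : ((max oS 2 : ℕ) : ℝ) = max (oS : ℝ) 2 := by push_cast; rfl
  rw [← hMc] at hs₁ ⊢
  set M : ℕ := max oS 2 with hMdef
  have hM : 2 ≤ M := le_max_right _ _
  have hM' : (2:ℝ) ≤ (M:ℝ) := by exact_mod_cast hM
  have hβ0 : 0 ≤ 1 / (M:ℝ) := by positivity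
  have hβ1 : 1 / (M:ℝ) ≤ 1 / 2 := one_div_le_one_div_of_le (by norm_num) hM'
  have hs0 : 0 < s₁ := (le_max_left _ _).trans_lt hs₁
  have hsg : 1 / (M:ℝ) - g < s₁ := (le_max_right _ _).trans_lt hs₁
  obtain ⟨r0, u, hS⟩ := exists_SD hc hSc
  obtain ⟨r, c0, hr, hrr, hc0, hLB⟩ := lower_bound hS (coeff_zero hSc hS0)
    (fun i => coeff_single hSc hS0 hS1 i) hoS
  obtain ⟨-, -, r₀, hr₀, hsub⟩ := ha₀
  have hga : g ≤ a₀ := hg ▸ min_le_left _ _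
  have hgl : ∀ k, g ≤ l k - a k := fun k => (hg ▸ min_le_right _ _ : g ≤ _).trans
    (ciInf_le (Set.finite_range _).bddBelow k)
  have hlt := hS.lt
  set R : ℝ := min r r₀ / 2 with hRdef
  have hmr : min r r₀ ≤ r := min_le_left _ _
  have hmr' : min r r₀ ≤ r₀ := min_le_right _ _
  have hmp : 0 < min r r₀ := lt_min hr hr₀
  have hR : 0 < R := by rw [hRdef]; linarith
  have h2R : 2 * R ≤ r := by rw [hRdef]; linarith
  have hRr₀ : R < r₀ := by rw [hRdef]; linarith
  have hR1 : R ≤ 1 := by linarith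
  refine ⟨bx n R, (isOpen_bx R).mem_nhds (fun i => by simpa using hR), ?_⟩
  intro K hKs hKB
  obtain ⟨hK, C, hC⟩ := hKB
  obtain ⟨b, B, hb, hB, hbB⟩ := hsub R hR hRr₀
  have hW := weight_integrable0 hn hgrp hl ha hR
  have hI1 := I1 (s := s₁) (β := 1 / (M:ℝ)) hc hB hR1 (fun ε h1 h2 => (hbB ε h1 h2).2.le) hW
    (by linarith)
  have hI2 := I2 (s := s₁) (β := 1 / (M:ℝ)) hn hgrp hl ha hR hR1 (by linarith)
    (fun k => by have := hgl k; linarith)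
  have hC' : ∀ t : Fin n → ℝ, (∀ i, t i ≠ 0) → |K t| ≤ max C 0 * kernelWeight grp a t ∧
      ∀ i : Fin n, |fderiv ℝ K t (Pi.single i 1)| ≤ max C 0 / |t i| * kernelWeight grp a t := by
    intro t ht
    have hw : 0 ≤ kernelWeight grp a t := kernelWeight_nonneg t
    refine ⟨(hC t ht).1.trans (mul_le_mul_of_nonneg_right (le_max_left _ _) hw), fun i =>
      ((hC t ht).2 i).trans (mul_le_mul_of_nonneg_right ?_ hw)⟩
    exact div_le_div_of_nonneg_right (le_max_left _ _) (abs_nonneg _)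
  have hLB' : LB c M (2 * R) c0 := fun t ht htr => hLB t ht fun i => (htr i).trans_le h2R
  obtain ⟨D, hD, hnu⟩ := nu_bound hn hS hM hc0 hR (h2R.trans hrr) hLB' hgrp (fun k => (ha k).1)
    hKs hK (le_max_right C 0) hC' hs0.le hW hI1 hI2
  refine ⟨D, hD, fun z hz => ⟨fun lam => hnu z lam hz, fun f => ?_⟩⟩
  exact sob_bound hn hS hR (h2R.trans hrr) hKs hK.continuousOn (fun t ht => (hC' t ht).1) hs0.le hW hz
    hD hβ0 (fun lam => hnu z lam hz) f

end Paper
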